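/- arXiv:2410.04745 — 4 statements merged into one kernel-verified Lean document; each statement's English description precedes it below -/
import Mathlib

section
/- In the two-asset Merton jump-diffusion model (i.e., when f is the bivariate normal density with mean μ̃ = (μ̃x, μ̃y) and positive definite covariance matrix C_M), for every z ∈ ℝ² and Δτ > 0 the Green's function g(z,Δτ) equals the sum g₀(z,Δτ) + Σ_{k=1}^∞ g_k(z,Δτ), where g₀(z,Δτ) = exp( θ − ½ (β+z)ᵀ C⁻¹ (β+z) ) / (2π √(det C)) and, for k ≥ 1, g_k(z,Δτ) = ((λΔτ)^k / k!) · exp( θ − ½ (β + z + k μ̃)ᵀ (C + k C_M)⁻¹ (β + z + k μ̃) ) / (2π √(det(C + k C_M))). -/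
open MeasureTheory Matrix
open scoped BigOperators

noncomputable section

/-- The diffusion covariance matrix `C̃`. -/
def covMat (σx σy ρ : ℝ) : Matrix (Fin 2) (Fin 2) ℝ :=
  !![σx ^ 2, ρ * σx * σy; ρ * σx * σy, σy ^ 2]

/-- The drift vector `β̃`. -/
def driftVec (r lam σx σy κx κy : ℝ) : Fin 2 → ℝ :=
  ![r - lam * κx - σx ^ 2 / 2, r - lam * κy - σy ^ 2 / 2]

/-- The jump covariance matrix `C_M`. -/
def jumpCov (σtx σty ρh : ℝ) : Matrix (Fin 2) (Fin 2) ℝ :=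
  !![σtx ^ 2, ρh * σtx * σty; ρh * σtx * σty, σty ^ 2]

/-- The bivariate normal (Merton) jump density with mean `(μx, μy)`,
standard deviations `σtx, σty` and correlation `ρh`. -/
def mertonDensity (μx μy σtx σty ρh : ℝ) (s : Fin 2 → ℝ) : ℝ :=
  1 / (2 * Real.pi * σtx * σty * Real.sqrt (1 - ρh ^ 2)) *
    Real.exp (-1 / (2 * (1 - ρh ^ 2)) *
      (((s 0 - μx) / σtx) ^ 2 - 2 * ρh * ((s 0 - μx) * (s 1 - μy) / (σtx * σty))
        + ((s 1 - μy) / σty) ^ 2))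

/-- `Γ(η) = ∫ f(s) e^{i η·s} ds`. -/
def jumpSymbol (f : (Fin 2 → ℝ) → ℝ) (η : Fin 2 → ℝ) : ℂ :=
  ∫ s : Fin 2 → ℝ, Complex.ofReal (f s) * Complex.exp (Complex.I * Complex.ofReal (η ⬝ᵥ s))

/-- The symbol `Ψ(η) = −½ ηᵀ C̃ η + i β̃·η − (r+λ) + λ Γ(η)`. -/
def symbolPsi (r lam σx σy ρ κx κy : ℝ) (f : (Fin 2 → ℝ) → ℝ) (η : Fin 2 → ℝ) : ℂ :=
  Complex.ofReal (-(1 / 2) * (η ⬝ᵥ (covMat σx σy ρ).mulVec η))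
    + Complex.I * Complex.ofReal (driftVec r lam σx σy κx κy ⬝ᵥ η)
    - Complex.ofReal (r + lam) + Complex.ofReal lam * jumpSymbol f η

/-- The Green's function `g(z, Δτ) = (2π)⁻² ∫ e^{i η·z} e^{Ψ(η)Δτ} dη`. -/
def greenFn (r lam σx σy ρ κx κy : ℝ) (f : (Fin 2 → ℝ) → ℝ) (Δτ : ℝ) (z : Fin 2 → ℝ) : ℂ :=
  Complex.ofReal (1 / (2 * Real.pi) ^ 2) *
    ∫ η : Fin 2 → ℝ,
      Complex.exp (Complex.I * Complex.ofReal (η ⬝ᵥ z)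
        + symbolPsi r lam σx σy ρ κx κy f η * Complex.ofReal Δτ)

/-- The `k`-th closed-form term of the Merton series: for `k = 0` this is
`exp(θ − ½(β+z)ᵀC⁻¹(β+z)) / (2π √(det C))`, and for `k ≥ 1` it is
`((λΔτ)^k/k!) exp(θ − ½(β+z+kμ̃)ᵀ(C+kC_M)⁻¹(β+z+kμ̃)) / (2π √(det(C+kC_M)))`. -/
def mertonTerm (lam Δτ : ℝ) (C CM : Matrix (Fin 2) (Fin 2) ℝ) (β μ z : Fin 2 → ℝ) (θ : ℝ)
    (k : ℕ) : ℝ :=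
  (lam * Δτ) ^ k / (k.factorial : ℝ) *
    Real.exp (θ - 1 / 2 *
      ((β + z + (k : ℝ) • μ) ⬝ᵥ ((C + (k : ℝ) • CM)⁻¹).mulVec (β + z + (k : ℝ) • μ))) /
    (2 * Real.pi * Real.sqrt (C + (k : ℝ) • CM).det)

theorem gauss1 (p : ℝ) (hp : 0 < p) (u d : ℂ) :
    Integrable (fun x : ℝ => Complex.exp (-(p/2) * x^2 + u * x + d)) ∧
    ∫ x : ℝ, Complex.exp (-(p/2) * x^2 + u * x + d) =
      (Real.sqrt (2 * Real.pi / p) : ℝ) * Complex.exp (d + u^2 / (2 * p)) := by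
  have hb : (-(p/2) : ℂ).re < 0 := by
    have : (-(p/2) : ℂ) = ((-(p/2) : ℝ) : ℂ) := by push_cast; rfl
    rw [this, Complex.ofReal_re]; linarith
  refine ⟨integrable_cexp_quadratic' hb u d, ?_⟩
  rw [integral_cexp_quadratic hb]
  have hp' : (p : ℂ) ≠ 0 := by exact_mod_cast hp.ne'
  congr 1
  · rw [Real.sqrt_eq_rpow, Complex.ofReal_cpow (by positivity)]
    congr 1
    · push_cast; field_simp
    · norm_num
  · congr 1; field_simp; ring

theorem gauss2 (a b c : ℝ) (hc : 0 < c) (hD : 0 < a * c - b^2) (u v d : ℂ) :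
    Integrable (fun s : Fin 2 → ℝ => Complex.exp (-(a * (s 0)^2 + 2 * b * s 0 * s 1 + c * (s 1)^2) / 2
       + u * s 0 + v * s 1 + d)) ∧
    ∫ s : Fin 2 → ℝ, Complex.exp (-(a * (s 0)^2 + 2 * b * s 0 * s 1 + c * (s 1)^2) / 2
       + u * s 0 + v * s 1 + d) =
      (2 * Real.pi / Real.sqrt (a * c - b^2) : ℝ) *
        Complex.exp (d + (c * u^2 - 2 * b * u * v + a * v^2) / (2 * (a * c - b^2))) := by
  have hq : 0 < (a * c - b^2) / c := by positivity
  obtain ⟨i1, e1⟩ := gauss1 _ hq (u - v * b / c) d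
  obtain ⟨i2, e2⟩ := gauss1 c hc v 0
  have hc' : (c : ℂ) ≠ 0 := by exact_mod_cast hc.ne'
  have hD' : (a * c - b^2 : ℂ) ≠ 0 := by exact_mod_cast hD.ne'
  have hD'' : (c * a - b^2 : ℂ) ≠ 0 := by rw [mul_comm]; exact hD'
  set G : ℝ × ℝ → ℂ := fun p => Complex.exp (-(((a * c - b^2) / c : ℝ)/2) * p.1^2 + (u - v * b / c) * p.1 + d) * Complex.exp (-(c/2) * p.2^2 + v * p.2 + 0) with hG
  have iG : Integrable G := i1.mul_prod i2
  have eG : ∫ p, G p = _ := integral_prod_mul (μ := volume) (ν := volume) (fun x : ℝ => Complex.exp (-(((a * c - b^2) / c : ℝ)/2) * x^2 + (u - v * b / c) * x + d)) (fun x : ℝ => Complex.exp (-(c/2) * x^2 + v * x + 0))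
  have hT : MeasurePreserving (fun p : ℝ × ℝ => (p.1, p.2 + b / c * p.1)) := by
    refine MeasurePreserving.skew_product (g := fun x y => y + b / c * x) (MeasurePreserving.id volume) (by fun_prop) ?_
    exact Filter.Eventually.of_forall fun x => (measurePreserving_add_right volume (b / c * x)).map_eq
  have hS := hT.comp (volume_preserving_finTwoArrow ℝ)
  have hGc : Continuous G := by fun_prop
  have key : (fun s : Fin 2 → ℝ => Complex.exp (-(a * (s 0)^2 + 2 * b * s 0 * s 1 + c * (s 1)^2) / 2
       + u * s 0 + v * s 1 + d)) = G ∘ ((fun p : ℝ × ℝ => (p.1, p.2 + b / c * p.1)) ∘ MeasurableEquiv.finTwoArrow) := by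
    funext s
    simp only [hG, Function.comp, MeasurableEquiv.finTwoArrow_apply, ← Complex.exp_add]
    congr 1
    push_cast
    field_simp
    ring
  constructor
  · rw [key]; exact (hS.integrable_comp hGc.aestronglyMeasurable).2 iG
  · rw [key]
    have := integral_map (μ := volume) hS.measurable.aemeasurable (f := G) (hS.map_eq ▸ hGc.aestronglyMeasurable)
    rw [hS.map_eq] at this
    simp only [Function.comp_def] at this ⊢
    rw [← this, eG, e1, e2, mul_mul_mul_comm, ← Complex.exp_add, ← Complex.ofReal_mul,
      ← Real.sqrt_mul (by positivity)]
    congr 2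
    · rw [show 2 * Real.pi / ((a * c - b^2) / c) * (2 * Real.pi / c) = (2 * Real.pi)^2 / (a * c - b^2) by
        field_simp, Real.sqrt_div (by positivity), Real.sqrt_sq (by positivity)]
    · push_cast; field_simp; ring

theorem jumpSymbol_merton (μx μy σtx σty ρh : ℝ)
    (hσtx : 0 < σtx) (hσty : 0 < σty) (hρh₁ : -1 < ρh) (hρh₂ : ρh < 1) (η : Fin 2 → ℝ) :
    jumpSymbol (mertonDensity μx μy σtx σty ρh) η =
      Complex.exp (-(σtx^2 * (η 0)^2 + 2 * (ρh * σtx * σty) * η 0 * η 1 + σty^2 * (η 1)^2) / 2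
        + Complex.I * (η 0 * μx + η 1 * μy)) := by
  have he : 0 < 1 - ρh^2 := by nlinarith
  have he' : (1 - ρh^2 : ℂ) ≠ 0 := by exact_mod_cast he.ne'
  have hx' : (σtx : ℂ) ≠ 0 := by exact_mod_cast hσtx.ne'
  have hy' : (σty : ℂ) ≠ 0 := by exact_mod_cast hσty.ne'
  have hDe : 1 / ((1 - ρh^2) * σtx^2) * (1 / ((1 - ρh^2) * σty^2)) - (-ρh / ((1 - ρh^2) * σtx * σty))^2
      = 1 / ((1 - ρh^2) * (σtx * σty)^2) := by
    field_simp
  have hDe' := congrArg Complex.ofReal hDe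
  obtain ⟨-, e⟩ := gauss2 (1 / ((1 - ρh^2) * σtx^2)) (-ρh / ((1 - ρh^2) * σtx * σty)) (1 / ((1 - ρh^2) * σty^2))
    (by positivity) (by rw [hDe]; positivity) (Complex.I * η 0) (Complex.I * η 1)
    (Complex.I * (η 0 * μx + η 1 * μy))
  unfold jumpSymbol
  rw [← integral_add_right_eq_self _ (![μx, μy] : Fin 2 → ℝ)]
  have key : ∀ s : Fin 2 → ℝ, Complex.ofReal (mertonDensity μx μy σtx σty ρh (s + ![μx, μy])) *
      Complex.exp (Complex.I * Complex.ofReal (η ⬝ᵥ (s + ![μx, μy]))) =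
      ((1 / (2 * Real.pi * σtx * σty * Real.sqrt (1 - ρh ^ 2)) : ℝ) : ℂ) *
      Complex.exp (-((1 / ((1 - ρh^2) * σtx^2) : ℝ) * (s 0)^2
       + 2 * (-ρh / ((1 - ρh^2) * σtx * σty) : ℝ) * s 0 * s 1 + (1 / ((1 - ρh^2) * σty^2) : ℝ) * (s 1)^2) / 2
       + (Complex.I * η 0) * s 0 + (Complex.I * η 1) * s 1 + Complex.I * (η 0 * μx + η 1 * μy)) := by
    intro s
    unfold mertonDensity
    rw [Complex.ofReal_mul, mul_assoc, Complex.ofReal_exp, ← Complex.exp_add]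
    congr 2
    simp [dotProduct, Fin.sum_univ_two]
    field_simp
    ring
  simp_rw [key]
  rw [integral_const_mul, e, ← mul_assoc, ← Complex.ofReal_mul, hDe]
  have h1 : 1 / (2 * Real.pi * σtx * σty * Real.sqrt (1 - ρh ^ 2)) *
      (2 * Real.pi / Real.sqrt (1 / ((1 - ρh^2) * (σtx * σty)^2))) = 1 := by
    rw [Real.sqrt_div zero_le_one, Real.sqrt_one, Real.sqrt_mul he.le, Real.sqrt_sq (by positivity)]
    have := Real.sqrt_pos.2 he
    have := Real.pi_pos
    field_simp
  rw [h1, Complex.ofReal_one, one_mul]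
  congr 1
  push_cast at hDe' ⊢
  rw [hDe', mul_pow, mul_pow, Complex.I_sq]
  have : Complex.I * (η 0 : ℂ) * (Complex.I * η 1) = -(η 0 * η 1) := by
    rw [mul_mul_mul_comm, Complex.I_mul_I]; ring
  rw [mul_assoc (2 * _) _ (Complex.I * _), this]
  field_simp
  ring

/-- The `k`-th term of the expanded integrand. -/
def mertonIntegrand (lam Δτ a b c : ℝ) (α β γ b0 b1 m0 m1 θ : ℝ) (k : ℕ) (η : Fin 2 → ℝ) : ℂ :=
  (((lam * Δτ) ^ k / (k.factorial : ℝ) : ℝ) : ℂ) *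
    Complex.exp (-((a + k * α : ℝ) * (η 0)^2 + 2 * (b + k * β : ℝ) * η 0 * η 1
        + (c + k * γ : ℝ) * (η 1)^2) / 2
       + (Complex.I * (b0 + k * m0 : ℝ)) * η 0 + (Complex.I * (b1 + k * m1 : ℝ)) * η 1 + θ)

theorem quad_nonneg (α β γ x y : ℝ) (hγ : 0 < γ) (hD : 0 < α * γ - β^2) :
    0 ≤ α * x^2 + 2 * β * x * y + γ * y^2 := by
  have : α * x^2 + 2 * β * x * y + γ * y^2 = ((γ * y + β * x)^2 + (α * γ - β^2) * x^2) / γ := by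
    field_simp; ring
  rw [this]; positivity

theorem det_add_pos (a b c α β γ : ℝ) (hc : 0 < c) (hD : 0 < a * c - b^2)
    (hγ : 0 < γ) (hD' : 0 < α * γ - β^2) (t : ℝ) (ht : 0 ≤ t) :
    0 < (a + t * α) * (c + t * γ) - (b + t * β)^2 := by
  have h := quad_nonneg α β γ (c + t * γ) (-(b + t * β)) hγ hD'
  have h2 : 0 < a * (c + t * γ)^2 + 2 * b * (c + t * γ) * (-(b + t * β)) + c * (-(b + t * β))^2 := by
    have hp : 0 < c + t * γ := by positivity
    have : a * (c + t * γ)^2 + 2 * b * (c + t * γ) * (-(b + t * β)) + c * (-(b + t * β))^2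
      = ((c * (-(b + t * β)) + b * (c + t * γ))^2 + (a * c - b^2) * (c + t * γ)^2) / c := by
      field_simp; ring
    rw [this]; positivity
  have h3 : (c + t * γ) * ((a + t * α) * (c + t * γ) - (b + t * β)^2) =
      (a * (c + t * γ)^2 + 2 * b * (c + t * γ) * (-(b + t * β)) + c * (-(b + t * β))^2)
      + t * (α * (c + t * γ)^2 + 2 * β * (c + t * γ) * (-(b + t * β)) + γ * (-(b + t * β))^2) := by
    ring
  have hp : 0 < c + t * γ := by positivity
  have : 0 < (c + t * γ) * ((a + t * α) * (c + t * γ) - (b + t * β)^2) := by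
    rw [h3]; positivity
  exact pos_of_mul_pos_right this hp.le

theorem mertonIntegrand_norm (lam Δτ a b c : ℝ) (α β γ b0 b1 m0 m1 θ : ℝ) (h : 0 ≤ lam * Δτ) 
    (k : ℕ) (η : Fin 2 → ℝ) :
    ‖mertonIntegrand lam Δτ a b c α β γ b0 b1 m0 m1 θ k η‖ =
    (lam * Δτ) ^ k / (k.factorial : ℝ) *
      Real.exp (-((a + k * α) * (η 0)^2 + 2 * (b + k * β) * η 0 * η 1
        + (c + k * γ) * (η 1)^2) / 2 + θ) := by
  unfold mertonIntegrand
  rw [norm_mul, Complex.norm_real, Real.norm_of_nonneg (by positivity), Complex.norm_exp]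
  congr 2
  have : ∀ x y : ℝ, (Complex.I * x * y).re = 0 := by intro x y; simp
  rw [Complex.add_re, Complex.add_re, Complex.add_re, this, this]
  rw [show (-((a + k * α : ℝ) * (η 0)^2 + 2 * (b + k * β : ℝ) * η 0 * η 1
        + (c + k * γ : ℝ) * (η 1)^2) / 2 : ℂ) = ((-((a + k * α : ℝ) * (η 0)^2 + 2 * (b + k * β : ℝ) * η 0 * η 1
        + (c + k * γ : ℝ) * (η 1)^2) / 2 : ℝ) : ℂ) by push_cast; rfl]
  rw [Complex.ofReal_re, Complex.ofReal_re]
  ring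

theorem hasSum_mertonIntegrand (lam Δτ a b c : ℝ) (α β γ b0 b1 m0 m1 θ : ℝ) (h : 0 ≤ lam * Δτ)
    (hc : 0 < c) (hD : 0 < a * c - b^2)
    (hγ : 0 < γ) (hD' : 0 < α * γ - β^2) :
    HasSum (fun k => ∫ η, mertonIntegrand lam Δτ a b c α β γ b0 b1 m0 m1 θ k η)
      (∫ η, ∑' k, mertonIntegrand lam Δτ a b c α β γ b0 b1 m0 m1 θ k η) := by
  have hint : ∀ k, Integrable (mertonIntegrand lam Δτ a b c α β γ b0 b1 m0 m1 θ k) := by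
    intro k
    exact (gauss2 (a + k * α) (b + k * β) (c + k * γ) (by positivity)
      (det_add_pos a b c α β γ hc hD hγ hD' k (by positivity)) _ _ _).1.const_mul _
  apply hasSum_integral_of_summable_integral_norm hint
  have h0 := (gauss2 a b c hc hD 0 0 θ).1.norm
  refine Summable.of_nonneg_of_le (fun k => integral_nonneg fun _ => norm_nonneg _) (fun k => ?_)
    ((Real.summable_pow_div_factorial (lam * Δτ)).mul_right (∫ s : Fin 2 → ℝ, ‖Complex.exp (-(a * (s 0)^2 + 2 * b * s 0 * s 1 + c * (s 1)^2) / 2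
       + 0 * s 0 + 0 * s 1 + θ)‖))
  rw [← integral_const_mul]
  refine integral_mono (hint k).norm (h0.const_mul _) fun η => ?_
  dsimp only
  rw [mertonIntegrand_norm _ _ _ _ _ _ _ _ _ _ _ _ _ h, Complex.norm_exp]
  gcongr
  rw [show (-(a * (η 0)^2 + 2 * b * η 0 * η 1 + c * (η 1)^2) / 2
       + 0 * η 0 + 0 * η 1 + θ : ℂ) = ((-(a * (η 0)^2 + 2 * b * η 0 * η 1 + c * (η 1)^2) / 2 + θ : ℝ) : ℂ) by
      push_cast; ring, Complex.ofReal_re]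
  have := mul_nonneg (Nat.cast_nonneg (α := ℝ) k) (quad_nonneg α β γ (η 0) (η 1) hγ hD')
  nlinarith

theorem integral_mertonIntegrand (lam Δτ a b c : ℝ) (α β γ b0 b1 m0 m1 θ : ℝ)
    (hc : 0 < c) (hD : 0 < a * c - b^2)
    (hγ : 0 < γ) (hD' : 0 < α * γ - β^2) (k : ℕ) (C CM : Matrix (Fin 2) (Fin 2) ℝ) (hC : C = !![a, b; b, c])
    (hCM : CM = !![α, β; β, γ]) (B z : Fin 2 → ℝ) (h0 : b0 = B 0 + z 0) (h1 : b1 = B 1 + z 1) :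
    Complex.ofReal (1 / (2 * Real.pi) ^ 2) * ∫ η, mertonIntegrand lam Δτ a b c α β γ b0 b1 m0 m1 θ k η =
     Complex.ofReal (mertonTerm lam Δτ C CM B ![m0, m1] z θ k) := by
  have hd := det_add_pos a b c α β γ hc hD hγ hD' k (by positivity)
  have hCC : C + (k : ℝ) • CM = !![a + k * α, b + k * β; b + k * β, c + k * γ] := by
    subst hC hCM
    ext i j; fin_cases i <;> fin_cases j <;> simp
  unfold mertonIntegrand mertonTerm
  rw [integral_const_mul, (gauss2 (a + k * α) (b + k * β) (c + k * γ) (by positivity) hd _ _ _).2]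
  rw [hCC, Matrix.inv_def, Matrix.det_fin_two_of, Matrix.adjugate_fin_two_of, Ring.inverse_eq_inv',
    ← sq]
  have hv : B + z + (k : ℝ) • ![m0, m1] = ![b0 + k * m0, b1 + k * m1] := by
    ext i; fin_cases i <;> simp [h0, h1]
  rw [hv]
  generalize a + k * α = a' at *
  generalize b + k * β = b' at *
  generalize c + k * γ = c' at *
  generalize b0 + k * m0 = u at *
  generalize b1 + k * m1 = v at *
  have he : (θ : ℂ) + (c' * (Complex.I * u)^2 - 2 * b' * (Complex.I * u) * (Complex.I * v) + a' * (Complex.I * v)^2) / (2 * (a' * c' - b'^2))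
     = ((θ - 1 / 2 * (![u, v] ⬝ᵥ ((a' * c' - b'^2)⁻¹ • !![c', -b'; -b', a']) *ᵥ ![u, v]) : ℝ) : ℂ) := by
    have hd' : (a' * c' - b'^2 : ℂ) ≠ 0 := by exact_mod_cast hd.ne'
    have : 2 * b' * (Complex.I * (u : ℂ)) * (Complex.I * v) = -(2 * b' * u * v) := by
      linear_combination 2 * b' * u * v * Complex.I_mul_I
    rw [this, mul_pow, mul_pow, Complex.I_sq]
    simp [dotProduct, Matrix.mulVec, Fin.sum_univ_two]
    field_simp
    ring
  rw [he]
  norm_cast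
  have := Real.sqrt_pos.2 hd
  field_simp

theorem merton_greens_function_series
    (r lam σx σy ρ κx κy Δτ μx μy σtx σty ρh : ℝ)
    (hr : 0 < r) (hlam : 0 ≤ lam) (hσx : 0 < σx) (hσy : 0 < σy)
    (hρ₁ : -1 < ρ) (hρ₂ : ρ < 1) (hΔτ : 0 < Δτ)
    (hσtx : 0 < σtx) (hσty : 0 < σty) (hρh₁ : -1 < ρh) (hρh₂ : ρh < 1)
    (z : Fin 2 → ℝ) :
    greenFn r lam σx σy ρ κx κy (mertonDensity μx μy σtx σty ρh) Δτ z =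
      Complex.ofReal
        (mertonTerm lam Δτ (Δτ • covMat σx σy ρ) (jumpCov σtx σty ρh)
            (Δτ • driftVec r lam σx σy κx κy) ![μx, μy] z (-(r + lam) * Δτ) 0
          + ∑' k : ℕ,
              mertonTerm lam Δτ (Δτ • covMat σx σy ρ) (jumpCov σtx σty ρh)
                (Δτ • driftVec r lam σx σy κx κy) ![μx, μy] z (-(r + lam) * Δτ) (k + 1)) := by
  have he : 0 < 1 - ρ^2 := by nlinarith
  have heh : 0 < 1 - ρh^2 := by nlinarith
  have hc : 0 < Δτ * σy^2 := by positivity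
  have hD : 0 < (Δτ * σx^2) * (Δτ * σy^2) - (Δτ * (ρ * σx * σy))^2 := by
    have : (Δτ * σx^2) * (Δτ * σy^2) - (Δτ * (ρ * σx * σy))^2 = (1 - ρ^2) * (Δτ * σx * σy)^2 := by ring
    rw [this]; positivity
  have hγ : 0 < σty^2 := by positivity
  have hD' : 0 < σtx^2 * σty^2 - (ρh * σtx * σty)^2 := by
    have : σtx^2 * σty^2 - (ρh * σtx * σty)^2 = (1 - ρh^2) * (σtx * σty)^2 := by ring
    rw [this]; positivity
  have hS := hasSum_mertonIntegrand lam Δτ _ _ _ _ _ _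
    ((Δτ • driftVec r lam σx σy κx κy) 0 + z 0) ((Δτ • driftVec r lam σx σy κx κy) 1 + z 1) μx μy
    (-(r + lam) * Δτ) (by positivity) hc hD hγ hD'
  have hS2 := hS.mul_left (Complex.ofReal (1 / (2 * Real.pi) ^ 2))
  have hterm := fun k => integral_mertonIntegrand lam Δτ _ _ _ _ _ _
    ((Δτ • driftVec r lam σx σy κx κy) 0 + z 0) ((Δτ • driftVec r lam σx σy κx κy) 1 + z 1) μx μy
    (-(r + lam) * Δτ) hc hD hγ hD' k (Δτ • covMat σx σy ρ) (jumpCov σtx σty ρh)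
    (by simp [covMat]) (by simp [jumpCov]) (Δτ • driftVec r lam σx σy κx κy) z rfl rfl
  simp only [hterm] at hS2
  have hpt : ∀ η : Fin 2 → ℝ, Complex.exp (Complex.I * Complex.ofReal (η ⬝ᵥ z)
        + symbolPsi r lam σx σy ρ κx κy (mertonDensity μx μy σtx σty ρh) η * Complex.ofReal Δτ) =
      ∑' k, mertonIntegrand lam Δτ (Δτ * σx^2) (Δτ * (ρ * σx * σy)) (Δτ * σy^2)
        (σtx^2) (ρh * σtx * σty) (σty^2)
        ((Δτ • driftVec r lam σx σy κx κy) 0 + z 0) ((Δτ • driftVec r lam σx σy κx κy) 1 + z 1) μx μy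
        (-(r + lam) * Δτ) k η := by
    intro η
    have hE := (NormedSpace.expSeries_div_hasSum_exp
      ((lam * Δτ : ℂ) * jumpSymbol (mertonDensity μx μy σtx σty ρh) η)).mul_left
      (Complex.exp (Complex.I * Complex.ofReal (η ⬝ᵥ z) +
      (Complex.ofReal (-(1 / 2) * (η ⬝ᵥ (covMat σx σy ρ).mulVec η))
    + Complex.I * Complex.ofReal (driftVec r lam σx σy κx κy ⬝ᵥ η)
    - Complex.ofReal (r + lam)) * Δτ))
    rw [← Complex.exp_eq_exp_ℂ, ← Complex.exp_add] at hE
    have hE2 := hE.tsum_eq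
    rw [show Complex.I * Complex.ofReal (η ⬝ᵥ z)
        + symbolPsi r lam σx σy ρ κx κy (mertonDensity μx μy σtx σty ρh) η * Complex.ofReal Δτ =
        Complex.I * Complex.ofReal (η ⬝ᵥ z) +
      (Complex.ofReal (-(1 / 2) * (η ⬝ᵥ (covMat σx σy ρ).mulVec η))
    + Complex.I * Complex.ofReal (driftVec r lam σx σy κx κy ⬝ᵥ η)
    - Complex.ofReal (r + lam)) * Δτ + (lam * Δτ : ℂ) * jumpSymbol (mertonDensity μx μy σtx σty ρh) η by
      unfold symbolPsi; ring, ← hE2]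
    refine tsum_congr fun k => ?_
    rw [jumpSymbol_merton μx μy σtx σty ρh hσtx hσty hρh₁ hρh₂, mul_pow, ← Complex.exp_nat_mul,
      mul_div_right_comm, mul_left_comm, ← Complex.exp_add]
    unfold mertonIntegrand
    congr 1
    · push_cast; rfl
    · congr 1
      simp [dotProduct, Matrix.mulVec, Fin.sum_univ_two, covMat, driftVec]
      ring
  unfold greenFn
  simp_rw [hpt]
  have hsum : Summable (fun k => mertonTerm lam Δτ (Δτ • covMat σx σy ρ) (jumpCov σtx σty ρh)
            (Δτ • driftVec r lam σx σy κx κy) ![μx, μy] z (-(r + lam) * Δτ) k) :=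
    Complex.summable_ofReal.1 hS2.summable
  rw [← hsum.tsum_eq_zero_add, Complex.ofReal_tsum, hS2.tsum_eq]
end
end

section
/- Let r > 0, λ ≥ 0, σx, σy > 0, ρ ∈ (−1,1), κx, κy ∈ ℝ, and let f be a probability density on ℝ². Then for every Δτ > 0 the Green's function has total mass ∫_{ℝ²} g(z, Δτ) dz = e^{−r Δτ}. -/
open MeasureTheory Matrix

noncomputable section

lemma aux_cov (A : Matrix (Fin 2) (Fin 2) ℝ) (hA : A.det ≠ 0) (F : (Fin 2 → ℝ) → ℂ)
    (hF : Continuous F) :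
    ∫ x, F (A *ᵥ x) = ((|A.det|⁻¹ : ℝ) : ℂ) * ∫ x, F x := by
  have h := Real.map_matrix_volume_pi_eq_smul_volume_pi hA
  have hm : Measurable (Matrix.toLin' A) :=
    (LinearMap.continuous_of_finiteDimensional _).measurable
  have h2 := integral_map (μ := volume) hm.aemeasurable (f := F) hF.aestronglyMeasurable
  rw [h, integral_smul_measure, ENNReal.toReal_ofReal (abs_nonneg _), abs_inv] at h2
  simp only [Matrix.toLin'_apply] at h2
  rw [← h2, Complex.real_smul]

lemma aux_cov_int (A : Matrix (Fin 2) (Fin 2) ℝ) (hA : A.det ≠ 0) (F : (Fin 2 → ℝ) → ℂ)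
    (hF : Continuous F) (hi : Integrable F) :
    Integrable (fun x => F (A *ᵥ x)) := by
  have h := Real.map_matrix_volume_pi_eq_smul_volume_pi hA
  have hm : Measurable (Matrix.toLin' A) :=
    (LinearMap.continuous_of_finiteDimensional _).measurable
  have h2 := integrable_map_measure (μ := volume) (g := F) hF.aestronglyMeasurable hm.aemeasurable
  rw [h] at h2
  exact h2.1 (hi.smul_measure ENNReal.ofReal_ne_top)

/-- compound Poisson measure with prescribed characteristic function -/
lemma aux_measure (f : (Fin 2 → ℝ) → ℝ) (hf_meas : Measurable f) (hf_nonneg : ∀ s, 0 ≤ f s)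
    (hf_prob : ∫ s : Fin 2 → ℝ, f s = 1) (c : ℝ) (hc : 0 ≤ c) :
    ∃ μ : Measure (Fin 2 → ℝ), IsFiniteMeasure μ ∧ ∀ η : Fin 2 → ℝ,
      ∫ s, Complex.exp (Complex.I * Complex.ofReal (η ⬝ᵥ s)) ∂μ
        = Complex.exp (c * jumpSymbol f η) := by
  have hfi : Integrable f := by
    by_contra h
    rw [integral_undef h] at hf_prob
    exact zero_ne_one hf_prob
  set ν : Measure (Fin 2 → ℝ) := volume.withDensity (fun s => ENNReal.ofReal (f s)) with hν
  have hνp : IsProbabilityMeasure ν := by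
    constructor
    rw [hν, withDensity_apply _ MeasurableSet.univ, Measure.restrict_univ,
      ← ofReal_integral_eq_lintegral_ofReal hfi (Filter.Eventually.of_forall hf_nonneg), hf_prob]
    simp
  obtain ⟨κ, hκ0, hκs⟩ : ∃ κ : ℕ → Measure (Fin 2 → ℝ), κ 0 = Measure.dirac 0 ∧
      ∀ n, κ (n + 1) = (κ n).conv ν :=
    ⟨fun n => Nat.rec (Measure.dirac 0) (fun _ m => m.conv ν) n, rfl, fun _ => rfl⟩
  have hκp : ∀ n, IsProbabilityMeasure (κ n) := by
    intro n
    induction n with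
    | zero => rw [hκ0]; infer_instance
    | succ n ih =>
      rw [hκs]
      infer_instance
  let L : (Fin 2 → ℝ) → StrongDual ℝ (Fin 2 → ℝ) := fun η =>
    ∑ i, η i • ContinuousLinearMap.proj (R := ℝ) (φ := fun _ : Fin 2 => ℝ) i
  have hL : ∀ η s, L η s = η ⬝ᵥ s := by
    intro η s
    simp [L, dotProduct]
  have hchar : ∀ (m : Measure (Fin 2 → ℝ)) η,
      ∫ s, Complex.exp (Complex.I * Complex.ofReal (η ⬝ᵥ s)) ∂m = charFunDual m (L η) := by
    intro m η
    rw [charFunDual_apply]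
    simp only [hL, mul_comm]
  have hνchar : ∀ η, charFunDual ν (L η) = jumpSymbol f η := by
    intro η
    rw [← hchar, hν, jumpSymbol, integral_withDensity_eq_integral_toReal_smul
      hf_meas.ennreal_ofReal (by simp)]
    simp [ENNReal.toReal_ofReal (hf_nonneg _)]
  have hκchar : ∀ n η, charFunDual (κ n) (L η) = jumpSymbol f η ^ n := by
    intro n η
    induction n with
    | zero =>
      rw [hκ0]
      simp
    | succ n ih =>
      have := hκp n
      rw [hκs]
      rw [charFunDual_conv, ih, hνchar, pow_succ]
  let w : ℕ → ℝ := fun n => c ^ n / (n.factorial : ℝ)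
  have hw : ∀ n, 0 ≤ w n := fun n => by positivity
  have hws : Summable w := Real.summable_pow_div_factorial c
  let μ : Measure (Fin 2 → ℝ) := Measure.sum (fun n => ENNReal.ofReal (w n) • κ n)
  have hμ : IsFiniteMeasure μ := by
    constructor
    simp only [μ, Measure.sum_apply _ MeasurableSet.univ, Measure.smul_apply, (hκp _).measure_univ,
      smul_eq_mul, mul_one]
    rw [← ENNReal.ofReal_tsum_of_nonneg hw hws]
    exact ENNReal.ofReal_lt_top
  refine ⟨μ, hμ, fun η => ?_⟩
  have hexp_int : Integrable (fun s : Fin 2 → ℝ =>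
      Complex.exp (Complex.I * Complex.ofReal (η ⬝ᵥ s))) μ := by
    refine Integrable.of_bound (C := 1) ?_ ?_
    · apply Continuous.aestronglyMeasurable
      simp only [dotProduct]
      fun_prop
    · refine Filter.Eventually.of_forall fun s => ?_
      rw [mul_comm, Complex.norm_exp_ofReal_mul_I]
  have h1 := hasSum_integral_measure hexp_int
  refine h1.unique ?_
  have h2 := NormedSpace.expSeries_div_hasSum_exp (𝔸 := ℂ) (c * jumpSymbol f η)
  rw [← Complex.exp_eq_exp_ℂ] at h2
  have h3 : (fun i => ∫ x, Complex.exp (Complex.I * Complex.ofReal (η ⬝ᵥ x))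
      ∂(ENNReal.ofReal (w i) • κ i)) =
      fun n : ℕ => ((c : ℂ) * jumpSymbol f η) ^ n / (n.factorial : ℂ) := by
    funext n
    rw [integral_smul_measure, ENNReal.toReal_ofReal (hw n), hchar, hκchar, Complex.real_smul]
    simp only [w]
    push_cast
    rw [mul_pow]
    ring
  rw [h3]
  exact h2

lemma aux_gauss (σx σy ρ : ℝ) (hσx : 0 < σx) (hσy : 0 < σy)
    (hρ₁ : -1 < ρ) (hρ₂ : ρ < 1) (t : ℝ) (ht : 0 < t) :
    let q : (Fin 2 → ℝ) → ℂ := fun η =>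
      Complex.exp (Complex.ofReal (-(1 / 2) * (η ⬝ᵥ (covMat σx σy ρ).mulVec η)) * t)
    let J : (Fin 2 → ℝ) → ℂ := fun z =>
      ∫ η, Complex.exp (Complex.I * Complex.ofReal (η ⬝ᵥ z)) * q η
    Integrable q ∧ Continuous J ∧ Integrable J ∧ ∫ z, J z = (2 * Real.pi) ^ 2 := by
  intro q J
  have hρ : 0 < 1 - ρ ^ 2 := by nlinarith
  set d := Real.sqrt (1 - ρ ^ 2) with hd
  have hdpos : 0 < d := Real.sqrt_pos.2 hρ
  have hd2 : d ^ 2 = 1 - ρ ^ 2 := Real.sq_sqrt hρ.le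
  let A : Matrix (Fin 2) (Fin 2) ℝ := !![σx, ρ * σy; 0, σy * d]
  let B : Matrix (Fin 2) (Fin 2) ℝ := !![1 / σx, 0; -ρ / (σx * d), 1 / (σy * d)]
  have hAd : A.det = σx * (σy * d) := by simp [A, Matrix.det_fin_two]
  have hBd : B.det = 1 / (σx * (σy * d)) := by
    simp only [B, Matrix.det_fin_two]
    simp
    ring
  have hD : 0 < σx * (σy * d) := by positivity
  have hA0 : A.det ≠ 0 := by rw [hAd]; exact hD.ne'
  have hB0 : B.det ≠ 0 := by rw [hBd]; positivity
  have hAB : ∀ η z : Fin 2 → ℝ, η ⬝ᵥ z = ∑ i, (B *ᵥ z) i * (A *ᵥ η) i := by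
    intro η z
    simp [A, B, Matrix.mulVec, dotProduct, Fin.sum_univ_two]
    field_simp
    ring
  have hAC : ∀ η : Fin 2 → ℝ, η ⬝ᵥ (covMat σx σy ρ).mulVec η = ∑ i, (A *ᵥ η) i ^ 2 := by
    intro η
    simp [A, covMat, Matrix.mulVec, dotProduct, Fin.sum_univ_two]
    linear_combination (-(σy ^ 2 * η 1 ^ 2)) * hd2
  have hb : 0 < (((t / 2 : ℝ)) : ℂ).re := by rw [Complex.ofReal_re]; positivity
  have hb' : 0 < (((1 / (2 * t) : ℝ)) : ℂ).re := by rw [Complex.ofReal_re]; positivity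
  let F : (Fin 2 → ℂ) → (Fin 2 → ℝ) → ℂ := fun c v =>
    Complex.exp (-((t / 2 : ℝ) : ℂ) * ∑ i, (v i : ℂ) ^ 2 + ∑ i, c i * v i)
  have hFc : ∀ c, Continuous (F c) := fun c => by simp only [F]; fun_prop
  have hq : q = fun η => F 0 (A *ᵥ η) := by
    funext η
    simp only [q, F, hAC]
    congr 1
    push_cast
    simp
    ring
  have hqi : Integrable q := by
    rw [hq]
    exact aux_cov_int A hA0 _ (hFc 0) (GaussianFourier.integrable_cexp_neg_mul_sum_add hb 0)
  let H : (Fin 2 → ℝ) → ℂ := fun v =>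
    Complex.exp (-((1 / (2 * t) : ℝ) : ℂ) * ∑ i, (v i : ℂ) ^ 2 + ∑ i, (0 : Fin 2 → ℂ) i * v i)
  have hHc : Continuous H := by simp only [H]; fun_prop
  have hpow : ∀ x : ℂ, x ^ ((Fintype.card (Fin 2) : ℂ) / 2) = x := by
    intro x; simp
  have htC : (t : ℂ) ≠ 0 := by exact_mod_cast ht.ne'
  have hJ : J = fun z => ((|A.det|⁻¹ : ℝ) : ℂ) * (Real.pi / ((t / 2 : ℝ) : ℂ)) * H (B *ᵥ z) := by
    funext z
    have e : J z = ∫ η, F (fun i => Complex.I * ((B *ᵥ z) i : ℝ)) (A *ᵥ η) := by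
      simp only [J, hq]
      congr 1
      funext η
      simp only [F, ← Complex.exp_add, hAB]
      congr 1
      push_cast
      simp [Finset.mul_sum]
      ring
    rw [e, aux_cov A hA0 _ (hFc _), mul_assoc]
    congr 1
    simp only [F]
    rw [GaussianFourier.integral_cexp_neg_mul_sum_add hb, hpow]
    congr 1
    simp only [H]
    congr 1
    push_cast
    simp only [mul_pow, Complex.I_sq, Fin.sum_univ_two, Pi.zero_apply]
    field_simp
    ring
  have hHB : Continuous fun z => H (B *ᵥ z) := hHc.comp (by fun_prop)
  refine ⟨hqi, ?_, ?_, ?_⟩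
  · rw [hJ]; exact continuous_const.mul hHB
  · rw [hJ]
    exact (aux_cov_int B hB0 H hHc
      (GaussianFourier.integrable_cexp_neg_mul_sum_add hb' 0)).const_mul _
  · rw [hJ, integral_const_mul, aux_cov B hB0 H hHc]
    simp only [H]
    rw [GaussianFourier.integral_cexp_neg_mul_sum_add hb', hpow, hAd, hBd, abs_of_pos hD,
      abs_of_pos (by positivity : 0 < 1 / (σx * (σy * d)))]
    have hDC : ((σx * (σy * d) : ℝ) : ℂ) ≠ 0 := by exact_mod_cast hD.ne'
    generalize σx * (σy * d) = D at hDC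
    push_cast
    simp
    field_simp

/-- the Green's function has total mass
`∫_{ℝ²} g(z, Δτ) dz = e^{−r Δτ}` for every `Δτ > 0`. -/
theorem greens_function_total_mass
    (r lam σx σy ρ κx κy : ℝ)
    (hr : 0 < r) (hlam : 0 ≤ lam) (hσx : 0 < σx) (hσy : 0 < σy)
    (hρ₁ : -1 < ρ) (hρ₂ : ρ < 1)
    (f : (Fin 2 → ℝ) → ℝ) (hf_meas : Measurable f) (hf_nonneg : ∀ s, 0 ≤ f s)
    (hf_prob : ∫ s : Fin 2 → ℝ, f s = 1)
    (Δτ : ℝ) (hΔτ : 0 < Δτ) :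
    ∫ z : Fin 2 → ℝ, greenFn r lam σx σy ρ κx κy f Δτ z =
      Complex.ofReal (Real.exp (-(r * Δτ))) := by
  obtain ⟨μ, hμ, hchar⟩ := aux_measure f hf_meas hf_nonneg hf_prob (lam * Δτ) (by positivity)
  have hG := aux_gauss σx σy ρ hσx hσy hρ₁ hρ₂ Δτ hΔτ
  extract_lets q J at hG
  obtain ⟨hqi, hJc, hJi, hJ1⟩ := hG
  set b : Fin 2 → ℝ := Δτ • driftVec r lam σx σy κx κy with hbdef
  set K : ℂ := Complex.exp (-(((r + lam) * Δτ : ℝ) : ℂ)) with hK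
  have hec : ∀ z : Fin 2 → ℝ, Continuous fun η : Fin 2 → ℝ =>
      Complex.exp (Complex.I * Complex.ofReal (η ⬝ᵥ z)) := by
    intro z
    simp only [dotProduct]
    fun_prop
  have hgreen : ∀ z, greenFn r lam σx σy ρ κx κy f Δτ z =
      Complex.ofReal (1 / (2 * Real.pi) ^ 2) * (K * ∫ s, J (z + b + s) ∂μ) := by
    intro z
    rw [greenFn]
    congr 1
    have e1 : ∀ η : Fin 2 → ℝ, Complex.exp (Complex.I * Complex.ofReal (η ⬝ᵥ z)
        + symbolPsi r lam σx σy ρ κx κy f η * Complex.ofReal Δτ) =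
        K * ∫ s, Complex.exp (Complex.I * Complex.ofReal (η ⬝ᵥ (z + b + s))) * q η ∂μ := by
      intro η
      have e2 : ∀ s : Fin 2 → ℝ,
          Complex.exp (Complex.I * Complex.ofReal (η ⬝ᵥ (z + b + s))) * q η =
          (Complex.exp (Complex.I * Complex.ofReal (η ⬝ᵥ (z + b))) * q η) *
          Complex.exp (Complex.I * Complex.ofReal (η ⬝ᵥ s)) := by
        intro s
        rw [dotProduct_add η (z + b) s, Complex.ofReal_add, mul_add, Complex.exp_add]
        ring
      simp only [e2]
      rw [integral_const_mul, hchar]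
      simp only [hK, q, ← Complex.exp_add]
      congr 1
      rw [symbolPsi, dotProduct_add, hbdef, dotProduct_smul, dotProduct_comm η (driftVec _ _ _ _ _ _)]
      push_cast
      simp only [smul_eq_mul]
      push_cast
      ring
    simp only [e1]
    rw [integral_const_mul]
    congr 1
    rw [integral_integral_swap]
    have hp : Integrable (fun p : (Fin 2 → ℝ) × (Fin 2 → ℝ) => q p.1 * (1 : ℂ))
        (volume.prod μ) := hqi.mul_prod (integrable_const (1 : ℂ))
    simp only [mul_one] at hp
    refine hp.bdd_mul (c := 1) ?_ ?_
    · apply Continuous.aestronglyMeasurable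
      simp only [dotProduct, Pi.add_apply]
      fun_prop
    · refine Filter.Eventually.of_forall fun p => ?_
      rw [mul_comm, Complex.norm_exp_ofReal_mul_I]
  simp only [hgreen]
  rw [integral_const_mul, integral_const_mul, integral_integral_swap]
  · have e3 : ∀ s : Fin 2 → ℝ, ∫ z, J (z + b + s) = (2 * Real.pi) ^ 2 := by
      intro s
      simp only [add_assoc]
      rw [integral_add_right_eq_self J (b + s), hJ1]
    simp only [e3]
    have hm := hchar 0
    have h0 : jumpSymbol f 0 = 1 := by
      simp only [jumpSymbol, zero_dotProduct, Complex.ofReal_zero, mul_zero, Complex.exp_zero,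
        mul_one]
      rw [integral_complex_ofReal, hf_prob, Complex.ofReal_one]
    simp only [zero_dotProduct, Complex.ofReal_zero, mul_zero, Complex.exp_zero, h0] at hm
    have e4 : ∫ _s : Fin 2 → ℝ, ((2 * Real.pi) ^ 2 : ℂ) ∂μ
        = (2 * Real.pi) ^ 2 * ∫ _s : Fin 2 → ℝ, (1 : ℂ) ∂μ := by
      rw [← integral_const_mul]; simp
    rw [e4, hm]
    have hpi : (Real.pi : ℂ) ≠ 0 := by exact_mod_cast Real.pi_ne_zero
    have e5 : K * Complex.exp (((lam * Δτ : ℝ) : ℂ) * 1) = Complex.exp (-(r * Δτ : ℝ)) := by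
      rw [hK, ← Complex.exp_add]
      congr 1
      push_cast
      ring
    rw [Complex.ofReal_exp, Complex.ofReal_neg, ← e5]
    push_cast
    field_simp
  · rw [integrable_prod_iff']
    · refine ⟨Filter.Eventually.of_forall fun s => ?_, ?_⟩
      · simp only [Function.uncurry, add_assoc]
        exact hJi.comp_add_right (b + s)
      · have : ∀ s : Fin 2 → ℝ, ∫ z, ‖J (z + b + s)‖ = ∫ z, ‖J z‖ := by
          intro s
          simp only [add_assoc]
          exact integral_add_right_eq_self (fun z => ‖J z‖) (b + s)
        simp only [Function.uncurry, this]
        exact integrable_const _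
    · apply Continuous.aestronglyMeasurable
      simp only [Function.uncurry_def]
      exact hJc.comp (by fun_prop)
end
end

section
/- In the two-asset Merton jump-diffusion model with discretization parameter h (Δx = C₁h, Δy = C₂h, Δτ = C₃h, and grid domains of diameter at least C₁'/h and C₂'/h as h → 0), let φ : ℝ² → ℝ be a bounded C^∞ function all of whose partial derivatives are bounded. Then there exist constants C > 0 and h₀ > 0 (depending on φ and the model parameters but not on h) such that for all h ∈ (0, h₀), all integers N, J ≥ 2 with 2NΔx ≥ C₁'/h and 2JΔy ≥ C₂'/h, and every interior index pair (n, j) with |n| ≤ N/2 − 1, |j| ≤ J/2 − 1: | Δx Δy Σ_{l=−N}^{N} Σ_{d=−J}^{J} φ_{l,d} g(x_{n−l}, y_{j−d}, Δτ) φ(x_l, y_d) − φ(x_n, y_j) − Δτ [(Lφ)(x_n,y_j) + (Jφ)(x_n,y_j)] | ≤ C h². -/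
open MeasureTheory
open scoped BigOperators

noncomputable section

/-- The bivariate normal (Merton) jump density on `ℝ × ℝ`. -/
def mertonDensity2 (μx μy σtx σty ρh : ℝ) (s : ℝ × ℝ) : ℝ :=
  1 / (2 * Real.pi * σtx * σty * Real.sqrt (1 - ρh ^ 2)) *
    Real.exp (-1 / (2 * (1 - ρh ^ 2)) *
      (((s.1 - μx) / σtx) ^ 2 - 2 * ρh * ((s.1 - μx) * (s.2 - μy) / (σtx * σty))
        + ((s.2 - μy) / σty) ^ 2))

/-- `Γ(η) = ∫ f(s) e^{i η·s} ds`. -/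
def jumpSymbol2 (f : ℝ × ℝ → ℝ) (η : ℝ × ℝ) : ℂ :=
  ∫ s : ℝ × ℝ,
    Complex.ofReal (f s) * Complex.exp (Complex.I * Complex.ofReal (η.1 * s.1 + η.2 * s.2))

/-- The symbol `Ψ(η) = −½ηᵀC̃η + iβ̃·η − (r+λ) + λΓ(η)`. -/
def symbolPsi2 (r lam σx σy ρ κx κy : ℝ) (f : ℝ × ℝ → ℝ) (η : ℝ × ℝ) : ℂ :=
  Complex.ofReal
      (-(1 / 2) * (σx ^ 2 * η.1 ^ 2 + 2 * ρ * σx * σy * η.1 * η.2 + σy ^ 2 * η.2 ^ 2))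
    + Complex.I *
        Complex.ofReal
          ((r - lam * κx - σx ^ 2 / 2) * η.1 + (r - lam * κy - σy ^ 2 / 2) * η.2)
    - Complex.ofReal (r + lam) + Complex.ofReal lam * jumpSymbol2 f η

/-- The Green's function `g(z, Δτ) = (2π)⁻² ∫ e^{iη·z} e^{Ψ(η)Δτ} dη`. -/
def greenFn2 (r lam σx σy ρ κx κy : ℝ) (f : ℝ × ℝ → ℝ) (Δτ : ℝ) (z : ℝ × ℝ) : ℂ :=
  Complex.ofReal (1 / (2 * Real.pi) ^ 2) *
    ∫ η : ℝ × ℝ,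
      Complex.exp (Complex.I * Complex.ofReal (η.1 * z.1 + η.2 * z.2)
        + symbolPsi2 r lam σx σy ρ κx κy f η * Complex.ofReal Δτ)

/-- The differential operator
`Lψ = ½σx²ψ_xx + (r−λκx−σx²/2)ψ_x + ½σy²ψ_yy + (r−λκy−σy²/2)ψ_y + ρσxσyψ_xy − (r+λ)ψ`. -/
def Lop (r lam σx σy ρ κx κy : ℝ) (ψ : ℝ × ℝ → ℝ) (z : ℝ × ℝ) : ℝ :=
  σx ^ 2 / 2 * fderiv ℝ (fun w => fderiv ℝ ψ w (1, 0)) z (1, 0)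
    + (r - lam * κx - σx ^ 2 / 2) * fderiv ℝ ψ z (1, 0)
    + σy ^ 2 / 2 * fderiv ℝ (fun w => fderiv ℝ ψ w (0, 1)) z (0, 1)
    + (r - lam * κy - σy ^ 2 / 2) * fderiv ℝ ψ z (0, 1)
    + ρ * σx * σy * fderiv ℝ (fun w => fderiv ℝ ψ w (0, 1)) z (1, 0)
    - (r + lam) * ψ z

/-- The jump operator `Jψ(x,y) = λ ∫ ψ(x+s_x, y+s_y) f(s_x,s_y) ds`. -/
def Jop (lam : ℝ) (f : ℝ × ℝ → ℝ) (ψ : ℝ × ℝ → ℝ) (z : ℝ × ℝ) : ℝ :=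
  lam * ∫ s : ℝ × ℝ, ψ (z.1 + s.1, z.2 + s.2) * f s

/-- Composite trapezoidal weight. -/
def trapWeight (N : ℕ) (l : ℤ) : ℝ := if l.natAbs = N then 1 / 2 else 1

/-- One-dimensional centred Gaussian kernel of variance `v`. -/
def gk (v u : ℝ) : ℝ := 1 / Real.sqrt (2 * Real.pi * v) * Real.exp (-u ^ 2 / (2 * v))

lemma gk_nonneg (v u : ℝ) : 0 ≤ gk v u := by unfold gk; positivity

lemma gk_neg (v u : ℝ) : gk v (-u) = gk v u := by unfold gk; simp

lemma summable_theta (A θ : ℝ) (hA : 0 < A) :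
    Summable (fun n : ℤ => Complex.exp (-(A : ℂ) * n ^ 2 + (θ : ℂ) * Complex.I * n)) := by
  have h : Summable (fun n : ℤ => jacobiTheta₂_term n (θ / (2 * Real.pi) : ℂ)
      (Complex.I * (A / Real.pi : ℂ))) := by
    rw [summable_jacobiTheta₂_term_iff]
    simp
    positivity
  refine h.congr fun n => ?_
  unfold jacobiTheta₂_term
  congr 1
  have : (Real.pi : ℂ) ≠ 0 := by exact_mod_cast Real.pi_ne_zero
  field_simp
  ring_nf
  simp
  ring

lemma summable_gauss (A θ : ℝ) (hA : 0 < A) :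
    Summable (fun n : ℤ => Real.exp (-A * (n + θ) ^ 2)) := by
  have h : Summable (fun n : ℤ => jacobiTheta₂_term n (Complex.I * (A * θ / Real.pi : ℂ))
      (Complex.I * (A / Real.pi : ℂ))) := by
    rw [summable_jacobiTheta₂_term_iff]
    simp
    positivity
  have h2 := (h.norm).mul_left (Real.exp (-A * θ ^ 2))
  refine h2.congr fun n => ?_
  unfold jacobiTheta₂_term
  have : (Real.pi : ℂ) ≠ 0 := by exact_mod_cast Real.pi_ne_zero
  have e : (2 * (Real.pi : ℂ) * Complex.I * n * (Complex.I * (A * θ / Real.pi : ℂ)) +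
      Real.pi * Complex.I * n ^ 2 * (Complex.I * (A / Real.pi : ℂ)))
      = ((-2 * A * θ * n - A * n ^ 2 : ℝ) : ℂ) := by
    push_cast
    field_simp
    ring_nf
    simp
    ring
  rw [e, ← Complex.ofReal_exp, Complex.norm_real, Real.norm_eq_abs, abs_of_pos (Real.exp_pos _),
    ← Real.exp_add]
  congr 1
  ring

lemma summable_gk (Δ v c : ℝ) (hΔ : 0 < Δ) (hv : 0 < v) :
    Summable (fun d : ℤ => gk v (c + d * Δ)) := by
  have h := (summable_gauss (Δ ^ 2 / (2 * v)) (c / Δ) (by positivity)).mul_left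
    (1 / Real.sqrt (2 * Real.pi * v))
  refine h.congr fun n => ?_
  unfold gk
  congr 2
  field_simp
  ring

lemma exp_neg_le_two_div_sq (x : ℝ) (hx : 0 < x) : Real.exp (-x) ≤ 2 / x ^ 2 := by
  have h := Real.quadratic_le_exp_of_nonneg hx.le
  rw [Real.exp_neg, inv_eq_one_div, div_le_div_iff₀ (Real.exp_pos _) (by positivity)]
  nlinarith

lemma poisson_gk : ∃ K > (0:ℝ), ∀ Δ v c : ℝ, 0 < Δ → 0 < v →
    |Δ * ∑' d : ℤ, gk v (c + d * Δ) - 1| ≤ K * (Δ ^ 2 / v) ^ 2 := by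
  have hs4 : Summable (fun n : ℤ => 1 / (n : ℝ) ^ 4) :=
    Real.summable_one_div_int_pow.2 (by norm_num)
  refine ⟨∑' n : ℤ, 1 / (n : ℝ) ^ 4 + 1, by positivity, fun Δ v c hΔ hv => ?_⟩
  set a : ℝ := 2 * Real.pi * v / Δ ^ 2 with ha
  have hpi := Real.pi_pos
  have ha0 : 0 < a := by positivity
  have hP := Complex.tsum_exp_neg_quadratic (a := (a : ℂ)) (by simpa using ha0)
    (-Complex.I * (c / Δ : ℝ))
  have hR : (1 / (a : ℂ) ^ (1 / 2 : ℂ) * ∑' n : ℤ, Complex.exp (-Real.pi / (a : ℂ) *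
      (n + Complex.I * (-Complex.I * (c / Δ : ℝ))) ^ 2))
      = ((Δ * ∑' d : ℤ, gk v (c + d * Δ) : ℝ) : ℂ) := by
    have h1 : (a : ℂ) ^ (1 / 2 : ℂ) = (Real.sqrt a : ℂ) := by
      rw [Real.sqrt_eq_rpow, Complex.ofReal_cpow ha0.le]; norm_num
    have h2 : Real.sqrt a = Real.sqrt (2 * Real.pi * v) / Δ := by
      rw [ha, Real.sqrt_div (by positivity), Real.sqrt_sq hΔ.le]
    rw [h1, h2]
    unfold gk
    rw [tsum_mul_left]
    push_cast
    rw [← mul_assoc (Δ : ℂ)]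
    congr 1
    · have : (Real.sqrt (2 * Real.pi * v)) ≠ 0 := by positivity
      have h3 : (Real.sqrt (2 * Real.pi * v) : ℂ) ≠ 0 := by exact_mod_cast this
      have h4 : (Δ : ℂ) ≠ 0 := by exact_mod_cast hΔ.ne'
      field_simp
    · refine tsum_congr fun n => ?_
      congr 1
      have h4 : (Δ : ℂ) ≠ 0 := by exact_mod_cast hΔ.ne'
      have h5 : (v : ℂ) ≠ 0 := by exact_mod_cast hv.ne'
      have h6 : (Real.pi : ℂ) ≠ 0 := by exact_mod_cast hpi.ne'
      rw [ha]
      push_cast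
      have h7 : Complex.I * (-Complex.I * (c / Δ : ℂ)) = c / Δ := by
        rw [← mul_assoc]; simp
      rw [h7]
      field_simp
      ring
  rw [hR] at hP
  have hterm : ∀ n : ℤ, (-Real.pi * (a : ℂ) * n ^ 2 + 2 * Real.pi * (-Complex.I * (c / Δ : ℝ)) * n)
      = (-((Real.pi * a : ℝ) : ℂ) * n ^ 2 + ((-2 * Real.pi * (c / Δ) : ℝ) : ℂ) * Complex.I * n) := by
    intro n; push_cast; ring
  simp_rw [hterm] at hP
  have hsum := summable_theta (Real.pi * a) (-2 * Real.pi * (c / Δ)) (by positivity)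
  rw [hsum.tsum_eq_add_tsum_ite 0] at hP
  simp only [Int.cast_zero, ne_eq, OfNat.ofNat_ne_zero, not_false_eq_true, zero_pow, mul_zero,
    add_zero, Complex.exp_zero] at hP
  have h8 : ((Δ * ∑' d : ℤ, gk v (c + d * Δ) - 1 : ℝ) : ℂ) = ∑' n : ℤ, if n = 0 then 0 else
      Complex.exp (-((Real.pi * a : ℝ) : ℂ) * n ^ 2 +
        ((-2 * Real.pi * (c / Δ) : ℝ) : ℂ) * Complex.I * n) := by
    rw [Complex.ofReal_sub, ← hP]; simp
  rw [← Real.norm_eq_abs, ← Complex.norm_real, h8]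
  have hb : ∀ n : ℤ, ‖(if n = 0 then 0 else
      Complex.exp (-((Real.pi * a : ℝ) : ℂ) * n ^ 2 +
        ((-2 * Real.pi * (c / Δ) : ℝ) : ℂ) * Complex.I * n))‖ ≤ (Δ ^ 2 / v) ^ 2 * (1 / (n : ℝ) ^ 4) := by
    intro n
    split_ifs with h
    · simp [h]
    · have hn : (0:ℝ) < (n : ℝ) ^ 2 := by positivity
      rw [Complex.norm_exp]
      have : (-((Real.pi * a : ℝ) : ℂ) * n ^ 2 +
        ((-2 * Real.pi * (c / Δ) : ℝ) : ℂ) * Complex.I * n).re = - (Real.pi * a * n ^ 2) := by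
        have e : (-((Real.pi * a : ℝ) : ℂ) * n ^ 2 +
          ((-2 * Real.pi * (c / Δ) : ℝ) : ℂ) * Complex.I * n) =
          ((-(Real.pi * a * n ^ 2) : ℝ) : ℂ) + ((-2 * Real.pi * (c / Δ) * n : ℝ) : ℂ) * Complex.I := by
          push_cast; ring
        rw [e, Complex.add_re, Complex.ofReal_re, Complex.re_ofReal_mul, Complex.I_re]; ring
      rw [this]
      refine (exp_neg_le_two_div_sq _ (by positivity)).trans ?_
      have e2 : (Δ ^ 2 / v) ^ 2 * (1 / (n : ℝ) ^ 4) = 4 * Real.pi ^ 4 / (Real.pi * a * n ^ 2) ^ 2 := by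
        rw [ha]; field_simp; ring
      rw [e2]
      gcongr
      have := Real.pi_gt_three
      nlinarith [pow_le_pow_left₀ (by norm_num) this.le 4]
  refine (tsum_of_norm_bounded (hs4.mul_left ((Δ ^ 2 / v) ^ 2)).hasSum hb).trans ?_
  rw [tsum_mul_left]
  nlinarith [sq_nonneg (Δ ^ 2 / v)]

lemma real_exp_sub_sum_le (x : ℝ) (n : ℕ) :
    |Real.exp x - ∑ m ∈ Finset.range n, x ^ m / (m.factorial : ℝ)| ≤ |x| ^ n * Real.exp |x| := by
  have h := Complex.norm_exp_sub_sum_le_norm_mul_exp (x : ℂ) n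
  have e : (Complex.exp (x : ℂ) - ∑ m ∈ Finset.range n, (x : ℂ) ^ m / (m.factorial : ℂ))
    = ((Real.exp x - ∑ m ∈ Finset.range n, x ^ m / (m.factorial : ℝ) : ℝ) : ℂ) := by
    push_cast; rfl
  rw [e, Complex.norm_real, Complex.norm_real] at h
  simpa using h

lemma exp_mul_gk (v a u : ℝ) (hv : 0 < v) :
    Real.exp (a * u) * gk v u = Real.exp (v * a ^ 2 / 2) * gk v (u - v * a) := by
  unfold gk
  rw [mul_left_comm, mul_left_comm (Real.exp (v * a ^ 2 / 2)), ← Real.exp_add, ← Real.exp_add]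
  congr 2
  field_simp
  ring

lemma exp_moment (S D : ℝ) (hS : 0 < S) (hD : 0 < D) : ∃ C > (0:ℝ), ∀ h c a : ℝ, 0 < h → h ≤ 1 →
    |a| ≤ 4 → ∃ m : ℝ, HasSum (fun d : ℤ => Real.exp (a * (c + d * (D * h))) *
      (D * h * gk (S * h) (c + d * (D * h)))) m ∧ |m - (1 + S * h * a ^ 2 / 2)| ≤ C * h ^ 2 := by
  obtain ⟨K, hK, hP⟩ := poisson_gk
  refine ⟨Real.exp (8 * S) * (K * (D ^ 2 / S) ^ 2) + (8 * S) ^ 2 * Real.exp (8 * S), by positivity,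
    fun h c a hh h1 ha => ?_⟩
  have hv : 0 < S * h := by positivity
  have hΔ : 0 < D * h := by positivity
  have hsum := summable_gk (D * h) (S * h) (c - S * h * a) hΔ hv
  have hp := hP (D * h) (S * h) (c - S * h * a) hΔ hv
  set M := ∑' d : ℤ, gk (S * h) (c - S * h * a + d * (D * h)) with hM
  set x := S * h * a ^ 2 / 2 with hx
  refine ⟨Real.exp x * (D * h * M), ?_, ?_⟩
  · have := (hsum.hasSum.mul_left (D * h)).mul_left (Real.exp x)
    refine this.congr_fun ?_
    intro d
    have e := exp_mul_gk (S * h) a (c + d * (D * h)) hv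
    have e2 : c + d * (D * h) - S * h * a = c - S * h * a + d * (D * h) := by ring
    rw [e2] at e
    rw [mul_left_comm, e, mul_left_comm]
  · have ha2 : a ^ 2 ≤ 16 := by
      have := abs_le.1 ha; nlinarith
    have hx0 : 0 ≤ x := by positivity
    have hx1 : x ≤ 8 * S * h := by rw [hx]; nlinarith
    have hx2 : x ≤ 8 * S := by nlinarith
    have hex : Real.exp x ≤ Real.exp (8 * S) := Real.exp_le_exp.2 hx2
    have h2 := real_exp_sub_sum_le x 2
    simp [Finset.sum_range_succ] at h2
    rw [abs_of_nonneg hx0] at h2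
    have e4 : K * ((D * h) ^ 2 / (S * h)) ^ 2 = K * (D ^ 2 / S) ^ 2 * h ^ 2 := by
      field_simp
    rw [e4] at hp
    have e3 : Real.exp x * (D * h * M) - (1 + x) =
      Real.exp x * (D * h * M - 1) + (Real.exp x - (1 + x)) := by ring
    rw [e3]
    refine (abs_add_le _ _).trans ?_
    rw [abs_mul, abs_of_pos (Real.exp_pos x), add_mul]
    refine add_le_add ?_ ?_
    · calc Real.exp x * |D * h * M - 1| ≤ Real.exp (8 * S) * (K * (D ^ 2 / S) ^ 2 * h ^ 2) := by
            gcongr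
        _ = Real.exp (8 * S) * (K * (D ^ 2 / S) ^ 2) * h ^ 2 := by ring
    · refine h2.trans ?_
      have : x ^ 2 ≤ (8 * S * h) ^ 2 := by gcongr
      calc x ^ 2 * Real.exp x ≤ (8 * S * h) ^ 2 * Real.exp (8 * S) := by
            gcongr
        _ = (8 * S) ^ 2 * Real.exp (8 * S) * h ^ 2 := by ring

lemma cosh_sub_one_lb (u : ℝ) : u ^ 2 / 2 ≤ Real.cosh u - 1 := by
  have h : Real.cosh u = 1 + 2 * Real.sinh (u / 2) ^ 2 := by
    have := Real.cosh_two_mul (u / 2)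
    rw [show 2 * (u / 2) = u by ring] at this
    have h2 := Real.cosh_sq (u / 2)
    linarith
  rw [h]
  have h3 : |u / 2| ≤ |Real.sinh (u / 2)| := by
    rw [Real.abs_sinh]
    exact Real.self_le_sinh_iff.2 (abs_nonneg _)
  have h4 := sq_le_sq.2 h3
  nlinarith

lemma rem_bound (u : ℝ) : u ^ 4 * Real.exp (2 * |u|) ≤
    Real.exp (4 * u) + Real.exp (-4 * u) + 2 * Real.exp (0 * u)
      + 6 * (Real.exp (2 * u) + Real.exp (-2 * u))
      - 4 * (Real.exp (3 * u) + Real.exp (-3 * u)) - 4 * (Real.exp (1 * u) + Real.exp (-1 * u)) := by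
  have h1 := cosh_sub_one_lb u
  have h2 : u ^ 4 ≤ 4 * (Real.cosh u - 1) ^ 2 := by
    have : (u ^ 2 / 2) ^ 2 ≤ (Real.cosh u - 1) ^ 2 := by gcongr
    nlinarith
  have h3 : Real.exp (2 * |u|) ≤ Real.exp (2 * u) + Real.exp (-2 * u) := by
    rcases abs_cases u with ⟨h, _⟩ | ⟨h, _⟩ <;> rw [h]
    · linarith [Real.exp_pos (-2 * u)]
    · rw [show 2 * -u = -2 * u by ring]; linarith [Real.exp_pos (2 * u)]
  calc u ^ 4 * Real.exp (2 * |u|) ≤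
      4 * (Real.cosh u - 1) ^ 2 * (Real.exp (2 * u) + Real.exp (-2 * u)) := by
        gcongr
    _ = _ := by
        have hE := Real.exp_pos u
        have hi : Real.exp u * Real.exp (-u) = 1 := by rw [← Real.exp_add]; simp
        rw [Real.cosh_eq]
        have e4 : Real.exp (4 * u) = Real.exp u ^ 4 := by rw [← Real.exp_nat_mul]; norm_num
        have e3 : Real.exp (3 * u) = Real.exp u ^ 3 := by rw [← Real.exp_nat_mul]; norm_num
        have e2 : Real.exp (2 * u) = Real.exp u ^ 2 := by rw [← Real.exp_nat_mul]; norm_num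
        have f4 : Real.exp (-4 * u) = Real.exp (-u) ^ 4 := by rw [← Real.exp_nat_mul]; norm_num
        have f3 : Real.exp (-3 * u) = Real.exp (-u) ^ 3 := by rw [← Real.exp_nat_mul]; norm_num
        have f2 : Real.exp (-2 * u) = Real.exp (-u) ^ 2 := by rw [← Real.exp_nat_mul]; norm_num
        rw [e4, e3, e2, f4, f3, f2]
        rw [one_mul, neg_one_mul, zero_mul, Real.exp_zero]
        have hy : Real.exp (-u) = (Real.exp u)⁻¹ := Real.exp_neg u
        rw [hy]
        field_simp
        ring

lemma taylor_exp (a u : ℝ) (ha : |a| ≤ 2) :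
    |Real.exp (a * u) - (1 + a * u + a ^ 2 * u ^ 2 / 2 + a ^ 3 * u ^ 3 / 6)| ≤
      16 * (u ^ 4 * Real.exp (2 * |u|)) := by
  have h := real_exp_sub_sum_le (a * u) 4
  simp [Finset.sum_range_succ, Nat.factorial] at h
  have e : 1 + a * u + (a * u) ^ 2 / 2 + (a * u) ^ 3 / 6 =
    1 + a * u + a ^ 2 * u ^ 2 / 2 + a ^ 3 * u ^ 3 / 6 := by ring
  rw [e] at h
  refine h.trans ?_
  rw [mul_pow]
  have h4 : |a| ^ 4 ≤ 2 ^ 4 := by gcongr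
  have h5 : |u| ^ 4 = u ^ 4 := by
    rw [show 4 = 2 * 2 by rfl, pow_mul, sq_abs, ← pow_mul]
  have h6 : Real.exp (|a| * |u|) ≤ Real.exp (2 * |u|) := by
    apply Real.exp_le_exp.2; gcongr
  rw [h5]
  calc |a| ^ 4 * u ^ 4 * Real.exp (|a| * |u|) ≤ 2 ^ 4 * u ^ 4 * Real.exp (2 * |u|) := by
        gcongr
    _ = _ := by ring

/-- grid point relative to the centre -/
def ud (D h c : ℝ) (d : ℤ) : ℝ := c + d * (D * h)

/-- discrete Gaussian weight -/
def kd (S D h c : ℝ) (d : ℤ) : ℝ := D * h * gk (S * h) (ud D h c d)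

lemma kd_nonneg (S D h c : ℝ) (d : ℤ) (hD : 0 < D) (hh : 0 < h) : 0 ≤ kd S D h c d := by
  unfold kd
  have := gk_nonneg (S * h) (ud D h c d)
  positivity

lemma abs_comb (C h B e c : ℝ) (he : |e| ≤ C * h ^ 2) (hc : |c| ≤ B) :
    |c * e| ≤ B * (C * h ^ 2) := by
  rw [abs_mul]
  have := abs_nonneg c
  have := abs_nonneg e
  gcongr
  linarith

set_option maxHeartbeats 1000000 in
lemma disc1 (S D : ℝ) (hS : 0 < S) (hD : 0 < D) : ∃ C > (0:ℝ), ∀ (h c B p0 p1 p2 p3 : ℝ)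
    (F : ℝ → ℝ), 0 < h → h ≤ 1 → |p0| ≤ B → |p1| ≤ B → |p2| ≤ B → |p3| ≤ B →
    (∀ u, |F u - (p0 + p1 * u + p2 * u ^ 2 / 2 + p3 * u ^ 3 / 6)| ≤ B * u ^ 4) →
    ∃ m, HasSum (fun d : ℤ => F (ud D h c d) * kd S D h c d) m ∧
      |m - (p0 + S * h * p2 / 2)| ≤ C * B * h ^ 2 := by
  obtain ⟨C, hC, hE⟩ := exp_moment S D hS hD
  refine ⟨(10 + 257 * 32) * C, by positivity, ?_⟩
  intro h c B p0 p1 p2 p3 F hh h1 hp0 hp1 hp2 hp3 hF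
  have hE' : ∀ a : ℝ, |a| ≤ 4 → ∃ m : ℝ, HasSum (fun d : ℤ => Real.exp (a * ud D h c d) *
      kd S D h c d) m ∧ |m - (1 + S * h * a ^ 2 / 2)| ≤ C * h ^ 2 := fun a ha => hE h c a hh h1 ha
  clear hE
  obtain ⟨m0, hm0, em0⟩ := hE' 0 (by norm_num)
  obtain ⟨m1, hm1, em1⟩ := hE' 1 (by norm_num)
  obtain ⟨m2, hm2, em2⟩ := hE' 2 (by norm_num)
  obtain ⟨m3, hm3, em3⟩ := hE' 3 (by norm_num)
  obtain ⟨m4, hm4, em4⟩ := hE' 4 (by norm_num)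
  obtain ⟨n1, hn1, en1⟩ := hE' (-1) (by norm_num)
  obtain ⟨n2, hn2, en2⟩ := hE' (-2) (by norm_num)
  obtain ⟨n3, hn3, en3⟩ := hE' (-3) (by norm_num)
  obtain ⟨n4, hn4, en4⟩ := hE' (-4) (by norm_num)
  have hB : 0 ≤ B := (abs_nonneg _).trans hp0
  set R : ℝ → ℝ := fun u => Real.exp (4 * u) + Real.exp (-4 * u) + 2 * Real.exp (0 * u)
      + 6 * (Real.exp (2 * u) + Real.exp (-2 * u))
      - 4 * (Real.exp (3 * u) + Real.exp (-3 * u)) - 4 * (Real.exp (1 * u) + Real.exp (-1 * u)) with hR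
  set ρ := m4 + n4 + 2 * m0 + 6 * (m2 + n2) - 4 * (m3 + n3) - 4 * (m1 + n1) with hρ
  have hRs : HasSum (fun d : ℤ => R (ud D h c d) * kd S D h c d) ρ := by
    have := ((((hm4.add hn4).add (hm0.mul_left 2)).add ((hm2.add hn2).mul_left 6)).sub
      ((hm3.add hn3).mul_left 4)).sub ((hm1.add hn1).mul_left 4)
    refine this.congr_fun fun d => ?_
    simp only [hR]; ring
  have hρb : ρ ≤ 32 * (C * h ^ 2) := by
    rw [abs_le] at em0 em1 em2 em3 em4 en1 en2 en3 en4
    rw [hρ]; linarith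
  set α := (4 * p1 - p3) / 3 with hα
  set β := (p3 - p1) / 6 with hβ
  set T : ℝ → ℝ := fun u => (p0 - p2) * Real.exp (0 * u) + (p2 / 2 + α / 2) * Real.exp (1 * u)
    + (p2 / 2 - α / 2) * Real.exp (-1 * u) + (β / 2) * Real.exp (2 * u)
    + (-(β / 2)) * Real.exp (-2 * u) with hT
  set t := (p0 - p2) * m0 + (p2 / 2 + α / 2) * m1
    + (p2 / 2 - α / 2) * n1 + (β / 2) * m2
    + (-(β / 2)) * n2 with ht
  have hTs : HasSum (fun d : ℤ => T (ud D h c d) * kd S D h c d) t := by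
    have := ((((hm0.mul_left (p0 - p2)).add (hm1.mul_left (p2 / 2 + α / 2))).add
      (hn1.mul_left (p2 / 2 - α / 2))).add (hm2.mul_left (β / 2))).add (hn2.mul_left (-(β / 2)))
    refine this.congr_fun fun d => ?_
    simp only [hT]; ring
  rw [abs_le] at hp0 hp1 hp2 hp3
  have c0 : |p0 - p2| ≤ 2 * B := by rw [abs_le]; constructor <;> linarith
  have c1 : |p2 / 2 + α / 2| ≤ 2 * B := by rw [abs_le, hα]; constructor <;> linarith
  have c2 : |p2 / 2 - α / 2| ≤ 2 * B := by rw [abs_le, hα]; constructor <;> linarith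
  have c3 : |β / 2| ≤ 2 * B := by rw [abs_le, hβ]; constructor <;> linarith
  have c4 : |-(β / 2)| ≤ 2 * B := by rw [abs_neg]; exact c3
  have htb : |t - (p0 + S * h * p2 / 2)| ≤ 10 * B * (C * h ^ 2) := by
    have e : t - (p0 + S * h * p2 / 2) = (p0 - p2) * (m0 - (1 + S * h * 0 ^ 2 / 2))
      + (p2 / 2 + α / 2) * (m1 - (1 + S * h * 1 ^ 2 / 2))
      + (p2 / 2 - α / 2) * (n1 - (1 + S * h * (-1) ^ 2 / 2))
      + (β / 2) * (m2 - (1 + S * h * 2 ^ 2 / 2))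
      + (-(β / 2)) * (n2 - (1 + S * h * (-2) ^ 2 / 2)) := by rw [ht]; ring
    rw [e]
    have a0 := abs_comb _ _ _ _ _ em0 c0
    have a1 := abs_comb _ _ _ _ _ em1 c1
    have a2 := abs_comb _ _ _ _ _ en1 c2
    have a3 := abs_comb _ _ _ _ _ em2 c3
    have a4 := abs_comb _ _ _ _ _ en2 c4
    rw [abs_le] at a0 a1 a2 a3 a4 ⊢
    constructor <;> linarith
  have hFT : ∀ u, |F u - T u| ≤ 257 * B * R u := by
    intro u
    set w := u ^ 4 * Real.exp (2 * |u|) with hw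
    have hw0 : 0 ≤ w := by positivity
    have hwR : w ≤ R u := rem_bound u
    have hu4 : u ^ 4 ≤ w := by
      have h1 : (1:ℝ) ≤ Real.exp (2 * |u|) := Real.one_le_exp (by positivity)
      have h2 : 0 ≤ u ^ 4 := by positivity
      rw [hw]; nlinarith
    have key : ∀ a cc : ℝ, |a| ≤ 2 → |cc| ≤ 2 * B →
        |cc * (Real.exp (a * u) - (1 + a * u + a ^ 2 * u ^ 2 / 2 + a ^ 3 * u ^ 3 / 6))| ≤
          32 * (B * w) := by
      intro a cc ha hcc
      rw [abs_mul]
      calc _ ≤ 2 * B * (16 * w) := by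
            gcongr
            exact taylor_exp a u ha
        _ = _ := by ring
    have k0 := key 0 _ (by norm_num) c0
    have k1 := key 1 _ (by norm_num) c1
    have k2 := key (-1) _ (by norm_num) c2
    have k3 := key 2 _ (by norm_num) c3
    have k4 := key (-2) _ (by norm_num) c4
    have kF := hF u
    have kF2 : |F u - (p0 + p1 * u + p2 * u ^ 2 / 2 + p3 * u ^ 3 / 6)| ≤ B * w :=
      kF.trans (by gcongr)
    have e : F u - T u = (F u - (p0 + p1 * u + p2 * u ^ 2 / 2 + p3 * u ^ 3 / 6))
      - (p0 - p2) * (Real.exp (0 * u) - (1 + 0 * u + 0 ^ 2 * u ^ 2 / 2 + 0 ^ 3 * u ^ 3 / 6))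
      - (p2 / 2 + α / 2) * (Real.exp (1 * u) - (1 + 1 * u + 1 ^ 2 * u ^ 2 / 2 + 1 ^ 3 * u ^ 3 / 6))
      - (p2 / 2 - α / 2) * (Real.exp (-1 * u) - (1 + -1 * u + (-1) ^ 2 * u ^ 2 / 2 + (-1) ^ 3 * u ^ 3 / 6))
      - (β / 2) * (Real.exp (2 * u) - (1 + 2 * u + 2 ^ 2 * u ^ 2 / 2 + 2 ^ 3 * u ^ 3 / 6))
      - (-(β / 2)) * (Real.exp (-2 * u) - (1 + -2 * u + (-2) ^ 2 * u ^ 2 / 2 + (-2) ^ 3 * u ^ 3 / 6)) := by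
      simp only [hT, hα, hβ]; ring
    have hBw : B * w ≤ B * R u := by gcongr
    have hBw0 : 0 ≤ B * w := by positivity
    rw [e]
    rw [abs_le] at k0 k1 k2 k3 k4 kF2 ⊢
    constructor <;> linarith
  have hbd : ∀ d : ℤ, ‖(F (ud D h c d) - T (ud D h c d)) * kd S D h c d‖ ≤
      257 * B * (R (ud D h c d) * kd S D h c d) := by
    intro d
    have hk := kd_nonneg S D h c d hD hh
    rw [Real.norm_eq_abs, abs_mul, abs_of_nonneg hk, ← mul_assoc]
    have := hFT (ud D h c d)
    gcongr
  have hR2 := hRs.mul_left (257 * B)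
  have hS1 : Summable (fun d : ℤ => (F (ud D h c d) - T (ud D h c d)) * kd S D h c d) :=
    Summable.of_norm_bounded hR2.summable hbd
  have hn := tsum_of_norm_bounded hR2 hbd
  refine ⟨_, (hS1.hasSum.add hTs).congr_fun fun d => ?_, ?_⟩
  · ring
  · set q := ∑' d : ℤ, (F (ud D h c d) - T (ud D h c d)) * kd S D h c d
    rw [Real.norm_eq_abs] at hn
    have : 257 * B * ρ ≤ 257 * B * (32 * (C * h ^ 2)) := by gcongr
    rw [abs_le] at hn htb ⊢
    constructor <;> linarith

/-- Smooth functions with all derivatives bounded. -/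
def Nice (ψ : ℝ × ℝ → ℝ) : Prop :=
  (∀ n : ℕ, ContDiff ℝ n ψ) ∧ ∀ k : ℕ, ∃ B : ℝ, ∀ z : ℝ × ℝ, ‖iteratedFDeriv ℝ k ψ z‖ ≤ B

/-- Directional derivative. -/
def dd (e : ℝ × ℝ) (ψ : ℝ × ℝ → ℝ) : ℝ × ℝ → ℝ := fun w => fderiv ℝ ψ w e

lemma Nice.dd {ψ : ℝ × ℝ → ℝ} (h : Nice ψ) (e : ℝ × ℝ) : Nice (dd e ψ) := by
  have hf : ∀ n : ℕ, ContDiff ℝ n (fderiv ℝ ψ) := fun n =>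
    (h.1 (n + 1)).fderiv_right (by norm_cast)
  constructor
  · intro n
    exact (hf n).clm_apply contDiff_const
  · intro k
    obtain ⟨B, hB⟩ := h.2 (k + 1)
    refine ⟨‖ContinuousLinearMap.apply ℝ ℝ e‖ * B, fun z => ?_⟩
    have := ContinuousLinearMap.norm_iteratedFDeriv_comp_left (𝕜 := ℝ) (n := k) (N := (k : ℕ))
      (ContinuousLinearMap.apply ℝ ℝ e) (f := fderiv ℝ ψ) (x := z) (hf k).contDiffAt le_rfl
    rw [norm_iteratedFDeriv_fderiv] at this
    refine le_trans ?_ (this.trans (by gcongr; exact hB z))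
    exact le_of_eq rfl

lemma Nice.bdd {ψ : ℝ × ℝ → ℝ} (h : Nice ψ) : ∃ B > (0:ℝ), ∀ z, |ψ z| ≤ B := by
  obtain ⟨B, hB⟩ := h.2 0
  refine ⟨|B| + 1, by positivity, fun z => ?_⟩
  have := hB z
  rw [norm_iteratedFDeriv_zero, Real.norm_eq_abs] at this
  linarith [le_abs_self B]

lemma Nice.hasDerivAt {ψ : ℝ × ℝ → ℝ} (h : Nice ψ) (e z : ℝ × ℝ) (u : ℝ) :
    HasDerivAt (fun t : ℝ => ψ (z + t • e)) (_root_.dd e ψ (z + u • e)) u := by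
  have h1 : HasFDerivAt ψ (fderiv ℝ ψ (z + u • e)) (z + u • e) :=
    (((h.1 1).differentiable (by simp)) _).hasFDerivAt
  have h2 : HasDerivAt (fun t : ℝ => z + t • e) e u := by
    simpa using ((hasDerivAt_id u).smul_const e).const_add z
  exact h1.comp_hasDerivAt u h2

lemma grow (F F' : ℝ → ℝ) (K : ℝ) (n : ℕ) (h0 : F 0 = 0) (hF : ∀ u, HasDerivAt F (F' u) u)
    (hb : ∀ u, |F' u| ≤ K * |u| ^ n) (hK : 0 ≤ K) (u : ℝ) : |F u| ≤ K * |u| ^ (n + 1) := by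
  have := Convex.norm_image_sub_le_of_norm_hasDerivWithin_le (𝕜 := ℝ) (f := F) (f' := F')
    (s := Set.uIcc 0 u) (x := 0) (y := u) (C := K * |u| ^ n)
    (fun x _ => (hF x).hasDerivWithinAt) (fun x hx => by
      rw [Real.norm_eq_abs]
      refine (hb x).trans ?_
      have : |x| ≤ |u| := by
        have := Set.abs_sub_left_of_mem_uIcc hx
        simpa using this
      gcongr) (convex_uIcc 0 u) Set.left_mem_uIcc Set.right_mem_uIcc
  rw [h0, sub_zero, sub_zero, Real.norm_eq_abs, Real.norm_eq_abs] at this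
  rw [pow_succ]; linarith

lemma Nice.lip {ψ : ℝ × ℝ → ℝ} (h : Nice ψ) (e : ℝ × ℝ) : ∃ B > (0:ℝ), ∀ z u,
    |ψ (z + u • e) - ψ z| ≤ B * |u| := by
  obtain ⟨B, hB, hb⟩ := (h.dd e).bdd
  refine ⟨B, hB, fun z u => ?_⟩
  have := grow (fun t => ψ (z + t • e) - ψ z) (fun t => _root_.dd e ψ (z + t • e)) B 0 (by simp)
    (fun u => (h.hasDerivAt e z u).sub_const _) (fun u => by simpa using hb _) hB.le u
  simpa using this

lemma Nice.taylor1 {ψ : ℝ × ℝ → ℝ} (h : Nice ψ) (e : ℝ × ℝ) : ∃ B > (0:ℝ), ∀ z u,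
    |ψ (z + u • e) - ψ z - u * _root_.dd e ψ z| ≤ B * u ^ 2 := by
  obtain ⟨B, hB, hb⟩ := (h.dd e).lip e
  refine ⟨B, hB, fun z u => ?_⟩
  have := grow (fun t => ψ (z + t • e) - ψ z - t * _root_.dd e ψ z)
    (fun t => _root_.dd e ψ (z + t • e) - 1 * _root_.dd e ψ z) B 1 (by simp)
    (fun u => ((h.hasDerivAt e z u).sub_const _).sub ((hasDerivAt_id u).mul_const _))
    (fun u => by simpa using hb z u) hB.le u
  simpa using this

lemma Nice.taylor3 {ψ : ℝ × ℝ → ℝ} (h : Nice ψ) (e : ℝ × ℝ) : ∃ B > (0:ℝ), ∀ z,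
    |ψ z| ≤ B ∧ |_root_.dd e ψ z| ≤ B ∧ |_root_.dd e (_root_.dd e ψ) z| ≤ B ∧
    |_root_.dd e (_root_.dd e (_root_.dd e ψ)) z| ≤ B ∧
    ∀ u, |ψ (z + u • e) - (ψ z + _root_.dd e ψ z * u + _root_.dd e (_root_.dd e ψ) z * u ^ 2 / 2
      + _root_.dd e (_root_.dd e (_root_.dd e ψ)) z * u ^ 3 / 6)| ≤ B * u ^ 4 := by
  have n1 := h.dd e
  have n2 := n1.dd e
  have n3 := n2.dd e
  obtain ⟨B0, hB0, b0⟩ := h.bdd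
  obtain ⟨B1, hB1, b1⟩ := n1.bdd
  obtain ⟨B2, hB2, b2⟩ := n2.bdd
  obtain ⟨B3, hB3, b3⟩ := n3.bdd
  obtain ⟨B4, hB4, b4⟩ := n2.taylor1 e
  refine ⟨B0 + B1 + B2 + B3 + B4, by positivity, fun z => ⟨by linarith [b0 z], by linarith [b1 z],
    by linarith [b2 z], by linarith [b3 z], fun u => ?_⟩⟩
  set p0 := ψ z
  set p1 := _root_.dd e ψ z
  set p2 := _root_.dd e (_root_.dd e ψ) z
  set p3 := _root_.dd e (_root_.dd e (_root_.dd e ψ)) z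
  have g1 := grow (fun t => _root_.dd e ψ (z + t • e) - (p1 + p2 * t + p3 * t ^ 2 / 2))
    (fun t => _root_.dd e (_root_.dd e ψ) (z + t • e) - (p2 * 1 + p3 * (2 * t) / 2)) B4 2
    (by simp [p1]) (fun u => by
      have h1 : HasDerivAt (fun t : ℝ => t ^ 2) (2 * u) u := by simpa using hasDerivAt_pow 2 u
      exact (n1.hasDerivAt e z u).sub ((((hasDerivAt_id u).const_mul p2).const_add p1).add
        ((h1.const_mul p3).div_const 2)))
    (fun u => by
      have := b4 z u
      rw [sq_abs]
      convert this using 2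
      ring) hB4.le
  have g2 := grow (fun t => ψ (z + t • e) - (p0 + p1 * t + p2 * t ^ 2 / 2 + p3 * t ^ 3 / 6))
    (fun t => _root_.dd e ψ (z + t • e) - (p1 * 1 + p2 * (2 * t) / 2 + p3 * (3 * t ^ 2) / 6)) B4 3
    (by simp [p0]) (fun u => by
      have h1 : HasDerivAt (fun t : ℝ => t ^ 2) (2 * u) u := by simpa using hasDerivAt_pow 2 u
      have h2 : HasDerivAt (fun t : ℝ => t ^ 3) (3 * u ^ 2) u := by simpa using hasDerivAt_pow 3 u
      exact (h.hasDerivAt e z u).sub (((((hasDerivAt_id u).const_mul p1).const_add p0).add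
        ((h1.const_mul p2).div_const 2)).add ((h2.const_mul p3).div_const 6)))
    (fun u => by
      have := g1 u
      convert this using 2
      ring) hB4.le u
  have h4 : |u| ^ 4 = u ^ 4 := by
    rw [show 4 = 2 * 2 by rfl, pow_mul, sq_abs, ← pow_mul]
  have h5 : 0 ≤ u ^ 4 := by positivity
  simp only [Nat.reduceAdd, h4] at g2
  refine g2.trans ?_
  gcongr
  linarith

lemma disc_mom (S D : ℝ) (hS : 0 < S) (hD : 0 < D) : ∃ C > (0:ℝ), ∀ h c q : ℝ, 0 < h → h ≤ 1 →
    0 ≤ q → ∃ m, HasSum (fun d : ℤ => (q + ud D h c d ^ 2) * kd S D h c d) m ∧ m ≤ C * (1 + q) := by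
  obtain ⟨C, hC, H⟩ := disc1 S D hS hD
  refine ⟨1 + S + 2 * C, by positivity, fun h c q hh h1 hq => ?_⟩
  obtain ⟨m, hm, hb⟩ := H h c (q + 2) q 0 2 0 (fun u => q + u ^ 2) hh h1
    (by rw [abs_of_nonneg hq]; linarith) (by simpa using by linarith) (by norm_num; linarith)
    (by simpa using by linarith) (fun u => by
      have : q + u ^ 2 - (q + 0 * u + 2 * u ^ 2 / 2 + 0 * u ^ 3 / 6) = 0 := by ring
      rw [this, abs_zero]; positivity)
  refine ⟨m, hm, ?_⟩
  have h2 := (abs_le.1 hb).2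
  have h3 : C * (q + 2) * h ^ 2 ≤ C * (q + 2) * 1 := by
    gcongr; exact pow_le_one₀ hh.le h1
  have h4 : S * h ≤ S := by nlinarith
  have : 0 ≤ S * q := by positivity
  have : 0 ≤ C * q := by positivity
  nlinarith

lemma disc_mom_fin (S D : ℝ) (hS : 0 < S) (hD : 0 < D) : ∃ C > (0:ℝ), ∀ h c q : ℝ, ∀ s : Finset ℤ,
    0 < h → h ≤ 1 → 0 ≤ q → ∑ d ∈ s, (q + ud D h c d ^ 2) * kd S D h c d ≤ C * (1 + q) := by
  obtain ⟨C, hC, H⟩ := disc_mom S D hS hD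
  refine ⟨C, hC, fun h c q s hh h1 hq => ?_⟩
  obtain ⟨m, hm, hb⟩ := H h c q hh h1 hq
  refine le_trans (sum_le_hasSum s (fun d _ => ?_) hm) hb
  have := kd_nonneg S D h c d hD hh
  positivity

lemma disc_mass_fin (S D : ℝ) (hS : 0 < S) (hD : 0 < D) : ∃ C > (0:ℝ), ∀ h c : ℝ, ∀ s : Finset ℤ,
    0 < h → h ≤ 1 → ∑ d ∈ s, kd S D h c d ≤ C := by
  obtain ⟨C, hC, H⟩ := disc_mom_fin S D hS hD
  refine ⟨C * (1 + 1), by positivity, fun h c s hh h1 => ?_⟩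
  refine le_trans (Finset.sum_le_sum fun d _ => ?_) (H h c 1 s hh h1 zero_le_one)
  have := kd_nonneg S D h c d hD hh
  nlinarith [mul_nonneg (sq_nonneg (ud D h c d)) this]

lemma disc_w (S D K : ℝ) (hS : 0 < S) (hD : 0 < D) (hK : 0 < K) : ∃ C > (0:ℝ),
    ∀ (h c B q p0 p1 p2 p3 : ℝ) (F : ℝ → ℝ) (s : Finset ℤ) (W : ℤ → ℝ),
    0 < h → h ≤ 1 → 0 ≤ q → |p0| ≤ B → |p1| ≤ B → |p2| ≤ B → |p3| ≤ B →
    (∀ u, |F u - (p0 + p1 * u + p2 * u ^ 2 / 2 + p3 * u ^ 3 / 6)| ≤ B * u ^ 4) →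
    (∀ u, |F u| ≤ B) → (∀ d, d ∉ s → W d = 0) → (∀ d, W d ≤ 1) →
    (∀ d, 1 - W d ≤ K * h ^ 2 * (q + ud D h c d ^ 2)) →
    |∑ d ∈ s, W d * (F (ud D h c d) * kd S D h c d) - (p0 + S * h * p2 / 2)|
      ≤ C * B * h ^ 2 * (1 + q) := by
  obtain ⟨C, hC, H⟩ := disc1 S D hS hD
  obtain ⟨C', hC', H'⟩ := disc_mom S D hS hD
  refine ⟨C + K * C', by positivity, ?_⟩
  intro h c B q p0 p1 p2 p3 F s W hh h1 hq hp0 hp1 hp2 hp3 hF hFB hW0 hW1 hW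
  obtain ⟨m, hm, hb⟩ := H h c B p0 p1 p2 p3 F hh h1 hp0 hp1 hp2 hp3 hF
  obtain ⟨m', hm', hb'⟩ := H' h c q hh h1 hq
  have hB : 0 ≤ B := (abs_nonneg _).trans hp0
  have hsum : HasSum (fun d => W d * (F (ud D h c d) * kd S D h c d))
      (∑ d ∈ s, W d * (F (ud D h c d) * kd S D h c d)) :=
    hasSum_sum_of_ne_finset_zero fun d hd => by rw [hW0 d hd, zero_mul]
  have hdiff := hsum.sub hm
  have hn := hdiff.norm_le_of_bounded (hm'.mul_left (B * (K * h ^ 2))) (fun d => by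
    have hk := kd_nonneg S D h c d hD hh
    have e : W d * (F (ud D h c d) * kd S D h c d) - F (ud D h c d) * kd S D h c d
      = -(F (ud D h c d) * (1 - W d) * kd S D h c d) := by ring
    have h2 : 0 ≤ 1 - W d := by linarith [hW1 d]
    rw [e, norm_neg, Real.norm_eq_abs, abs_mul, abs_mul, abs_of_nonneg hk, abs_of_nonneg h2]
    calc _ ≤ B * (K * h ^ 2 * (q + ud D h c d ^ 2)) * kd S D h c d := by
          gcongr
          · exact hFB _
          · exact hW d
      _ = _ := by ring)
  rw [Real.norm_eq_abs] at hn
  set σs := ∑ d ∈ s, W d * (F (ud D h c d) * kd S D h c d)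
  have h3 : B * (K * h ^ 2) * m' ≤ B * (K * h ^ 2) * (C' * (1 + q)) := by gcongr
  have h4 : C * B * h ^ 2 ≤ C * B * h ^ 2 * (1 + q) := by
    have : 0 ≤ C * B * h ^ 2 := by positivity
    nlinarith
  have e : σs - (p0 + S * h * p2 / 2) = (σs - m) + (m - (p0 + S * h * p2 / 2)) := by ring
  rw [e]
  refine (abs_add_le _ _).trans ?_
  calc _ ≤ B * (K * h ^ 2) * (C' * (1 + q)) + C * B * h ^ 2 * (1 + q) := by linarith
    _ = _ := by ring

/-- the truncated double sum -/
def dsum (S1 S2 D1 D2 b h X0 Y0 : ℝ) (m : ℝ × ℝ) (φ : ℝ × ℝ → ℝ) (s1 s2 : Finset ℤ)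
    (W1 W2 : ℤ → ℝ) : ℝ :=
  ∑ l ∈ s1, W1 l * ((∑ d ∈ s2, W2 d * (φ (X0 + l * (D1 * h), Y0 + d * (D2 * h)) *
    kd S2 D2 h (Y0 - m.2 - b * ud D1 h (X0 - m.1) l) d)) * kd S1 D1 h (X0 - m.1) l)

lemma dsum_bdd (S1 S2 D1 D2 b : ℝ) (hS1 : 0 < S1) (hS2 : 0 < S2) (hD1 : 0 < D1) (hD2 : 0 < D2)
    (φ : ℝ × ℝ → ℝ) (hφ : Nice φ) : ∃ C > (0:ℝ), ∀ (h X0 Y0 : ℝ) (m : ℝ × ℝ) (s1 s2 : Finset ℤ)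
    (W1 W2 : ℤ → ℝ), 0 < h → h ≤ 1 → (∀ d, 0 ≤ W1 d) → (∀ d, W1 d ≤ 1) →
    (∀ d, 0 ≤ W2 d) → (∀ d, W2 d ≤ 1) →
    |dsum S1 S2 D1 D2 b h X0 Y0 m φ s1 s2 W1 W2| ≤ C := by
  obtain ⟨B, hB, hb⟩ := hφ.bdd
  obtain ⟨C1, hC1, H1⟩ := disc_mass_fin S1 D1 hS1 hD1
  obtain ⟨C2, hC2, H2⟩ := disc_mass_fin S2 D2 hS2 hD2
  refine ⟨(B * C2) * C1, by positivity, ?_⟩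
  intro h X0 Y0 m s1 s2 W1 W2 hh h1 hW1 hW1' hW2 hW2'
  unfold dsum
  have hin : ∀ l : ℤ, |∑ d ∈ s2, W2 d * (φ (X0 + l * (D1 * h), Y0 + d * (D2 * h)) *
    kd S2 D2 h (Y0 - m.2 - b * ud D1 h (X0 - m.1) l) d)| ≤ B * C2 := by
    intro l
    refine (Finset.abs_sum_le_sum_abs _ _).trans ?_
    refine le_trans ?_ (mul_le_mul_of_nonneg_left
      (H2 h (Y0 - m.2 - b * ud D1 h (X0 - m.1) l) s2 hh h1) hB.le)
    rw [Finset.mul_sum]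
    refine Finset.sum_le_sum fun d _ => ?_
    have hk := kd_nonneg S2 D2 h (Y0 - m.2 - b * ud D1 h (X0 - m.1) l) d hD2 hh
    rw [abs_mul, abs_mul, abs_of_nonneg hk, abs_of_nonneg (hW2 d)]
    calc _ ≤ 1 * (B * kd S2 D2 h (Y0 - m.2 - b * ud D1 h (X0 - m.1) l) d) := by
          gcongr
          · exact hW2' d
          · exact hb _
      _ = _ := by ring
  refine (Finset.abs_sum_le_sum_abs _ _).trans ?_
  refine le_trans ?_ (mul_le_mul_of_nonneg_left (H1 h (X0 - m.1) s1 hh h1) (by positivity))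
  rw [Finset.mul_sum]
  refine Finset.sum_le_sum fun l _ => ?_
  have hk := kd_nonneg S1 D1 h (X0 - m.1) l hD1 hh
  rw [abs_mul, abs_mul, abs_of_nonneg hk, abs_of_nonneg (hW1 l)]
  calc _ ≤ 1 * (B * C2 * kd S1 D1 h (X0 - m.1) l) := by
        gcongr
        · exact hW1' l
        · exact hin l
    _ = _ := by ring

set_option maxHeartbeats 1000000 in
lemma disc2 (S1 S2 D1 D2 b K : ℝ) (hS1 : 0 < S1) (hS2 : 0 < S2) (hD1 : 0 < D1) (hD2 : 0 < D2)
    (hK : 0 < K) (φ : ℝ × ℝ → ℝ) (hφ : Nice φ) : ∃ C > (0:ℝ), ∀ (h X0 Y0 q : ℝ) (m : ℝ × ℝ)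
    (s1 s2 : Finset ℤ) (W1 W2 : ℤ → ℝ), 0 < h → h ≤ 1 → 0 ≤ q →
    (∀ d, d ∉ s1 → W1 d = 0) → (∀ d, d ∉ s2 → W2 d = 0) →
    (∀ d, 0 ≤ W1 d) → (∀ d, W1 d ≤ 1) → (∀ d, W2 d ≤ 1) →
    (∀ l : ℤ, 1 - W1 l ≤ K * h ^ 2 * (q + (X0 + l * (D1 * h) - m.1) ^ 2)) →
    (∀ d : ℤ, 1 - W2 d ≤ K * h ^ 2 * (q + (Y0 + d * (D2 * h) - m.2) ^ 2)) →
    |dsum S1 S2 D1 D2 b h X0 Y0 m φ s1 s2 W1 W2 - (φ m + S2 * h * dd (0, 1) (dd (0, 1) φ) m / 2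
      + S1 * h * dd (1, b) (dd (1, b) φ) m / 2)| ≤ C * h ^ 2 * (1 + q) := by
  have nyy := (hφ.dd (0, 1)).dd (0, 1)
  obtain ⟨By, hBy, ty⟩ := hφ.taylor3 (0, 1)
  obtain ⟨Be, hBe, te⟩ := hφ.taylor3 (1, b)
  obtain ⟨Bz, hBz, tz⟩ := nyy.taylor3 (1, b)
  obtain ⟨C1, hC1, H1⟩ := disc_w S1 D1 K hS1 hD1 hK
  obtain ⟨C2, hC2, H2⟩ := disc_w S2 D2 (2 * K) hS2 hD2 (by positivity)
  obtain ⟨C3, hC3, H3⟩ := disc_mom_fin S1 D1 hS1 hD1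
  refine ⟨C1 * Be + S2 * (C1 * Bz + S1 * Bz) + C2 * By * (2 * b ^ 2 + 1) * (C3 * 2),
    by positivity, ?_⟩
  intro h X0 Y0 q m s1 s2 W1 W2 hh h1 hq hW1 hW2 hp1 hl1 hl2 hk1 hk2
  set φyy := dd (0, 1) (dd (0, 1) φ) with hφyy
  have hz : ∀ l : ℤ, (X0 + l * (D1 * h) - m.1) = ud D1 h (X0 - m.1) l := by
    intro l; unfold ud; ring
  simp_rw [hz] at hk1
  set u := ud D1 h (X0 - m.1) with hu
  set k1 := kd S1 D1 h (X0 - m.1) with hk1d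
  set I : ℤ → ℝ := fun l => ∑ d ∈ s2, W2 d * (φ (X0 + l * (D1 * h), Y0 + d * (D2 * h)) *
    kd S2 D2 h (Y0 - m.2 - b * u l) d) with hI
  have hIn : ∀ l : ℤ, |I l - (φ (m + u l • ((1:ℝ), b)) + S2 * h * φyy (m + u l • ((1:ℝ), b)) / 2)| ≤
      C2 * By * h ^ 2 * (1 + (q + 2 * b ^ 2 * u l ^ 2)) := by
    intro l
    obtain ⟨t0, t1, t2, t3, t4⟩ := ty (m + u l • ((1:ℝ), b))
    have := H2 h (Y0 - m.2 - b * u l) By (q + 2 * b ^ 2 * u l ^ 2) _ _ _ _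
      (fun t => φ (m + u l • ((1:ℝ), b) + t • ((0:ℝ), (1:ℝ)))) s2 W2 hh h1 (by positivity)
      t0 t1 t2 t3 t4 (fun t => (ty _).1) hW2 hl2 (fun d => by
        refine (hk2 d).trans ?_
        have e : Y0 + d * (D2 * h) - m.2 = ud D2 h (Y0 - m.2 - b * u l) d + b * u l := by
          unfold ud; ring
        rw [e]
        set t := ud D2 h (Y0 - m.2 - b * u l) d
        calc K * h ^ 2 * (q + (t + b * u l) ^ 2) ≤
            K * h ^ 2 * (2 * (q + 2 * b ^ 2 * u l ^ 2 + t ^ 2)) := by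
              gcongr
              nlinarith [sq_nonneg (t - b * u l), sq_nonneg (b * u l)]
          _ = _ := by ring)
    convert this using 4
    congr 3
    ext
    · have := hz l
      simp
      linarith
    · simp [ud]
      try ring
  have hO1 := by
    obtain ⟨t0, t1, t2, t3, t4⟩ := te m
    exact H1 h (X0 - m.1) Be q _ _ _ _ (fun t => φ (m + t • ((1:ℝ), b))) s1 W1 hh h1 hq
      t0 t1 t2 t3 t4 (fun t => (te _).1) hW1 hl1 hk1
  have hO2 := by
    obtain ⟨t0, t1, t2, t3, t4⟩ := tz m
    exact H1 h (X0 - m.1) Bz q _ _ _ _ (fun t => φyy (m + t • ((1:ℝ), b))) s1 W1 hh h1 hq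
      t0 t1 t2 t3 t4 (fun t => (tz _).1) hW1 hl1 hk1
  simp only [← hu, ← hk1d] at hO1 hO2
  have hO3 : |∑ l ∈ s1, W1 l * ((I l - (φ (m + u l • ((1:ℝ), b)) +
      S2 * h * φyy (m + u l • ((1:ℝ), b)) / 2)) * k1 l)| ≤
      C2 * By * (2 * b ^ 2 + 1) * (C3 * 2) * h ^ 2 * (1 + q) := by
    have hm := H3 h (X0 - m.1) (1 + q) s1 hh h1 (by positivity)
    simp only [← hu, ← hk1d] at hm
    refine (Finset.abs_sum_le_sum_abs _ _).trans ?_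
    calc _ ≤ ∑ l ∈ s1, C2 * By * (2 * b ^ 2 + 1) * h ^ 2 * (((1 + q) + u l ^ 2) * k1 l) := by
          refine Finset.sum_le_sum fun l _ => ?_
          have hk : 0 ≤ k1 l := kd_nonneg S1 D1 h (X0 - m.1) l hD1 hh
          rw [abs_mul, abs_mul, abs_of_nonneg hk, abs_of_nonneg (hp1 l)]
          calc _ ≤ 1 * ((C2 * By * h ^ 2 * (1 + (q + 2 * b ^ 2 * u l ^ 2))) * k1 l) := by
                gcongr
                · exact hl1 l
                · exact hIn l
            _ ≤ 1 * ((C2 * By * h ^ 2 * ((2 * b ^ 2 + 1) * (1 + q + u l ^ 2))) * k1 l) := by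
                gcongr
                nlinarith [mul_nonneg (sq_nonneg b) hq, sq_nonneg b, sq_nonneg (u l)]
            _ = _ := by ring
      _ = C2 * By * (2 * b ^ 2 + 1) * h ^ 2 * ∑ l ∈ s1, (((1 + q) + u l ^ 2) * k1 l) := by
          rw [Finset.mul_sum]
      _ ≤ C2 * By * (2 * b ^ 2 + 1) * h ^ 2 * (C3 * (1 + (1 + q))) := by gcongr
      _ ≤ C2 * By * (2 * b ^ 2 + 1) * h ^ 2 * (C3 * (2 * (1 + q))) := by gcongr; linarith
      _ = _ := by ring
  have hsplit : dsum S1 S2 D1 D2 b h X0 Y0 m φ s1 s2 W1 W2 =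
      ∑ l ∈ s1, W1 l * (φ (m + u l • ((1:ℝ), b)) * k1 l)
      + S2 * h / 2 * ∑ l ∈ s1, W1 l * (φyy (m + u l • ((1:ℝ), b)) * k1 l)
      + ∑ l ∈ s1, W1 l * ((I l - (φ (m + u l • ((1:ℝ), b)) +
      S2 * h * φyy (m + u l • ((1:ℝ), b)) / 2)) * k1 l) := by
    rw [Finset.mul_sum, ← Finset.sum_add_distrib, ← Finset.sum_add_distrib]
    unfold dsum
    refine Finset.sum_congr rfl fun l _ => ?_
    simp only [hI, hu, hk1d]
    ring
  rw [hsplit]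
  set A1 := ∑ l ∈ s1, W1 l * (φ (m + u l • ((1:ℝ), b)) * k1 l)
  set A2 := ∑ l ∈ s1, W1 l * (φyy (m + u l • ((1:ℝ), b)) * k1 l)
  set A3 := ∑ l ∈ s1, W1 l * ((I l - (φ (m + u l • ((1:ℝ), b)) +
      S2 * h * φyy (m + u l • ((1:ℝ), b)) / 2)) * k1 l)
  have tz2 := (tz m).2.2.1
  set z2 := dd (1, b) (dd (1, b) φyy) m
  have hh2 : h ^ 2 ≤ h := by nlinarith
  have hA2 : |A2 - φyy m| ≤ (C1 * Bz + S1 * Bz) * h * (1 + q) := by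
    have e : A2 - φyy m = (A2 - (φyy m + S1 * h * z2 / 2)) + S1 * h * z2 / 2 := by ring
    rw [e]
    refine (abs_add_le _ _).trans ?_
    have h5 : |S1 * h * z2 / 2| ≤ S1 * h * Bz := by
      rw [abs_div, abs_mul, abs_of_pos (by positivity : 0 < S1 * h), abs_two]
      have := abs_nonneg z2
      have : S1 * h * |z2| ≤ S1 * h * Bz := by gcongr
      have : 0 ≤ S1 * h * |z2| := by positivity
      linarith
    have h6 : C1 * Bz * h ^ 2 * (1 + q) ≤ C1 * Bz * h * (1 + q) := by gcongr
    have h7 : 0 ≤ S1 * h * Bz * q := by positivity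
    nlinarith
  have hA2' : |S2 * h / 2 * (A2 - φyy m)| ≤ S2 * (C1 * Bz + S1 * Bz) * h ^ 2 * (1 + q) := by
    rw [abs_mul, abs_of_pos (by positivity : 0 < S2 * h / 2)]
    calc _ ≤ S2 * h * ((C1 * Bz + S1 * Bz) * h * (1 + q)) := by
          gcongr
          have : 0 ≤ S2 * h := by positivity
          linarith
      _ = _ := by ring
  have e : A1 + S2 * h / 2 * A2 + A3 - (φ m + S2 * h * φyy m / 2
      + S1 * h * dd (1, b) (dd (1, b) φ) m / 2) =
      (A1 - (φ m + S1 * h * dd (1, b) (dd (1, b) φ) m / 2)) + S2 * h / 2 * (A2 - φyy m) + A3 := by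
    ring
  rw [e]
  rw [abs_le] at hO1 hA2' hO3 ⊢
  constructor <;> linarith

lemma dd_comb (a b : ℝ) (ψ : ℝ × ℝ → ℝ) (w : ℝ × ℝ) :
    dd (a, b) ψ w = a * dd (1, 0) ψ w + b * dd (0, 1) ψ w := by
  unfold dd
  have : ((a, b) : ℝ × ℝ) = a • ((1:ℝ), (0:ℝ)) + b • ((0:ℝ), (1:ℝ)) := by simp
  rw [this, map_add, map_smul, map_smul]; simp

lemma Nice.dd_dd {ψ : ℝ × ℝ → ℝ} (h : Nice ψ) (e e' w : ℝ × ℝ) :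
    _root_.dd e (_root_.dd e' ψ) w = fderiv ℝ (fderiv ℝ ψ) w e e' := by
  have hf : Differentiable ℝ (fderiv ℝ ψ) :=
    ((h.1 2).fderiv_right (m := 1) (by norm_num)).differentiable (by simp)
  have := ((ContinuousLinearMap.apply ℝ ℝ e').hasFDerivAt.comp w (hf w).hasFDerivAt).fderiv
  have h2 : _root_.dd e' ψ = (ContinuousLinearMap.apply ℝ ℝ e') ∘ (fderiv ℝ ψ) := rfl
  rw [h2]
  unfold _root_.dd
  rw [this]; rfl

lemma Nice.dd_sq {ψ : ℝ × ℝ → ℝ} (h : Nice ψ) (b : ℝ) (w : ℝ × ℝ) :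
    _root_.dd (1, b) (_root_.dd (1, b) ψ) w = _root_.dd (1, 0) (_root_.dd (1, 0) ψ) w +
      2 * b * _root_.dd (1, 0) (_root_.dd (0, 1) ψ) w
      + b ^ 2 * _root_.dd (0, 1) (_root_.dd (0, 1) ψ) w := by
  simp only [h.dd_dd]
  have hs : IsSymmSndFDerivAt ℝ ψ w := ((h.1 2).contDiffAt).isSymmSndFDerivAt (by simp)
  have : ((1, b) : ℝ × ℝ) = ((1:ℝ), (0:ℝ)) + b • ((0:ℝ), (1:ℝ)) := by simp
  rw [this, map_add, map_smul]
  simp only [ContinuousLinearMap.add_apply, map_add, map_smul, ContinuousLinearMap.smul_apply,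
    smul_eq_mul]
  rw [hs.eq ((0:ℝ), (1:ℝ)) ((1:ℝ), (0:ℝ))]
  ring

/-- the differential part without the zeroth-order term -/
def L0 (σx σy ρ β1 β2 : ℝ) (ψ : ℝ × ℝ → ℝ) (z : ℝ × ℝ) : ℝ :=
  σx ^ 2 / 2 * dd (1, 0) (dd (1, 0) ψ) z + β1 * dd (1, 0) ψ z
    + σy ^ 2 / 2 * dd (0, 1) (dd (0, 1) ψ) z + β2 * dd (0, 1) ψ z
    + ρ * σx * σy * dd (1, 0) (dd (0, 1) ψ) z

lemma L0_bdd (σx σy ρ β1 β2 : ℝ) (ψ : ℝ × ℝ → ℝ) (hψ : Nice ψ) : ∃ B > (0:ℝ),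
    ∀ z, |L0 σx σy ρ β1 β2 ψ z| ≤ B := by
  obtain ⟨B1, hB1, b1⟩ := ((hψ.dd (1, 0)).dd (1, 0)).bdd
  obtain ⟨B2, hB2, b2⟩ := (hψ.dd (1, 0)).bdd
  obtain ⟨B3, hB3, b3⟩ := ((hψ.dd (0, 1)).dd (0, 1)).bdd
  obtain ⟨B4, hB4, b4⟩ := (hψ.dd (0, 1)).bdd
  obtain ⟨B5, hB5, b5⟩ := ((hψ.dd (0, 1)).dd (1, 0)).bdd
  refine ⟨|σx ^ 2 / 2| * B1 + |β1| * B2 + |σy ^ 2 / 2| * B3 + |β2| * B4 + |ρ * σx * σy| * B5 + 1,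
    by positivity, fun z => ?_⟩
  have k : ∀ a x B : ℝ, |x| ≤ B → |a * x| ≤ |a| * B := fun a x B hx => by
    rw [abs_mul]; gcongr
  unfold L0
  have e1 := k (σx ^ 2 / 2) _ _ (b1 z)
  have e2 := k β1 _ _ (b2 z)
  have e3 := k (σy ^ 2 / 2) _ _ (b3 z)
  have e4 := k β2 _ _ (b4 z)
  have e5 := k (ρ * σx * σy) _ _ (b5 z)
  rw [abs_le] at *
  constructor <;> linarith [e1.1, e1.2, e2.1, e2.2, e3.1, e3.2, e4.1, e4.2, e5.1, e5.2]

set_option maxHeartbeats 1000000 in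
lemma discL (σx σy ρ β1 β2 C1 C2 C3 K : ℝ) (hσx : 0 < σx) (hσy : 0 < σy) (hρ1 : -1 < ρ)
    (hρ2 : ρ < 1) (hC1 : 0 < C1) (hC2 : 0 < C2) (hC3 : 0 < C3)
    (hK : 0 < K) (φ : ℝ × ℝ → ℝ) (hφ : Nice φ) : ∃ C > (0:ℝ), ∀ (h X0 Y0 q : ℝ) (w : ℝ × ℝ)
    (s1 s2 : Finset ℤ) (W1 W2 : ℤ → ℝ), 0 < h → h ≤ 1 → 0 ≤ q →
    (∀ d, d ∉ s1 → W1 d = 0) → (∀ d, d ∉ s2 → W2 d = 0) →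
    (∀ d, 0 ≤ W1 d) → (∀ d, W1 d ≤ 1) → (∀ d, W2 d ≤ 1) →
    (∀ l : ℤ, 1 - W1 l ≤ K * h ^ 2 * (q + (X0 + l * (C1 * h) - (w.1 + C3 * h * β1)) ^ 2)) →
    (∀ d : ℤ, 1 - W2 d ≤ K * h ^ 2 * (q + (Y0 + d * (C2 * h) - (w.2 + C3 * h * β2)) ^ 2)) →
    |dsum (σx ^ 2 * C3) (σy ^ 2 * (1 - ρ ^ 2) * C3) C1 C2 (ρ * σy / σx) h X0 Y0
      (w.1 + C3 * h * β1, w.2 + C3 * h * β2) φ s1 s2 W1 W2 -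
      (φ w + C3 * h * L0 σx σy ρ β1 β2 φ w)| ≤ C * h ^ 2 * (1 + q) := by
  have hρ : 0 < 1 - ρ ^ 2 := by nlinarith
  set b := ρ * σy / σx with hb
  set S1 := σx ^ 2 * C3 with hS1d
  set S2 := σy ^ 2 * (1 - ρ ^ 2) * C3 with hS2d
  have hS1 : 0 < S1 := by positivity
  have hS2 : 0 < S2 := by positivity
  obtain ⟨C, hC, H⟩ := disc2 S1 S2 C1 C2 b K hS1 hS2 hC1 hC2 hK φ hφ
  obtain ⟨B0, hB0, b0⟩ := hφ.taylor1 (β1, β2)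
  obtain ⟨B1, hB1, b1⟩ := ((hφ.dd (0, 1)).dd (0, 1)).lip (β1, β2)
  obtain ⟨B2, hB2, b2⟩ := ((hφ.dd (1, b)).dd (1, b)).lip (β1, β2)
  refine ⟨C + B0 * C3 ^ 2 + S2 * B1 * C3 + S1 * B2 * C3, by positivity, ?_⟩
  intro h X0 Y0 q w s1 s2 W1 W2 hh h1 hq hW1 hW2 hp1 hl1 hl2 hk1 hk2
  have hm : ((w.1 + C3 * h * β1, w.2 + C3 * h * β2) : ℝ × ℝ) = w + (C3 * h) • ((β1, β2) : ℝ × ℝ) := by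
    ext <;> simp
  have := H h X0 Y0 q (w.1 + C3 * h * β1, w.2 + C3 * h * β2) s1 s2 W1 W2 hh h1 hq hW1 hW2 hp1 hl1 hl2 hk1 hk2
  set ds := dsum S1 S2 C1 C2 b h X0 Y0 (w.1 + C3 * h * β1, w.2 + C3 * h * β2) φ s1 s2 W1 W2
  rw [hm] at this
  have e0 := b0 w (C3 * h)
  have e1 := b1 w (C3 * h)
  have e2 := b2 w (C3 * h)
  set m := w + (C3 * h) • ((β1, β2) : ℝ × ℝ)
  rw [abs_of_pos (by positivity : 0 < C3 * h)] at e1 e2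
  have hL : C3 * h * L0 σx σy ρ β1 β2 φ w = C3 * h * dd (β1, β2) φ w +
      S2 * h * dd (0, 1) (dd (0, 1) φ) w / 2 + S1 * h * dd (1, b) (dd (1, b) φ) w / 2 := by
    rw [hφ.dd_sq, dd_comb β1 β2, hS1d, hS2d, hb]
    unfold L0
    field_simp
    ring
  rw [hL]
  have f1 : |S2 * h / 2 * (dd (0, 1) (dd (0, 1) φ) m - dd (0, 1) (dd (0, 1) φ) w)| ≤
      S2 * B1 * C3 * h ^ 2 := by
    rw [abs_mul, abs_of_pos (by positivity : 0 < S2 * h / 2)]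
    calc _ ≤ S2 * h / 2 * (B1 * (C3 * h)) := by gcongr
      _ ≤ S2 * h * (B1 * (C3 * h)) := by gcongr; linarith [(by positivity : 0 < S2 * h)]
      _ = _ := by ring
  have f2 : |S1 * h / 2 * (dd (1, b) (dd (1, b) φ) m - dd (1, b) (dd (1, b) φ) w)| ≤
      S1 * B2 * C3 * h ^ 2 := by
    rw [abs_mul, abs_of_pos (by positivity : 0 < S1 * h / 2)]
    calc _ ≤ S1 * h / 2 * (B2 * (C3 * h)) := by gcongr
      _ ≤ S1 * h * (B2 * (C3 * h)) := by gcongr; linarith [(by positivity : 0 < S1 * h)]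
      _ = _ := by ring
  have g : (B0 * C3 ^ 2 + S2 * B1 * C3 + S1 * B2 * C3) * h ^ 2 ≤
    (B0 * C3 ^ 2 + S2 * B1 * C3 + S1 * B2 * C3) * h ^ 2 * (1 + q) := by
    have : 0 ≤ (B0 * C3 ^ 2 + S2 * B1 * C3 + S1 * B2 * C3) * h ^ 2 := by positivity
    nlinarith
  have e0' : |φ m - φ w - C3 * h * dd (β1, β2) φ w| ≤ B0 * C3 ^ 2 * h ^ 2 := by
    refine e0.trans (le_of_eq ?_); ring
  rw [abs_le] at *
  constructor <;> nlinarith [this.1, this.2, f1.1, f1.2, f2.1, f2.2, e0'.1, e0'.2]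

/-- trapezoidal weight extended by zero -/
def tw (N : ℕ) (l : ℤ) : ℝ := if l ∈ Finset.Icc (-(N : ℤ)) (N : ℤ) then trapWeight N l else 0

lemma tw_nonneg (N : ℕ) (l : ℤ) : 0 ≤ tw N l := by
  unfold tw trapWeight; split_ifs <;> norm_num

lemma tw_le_one (N : ℕ) (l : ℤ) : tw N l ≤ 1 := by
  unfold tw trapWeight; split_ifs <;> norm_num

lemma tw_bound (C1 C' h : ℝ) (hC1 : 0 < C1) (hC' : 0 < C') (hh : 0 < h) (N : ℕ) (n : ℤ)
    (hN : C' / h ≤ 2 * N * (C1 * h)) (hn : 2 * |n| ≤ (N : ℤ) - 2) (l : ℤ) :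
    1 - tw N l ≤ 16 / C' ^ 2 * h ^ 2 * (l * (C1 * h) - n * (C1 * h)) ^ 2 := by
  by_cases hl : |l| < N
  · have h1 : l ∈ Finset.Icc (-(N : ℤ)) (N : ℤ) := by
      rw [Finset.mem_Icc]; exact abs_le.1 hl.le
    have h2 : l.natAbs ≠ N := by
      have := Int.abs_eq_natAbs l
      omega
    unfold tw trapWeight
    rw [if_pos h1, if_neg h2, sub_self]; positivity
  · push Not at hl
    have h1 : (N : ℤ) ≤ 2 * |l - n| := by
      have := abs_sub_abs_le_abs_sub l n
      omega
    have h2 : (N : ℝ) ≤ 2 * |(l:ℝ) - n| := by exact_mod_cast h1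
    have h3 : C' / (4 * h) ≤ |(l:ℝ) - n| * (C1 * h) := by
      have : C' / (4 * h) = (C' / h) / 4 := by field_simp
      rw [this]
      have : N * (C1 * h) ≤ 2 * |(l:ℝ) - n| * (C1 * h) := by gcongr
      linarith
    have h4 : (C' / (4 * h)) ^ 2 ≤ (l * (C1 * h) - n * (C1 * h)) ^ 2 := by
      have : (l * (C1 * h) - n * (C1 * h)) ^ 2 = (|(l:ℝ) - n| * (C1 * h)) ^ 2 := by
        rw [mul_pow, sq_abs]; ring
      rw [this]
      gcongr
    calc 1 - tw N l ≤ 1 := by linarith [tw_nonneg N l]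
      _ = 16 / C' ^ 2 * h ^ 2 * (C' / (4 * h)) ^ 2 := by field_simp; norm_num
      _ ≤ _ := by gcongr

set_option maxHeartbeats 1000000 in
lemma discQ (σx σy ρ β1 β2 C1 C2 C3 C1' C2' : ℝ) (hσx : 0 < σx) (hσy : 0 < σy) (hρ1 : -1 < ρ)
    (hρ2 : ρ < 1) (hC1 : 0 < C1) (hC2 : 0 < C2) (hC3 : 0 < C3) (hC1' : 0 < C1') (hC2' : 0 < C2')
    (φ : ℝ × ℝ → ℝ) (hφ : Nice φ) : ∃ C > (0:ℝ), ∀ (h X0 Y0 : ℝ) (N J : ℕ) (n j : ℤ) (s : ℝ × ℝ),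
    0 < h → h ≤ 1 → C1' / h ≤ 2 * N * (C1 * h) → C2' / h ≤ 2 * J * (C2 * h) →
    2 * |n| ≤ (N : ℤ) - 2 → 2 * |j| ≤ (J : ℤ) - 2 →
    |dsum (σx ^ 2 * C3) (σy ^ 2 * (1 - ρ ^ 2) * C3) C1 C2 (ρ * σy / σx) h X0 Y0
      (X0 + n * (C1 * h) + s.1 + C3 * h * β1, Y0 + j * (C2 * h) + s.2 + C3 * h * β2) φ
      (Finset.Icc (-(N : ℤ)) (N : ℤ)) (Finset.Icc (-(J : ℤ)) (J : ℤ)) (tw N) (tw J) -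
      (φ (X0 + n * (C1 * h) + s.1, Y0 + j * (C2 * h) + s.2)
        + C3 * h * L0 σx σy ρ β1 β2 φ (X0 + n * (C1 * h) + s.1, Y0 + j * (C2 * h) + s.2))|
      ≤ C * h ^ 2 * (1 + s.1 ^ 2 + s.2 ^ 2) := by
  obtain ⟨C, hC, H⟩ := discL σx σy ρ β1 β2 C1 C2 C3 (3 * (16 / C1' ^ 2 + 16 / C2' ^ 2)) hσx hσy
    hρ1 hρ2 hC1 hC2 hC3 (by positivity) φ hφ
  set A := C3 ^ 2 * (β1 ^ 2 + β2 ^ 2) with hA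
  have hA0 : 0 ≤ A := by positivity
  refine ⟨C * (1 + A), by positivity, ?_⟩
  intro h X0 Y0 N J n j s hh h1 hN hJ hn hj
  have key : ∀ x s β : ℝ, (x + s + C3 * h * β) ^ 2 ≤ 3 * (s ^ 2 + C3 ^ 2 * β ^ 2 + x ^ 2) := by
    intro x s β
    have e : (C3 * h * β) ^ 2 ≤ C3 ^ 2 * β ^ 2 := by
      have : (C3 * h * β) ^ 2 = C3 ^ 2 * β ^ 2 * h ^ 2 := by ring
      rw [this]
      exact mul_le_of_le_one_right (by positivity) (pow_le_one₀ hh.le h1)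
    nlinarith [sq_nonneg (x - s), sq_nonneg (x - C3 * h * β), sq_nonneg (s - C3 * h * β)]
  have := H h X0 Y0 (s.1 ^ 2 + s.2 ^ 2 + A) (X0 + n * (C1 * h) + s.1, Y0 + j * (C2 * h) + s.2)
    (Finset.Icc (-(N : ℤ)) (N : ℤ)) (Finset.Icc (-(J : ℤ)) (J : ℤ)) (tw N) (tw J) hh h1
    (by positivity) (fun d hd => by unfold tw; rw [if_neg hd]) (fun d hd => by unfold tw; rw [if_neg hd])
    (tw_nonneg N) (tw_le_one N) (tw_le_one J)
    (fun l => by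
      refine (tw_bound C1 C1' h hC1 hC1' hh N n hN hn l).trans ?_
      simp only
      set x := X0 + l * (C1 * h) - (X0 + n * (C1 * h) + s.1 + C3 * h * β1) with hx
      have e : l * (C1 * h) - n * (C1 * h) = x + s.1 + C3 * h * β1 := by rw [hx]; ring
      rw [e]
      calc _ ≤ (16 / C1' ^ 2 + 16 / C2' ^ 2) * h ^ 2 * (3 * (s.1 ^ 2 + s.2 ^ 2 + A + x ^ 2)) := by
            gcongr
            · have : 0 < 16 / C2' ^ 2 := by positivity
              linarith
            · refine (key x s.1 β1).trans ?_
              have : 0 ≤ C3 ^ 2 * β2 ^ 2 := by positivity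
              nlinarith [sq_nonneg s.2]
        _ = _ := by ring)
    (fun l => by
      refine (tw_bound C2 C2' h hC2 hC2' hh J j hJ hj l).trans ?_
      simp only
      set x := Y0 + l * (C2 * h) - (Y0 + j * (C2 * h) + s.2 + C3 * h * β2) with hx
      have e : l * (C2 * h) - j * (C2 * h) = x + s.2 + C3 * h * β2 := by rw [hx]; ring
      rw [e]
      calc _ ≤ (16 / C1' ^ 2 + 16 / C2' ^ 2) * h ^ 2 * (3 * (s.1 ^ 2 + s.2 ^ 2 + A + x ^ 2)) := by
            gcongr
            · have : 0 < 16 / C1' ^ 2 := by positivity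
              linarith
            · refine (key x s.2 β2).trans ?_
              have : 0 ≤ C3 ^ 2 * β1 ^ 2 := by positivity
              nlinarith [sq_nonneg s.1]
        _ = _ := by ring)
  refine this.trans ?_
  calc _ = C * h ^ 2 * (1 + (s.1 ^ 2 + s.2 ^ 2 + A)) := rfl
    _ ≤ C * h ^ 2 * ((1 + A) * (1 + s.1 ^ 2 + s.2 ^ 2)) := by
      gcongr
      nlinarith [mul_nonneg hA0 (sq_nonneg s.1), mul_nonneg hA0 (sq_nonneg s.2)]
    _ = _ := by ring

lemma int1d (c μ σ : ℝ) (hc : 0 < c) (hσ : 0 < σ) :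
    Integrable (fun x : ℝ => (1 + x ^ 2) * Real.exp (-c * ((x - μ) / σ) ^ 2)) := by
  have hd : 0 < c / σ ^ 2 := by positivity
  have h0 := integrable_exp_neg_mul_sq hd
  have h1 := integrable_mul_exp_neg_mul_sq hd
  have h2 := integrable_rpow_mul_exp_neg_mul_sq hd (s := 2) (by norm_num)
  simp only [Real.rpow_two] at h2
  have h3 := (((h0.const_mul (1 + μ ^ 2)).add (h1.const_mul (2 * μ))).add h2).comp_sub_right μ
  refine h3.congr (Filter.Eventually.of_forall fun x => ?_)
  simp only [Pi.add_apply]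
  have : -c * ((x - μ) / σ) ^ 2 = -(c / σ ^ 2) * (x - μ) ^ 2 := by field_simp
  rw [this]; ring

lemma md_cont (μx μy σtx σty ρh : ℝ) : Continuous (mertonDensity2 μx μy σtx σty ρh) := by
  unfold mertonDensity2; fun_prop

lemma md_nonneg (μx μy σtx σty ρh : ℝ) (hσtx : 0 < σtx) (hσty : 0 < σty) (s : ℝ × ℝ) :
    0 ≤ mertonDensity2 μx μy σtx σty ρh s := by
  unfold mertonDensity2; positivity

lemma quad_lb (ρ a b : ℝ) : (1 - |ρ|) * (a ^ 2 + b ^ 2) ≤ a ^ 2 - 2 * ρ * (a * b) + b ^ 2 := by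
  rcases abs_cases ρ with ⟨h, h'⟩ | ⟨h, h'⟩ <;> rw [h]
  · nlinarith [mul_nonneg h' (sq_nonneg (a - b))]
  · nlinarith [mul_nonneg (neg_nonneg.2 h'.le) (sq_nonneg (a + b))]

lemma md_moment (μx μy σtx σty ρh : ℝ) (hσtx : 0 < σtx) (hσty : 0 < σty) (h1 : -1 < ρh)
    (h2 : ρh < 1) :
    Integrable (fun s : ℝ × ℝ => (1 + s.1 ^ 2 + s.2 ^ 2) * mertonDensity2 μx μy σtx σty ρh s) := by
  have hρ : 0 < 1 - ρh ^ 2 := by nlinarith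
  have hρ' : 0 < 1 - |ρh| := by
    have := abs_lt.2 ⟨h1, h2⟩; linarith
  set c := (1 - |ρh|) / (2 * (1 - ρh ^ 2)) with hc
  have hc0 : 0 < c := by positivity
  set A := 1 / (2 * Real.pi * σtx * σty * Real.sqrt (1 - ρh ^ 2)) with hA
  have hA0 : 0 ≤ A := by positivity
  have hI := ((int1d c μx σtx hc0 hσtx).mul_prod (int1d c μy σty hc0 hσty)).const_mul A
  refine hI.mono' ?_ (Filter.Eventually.of_forall fun s => ?_)
  · exact ((by fun_prop : Continuous fun s : ℝ × ℝ => 1 + s.1 ^ 2 + s.2 ^ 2).mul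
      (md_cont μx μy σtx σty ρh)).aestronglyMeasurable
  · have hn := md_nonneg μx μy σtx σty ρh hσtx hσty s
    rw [Real.norm_eq_abs, abs_of_nonneg (by positivity)]
    unfold mertonDensity2
    rw [← hA]
    have hq := quad_lb ρh ((s.1 - μx) / σtx) ((s.2 - μy) / σty)
    have he : (s.1 - μx) / σtx * ((s.2 - μy) / σty) = (s.1 - μx) * (s.2 - μy) / (σtx * σty) := by
      field_simp
    rw [he] at hq
    set a := (s.1 - μx) / σtx
    set b := (s.2 - μy) / σty
    have hE : Real.exp (-1 / (2 * (1 - ρh ^ 2)) *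
        (a ^ 2 - 2 * ρh * ((s.1 - μx) * (s.2 - μy) / (σtx * σty)) + b ^ 2)) ≤
        Real.exp (-c * a ^ 2) * Real.exp (-c * b ^ 2) := by
      rw [← Real.exp_add]
      apply Real.exp_le_exp.2
      have e : -c * a ^ 2 + -c * b ^ 2 = -1 / (2 * (1 - ρh ^ 2)) * ((1 - |ρh|) * (a ^ 2 + b ^ 2)) := by
        rw [hc]; field_simp; ring
      rw [e]
      apply mul_le_mul_of_nonpos_left hq
      apply div_nonpos_of_nonpos_of_nonneg <;> linarith
    calc _ ≤ ((1 + s.1 ^ 2) * (1 + s.2 ^ 2)) * (A * (Real.exp (-c * a ^ 2) * Real.exp (-c * b ^ 2))) := by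
          gcongr
          nlinarith [mul_nonneg (sq_nonneg s.1) (sq_nonneg s.2)]
      _ = _ := by ring

lemma md_int (μx μy σtx σty ρh : ℝ) (hσtx : 0 < σtx) (hσty : 0 < σty) (h1 : -1 < ρh)
    (h2 : ρh < 1) : Integrable (mertonDensity2 μx μy σtx σty ρh) := by
  refine (md_moment μx μy σtx σty ρh hσtx hσty h1 h2).mono'
    (md_cont _ _ _ _ _).aestronglyMeasurable (Filter.Eventually.of_forall fun s => ?_)
  have hn := md_nonneg μx μy σtx σty ρh hσtx hσty s
  rw [Real.norm_eq_abs, abs_of_nonneg hn]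
  nlinarith [mul_nonneg (sq_nonneg s.1) hn, mul_nonneg (sq_nonneg s.2) hn]

/-- Gaussian oscillating kernel on the Fourier side. -/
def ek (σx σy ρ τ β1 β2 : ℝ) (z η : ℝ × ℝ) : ℂ :=
  Complex.exp (Complex.I * ((η.1 * (z.1 + β1 * τ) + η.2 * (z.2 + β2 * τ) : ℝ) : ℂ) +
    ((-(1 / 2) * (σx ^ 2 * η.1 ^ 2 + 2 * ρ * σx * σy * η.1 * η.2 + σy ^ 2 * η.2 ^ 2) * τ : ℝ) : ℂ))

/-- Gaussian majorant. -/
def eg (σx σy ρ τ : ℝ) (η : ℝ × ℝ) : ℝ :=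
  Real.exp (-(τ / 2 * (1 - |ρ|) * σx ^ 2) * η.1 ^ 2) *
    Real.exp (-(τ / 2 * (1 - |ρ|) * σy ^ 2) * η.2 ^ 2)

lemma eg_nonneg (σx σy ρ τ : ℝ) (η : ℝ × ℝ) : 0 ≤ eg σx σy ρ τ η := by unfold eg; positivity

lemma ek_cont (σx σy ρ τ β1 β2 : ℝ) :
    Continuous (fun p : (ℝ × ℝ) × (ℝ × ℝ) => ek σx σy ρ τ β1 β2 p.1 p.2) := by
  unfold ek; fun_prop

lemma ek_norm_le (σx σy ρ τ β1 β2 : ℝ) (hτ : 0 < τ) (z η : ℝ × ℝ) :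
    ‖ek σx σy ρ τ β1 β2 z η‖ ≤ eg σx σy ρ τ η := by
  unfold ek eg
  rw [Complex.exp_add, norm_mul, mul_comm Complex.I, Complex.norm_exp_ofReal_mul_I, one_mul,
    Complex.norm_exp_ofReal, ← Real.exp_add]
  apply Real.exp_le_exp.2
  have := quad_lb (-ρ) (σx * η.1) (σy * η.2)
  rw [abs_neg] at this
  nlinarith

lemma eg_int (σx σy ρ τ : ℝ) (hσx : 0 < σx) (hσy : 0 < σy) (h1 : -1 < ρ) (h2 : ρ < 1)
    (hτ : 0 < τ) : Integrable (eg σx σy ρ τ) := by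
  have hρ' : 0 < 1 - |ρ| := by
    have := abs_lt.2 ⟨h1, h2⟩; linarith
  exact (integrable_exp_neg_mul_sq (by positivity)).mul_prod
    (integrable_exp_neg_mul_sq (by positivity))

lemma js_norm_le (f : ℝ × ℝ → ℝ) (hf0 : ∀ s, 0 ≤ f s) (η : ℝ × ℝ) :
    ‖jumpSymbol2 f η‖ ≤ ∫ s, f s := by
  unfold jumpSymbol2
  refine (norm_integral_le_integral_norm _).trans (le_of_eq ?_)
  refine integral_congr_ae (Filter.Eventually.of_forall fun s => ?_)
  simp only
  rw [norm_mul, mul_comm Complex.I, Complex.norm_exp_ofReal_mul_I, mul_one, Complex.norm_real,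
    Real.norm_eq_abs, abs_of_nonneg (hf0 s)]

lemma js_cont (f : ℝ × ℝ → ℝ) (hf : Continuous f) (hf0 : ∀ s, 0 ≤ f s) (hfi : Integrable f) :
    Continuous (jumpSymbol2 f) := by
  unfold jumpSymbol2
  refine continuous_of_dominated (bound := f) ?_ ?_ hfi ?_
  · intro η
    exact (by fun_prop : Continuous _).aestronglyMeasurable
  · intro η
    refine Filter.Eventually.of_forall fun s => le_of_eq ?_
    rw [norm_mul, mul_comm Complex.I, Complex.norm_exp_ofReal_mul_I, mul_one, Complex.norm_real,
      Real.norm_eq_abs, abs_of_nonneg (hf0 s)]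
  · refine Filter.Eventually.of_forall fun s => ?_
    fun_prop

/-- k-jump kernel -/
def HH (σx σy ρ τ β1 β2 : ℝ) (f : ℝ × ℝ → ℝ) (k : ℕ) (z : ℝ × ℝ) : ℂ :=
  Complex.ofReal (1 / (2 * Real.pi) ^ 2) *
    ∫ η : ℝ × ℝ, ek σx σy ρ τ β1 β2 z η * jumpSymbol2 f η ^ k

lemma HH_integrand_norm (σx σy ρ τ β1 β2 : ℝ) (hτ : 0 < τ) (f : ℝ × ℝ → ℝ)
    (hf0 : ∀ s, 0 ≤ f s) (k : ℕ) (z η : ℝ × ℝ) :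
    ‖ek σx σy ρ τ β1 β2 z η * jumpSymbol2 f η ^ k‖ ≤ eg σx σy ρ τ η * (∫ s, f s) ^ k := by
  rw [norm_mul, norm_pow]
  have := eg_nonneg σx σy ρ τ η
  gcongr
  · exact ek_norm_le σx σy ρ τ β1 β2 hτ z η
  · exact js_norm_le f hf0 η

lemma HH_cont (σx σy ρ τ β1 β2 : ℝ) (hσx : 0 < σx) (hσy : 0 < σy) (h1 : -1 < ρ) (h2 : ρ < 1)
    (hτ : 0 < τ) (f : ℝ × ℝ → ℝ) (hf : Continuous f) (hf0 : ∀ s, 0 ≤ f s) (hfi : Integrable f)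
    (k : ℕ) : Continuous (HH σx σy ρ τ β1 β2 f k) := by
  unfold HH
  have hj := js_cont f hf hf0 hfi
  have he := ek_cont σx σy ρ τ β1 β2
  refine continuous_const.mul ?_
  refine continuous_of_dominated (bound := fun η => eg σx σy ρ τ η * (∫ s, f s) ^ k) ?_ ?_ ?_ ?_
  · intro z
    exact ((he.comp (by fun_prop : Continuous fun η : ℝ × ℝ => (z, η))).mul
      (hj.pow k)).aestronglyMeasurable
  · intro z
    exact Filter.Eventually.of_forall fun η => HH_integrand_norm σx σy ρ τ β1 β2 hτ f hf0 k z η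
  · exact (eg_int σx σy ρ τ hσx hσy h1 h2 hτ).mul_const _
  · refine Filter.Eventually.of_forall fun η => ?_
    exact (he.comp (by fun_prop : Continuous fun z : ℝ × ℝ => (z, η))).mul continuous_const

lemma HH_bdd (σx σy ρ τ β1 β2 : ℝ) (hσx : 0 < σx) (hσy : 0 < σy) (h1 : -1 < ρ) (h2 : ρ < 1)
    (hτ : 0 < τ) (f : ℝ × ℝ → ℝ) (hf0 : ∀ s, 0 ≤ f s)
    (k : ℕ) : ∃ B, ∀ z, ‖HH σx σy ρ τ β1 β2 f k z‖ ≤ B := by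
  refine ⟨‖Complex.ofReal (1 / (2 * Real.pi) ^ 2)‖ * ∫ η, eg σx σy ρ τ η * (∫ s, f s) ^ k,
    fun z => ?_⟩
  unfold HH
  rw [norm_mul]
  gcongr
  exact norm_integral_le_of_norm_le ((eg_int σx σy ρ τ hσx hσy h1 h2 hτ).mul_const _)
    (Filter.Eventually.of_forall fun η => HH_integrand_norm σx σy ρ τ β1 β2 hτ f hf0 k z η)

lemma HH_succ (σx σy ρ τ β1 β2 : ℝ) (hσx : 0 < σx) (hσy : 0 < σy) (h1 : -1 < ρ) (h2 : ρ < 1)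
    (hτ : 0 < τ) (f : ℝ × ℝ → ℝ) (hf : Continuous f) (hf0 : ∀ s, 0 ≤ f s) (hfi : Integrable f)
    (k : ℕ) (z : ℝ × ℝ) : HH σx σy ρ τ β1 β2 f (k + 1) z =
      ∫ s : ℝ × ℝ, HH σx σy ρ τ β1 β2 f k (z + s) * (f s : ℂ) := by
  have hj := js_cont f hf hf0 hfi
  have he := ek_cont σx σy ρ τ β1 β2
  have hsw := integral_integral_swap (μ := (volume : Measure (ℝ × ℝ)))
    (ν := (volume : Measure (ℝ × ℝ)))
    (f := fun η s => ek σx σy ρ τ β1 β2 (z + s) η * jumpSymbol2 f η ^ k * (f s : ℂ)) (by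
      refine ((((eg_int σx σy ρ τ hσx hσy h1 h2 hτ).mul_const ((∫ s, f s) ^ k))).mul_prod
        hfi).mono' ?_ (Filter.Eventually.of_forall fun p => ?_)
      · refine Continuous.aestronglyMeasurable ?_
        have a1 : Continuous fun p : (ℝ × ℝ) × (ℝ × ℝ) => ek σx σy ρ τ β1 β2 (z + p.2) p.1 :=
          he.comp (by fun_prop : Continuous fun p : (ℝ × ℝ) × (ℝ × ℝ) => (z + p.2, p.1))
        exact (a1.mul ((hj.comp continuous_fst).pow k)).mul
          (Complex.continuous_ofReal.comp (hf.comp continuous_snd))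
      · simp only [Function.uncurry]
        rw [norm_mul, Complex.norm_real, Real.norm_eq_abs, abs_of_nonneg (hf0 _)]
        have := hf0 p.2
        gcongr
        exact HH_integrand_norm σx σy ρ τ β1 β2 hτ f hf0 k _ _)
  unfold HH
  simp_rw [mul_assoc, integral_const_mul]
  congr 1
  calc _ = ∫ η : ℝ × ℝ, ∫ s : ℝ × ℝ,
        ek σx σy ρ τ β1 β2 (z + s) η * jumpSymbol2 f η ^ k * (f s : ℂ) := by
        refine integral_congr_ae (Filter.Eventually.of_forall fun η => ?_)
        simp only
        have e : ek σx σy ρ τ β1 β2 z η * jumpSymbol2 f η ^ (k + 1) =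
            (ek σx σy ρ τ β1 β2 z η * jumpSymbol2 f η ^ k) * ∫ s : ℝ × ℝ, Complex.ofReal (f s) *
              Complex.exp (Complex.I * Complex.ofReal (η.1 * s.1 + η.2 * s.2)) := by
          rw [pow_succ, ← mul_assoc]; rfl
        rw [e, ← integral_const_mul]
        refine integral_congr_ae (Filter.Eventually.of_forall fun s => ?_)
        simp only
        have e2 : ek σx σy ρ τ β1 β2 (z + s) η = ek σx σy ρ τ β1 β2 z η *
            Complex.exp (Complex.I * Complex.ofReal (η.1 * s.1 + η.2 * s.2)) := by
          unfold ek
          rw [← Complex.exp_add]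
          congr 1
          simp only [Prod.fst_add, Prod.snd_add]
          push_cast
          ring
        rw [e2]
        ring
    _ = _ := by
        rw [hsw]
        refine integral_congr_ae (Filter.Eventually.of_forall fun s => ?_)
        simp only
        rw [integral_mul_const]

lemma green_hasSum (r lam σx σy ρ κx κy τ : ℝ) (hlam : 0 ≤ lam) (hσx : 0 < σx) (hσy : 0 < σy)
    (h1 : -1 < ρ) (h2 : ρ < 1)
    (hτ : 0 < τ) (f : ℝ × ℝ → ℝ) (hf : Continuous f) (hf0 : ∀ s, 0 ≤ f s) (hfi : Integrable f)
    (z : ℝ × ℝ) : HasSum (fun k : ℕ => ((Real.exp (-(r + lam) * τ) * ((lam * τ) ^ k / k.factorial) : ℝ) : ℂ)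
      * HH σx σy ρ τ (r - lam * κx - σx ^ 2 / 2) (r - lam * κy - σy ^ 2 / 2) f k z)
      (greenFn2 r lam σx σy ρ κx κy f τ z) := by
  set β1 := r - lam * κx - σx ^ 2 / 2 with hβ1
  set β2 := r - lam * κy - σy ^ 2 / 2 with hβ2
  have hj := js_cont f hf hf0 hfi
  have he := ek_cont σx σy ρ τ β1 β2
  have hM : 0 ≤ ∫ s, f s := integral_nonneg hf0
  set M := ∫ s, f s
  have hgi := eg_int σx σy ρ τ hσx hσy h1 h2 hτ
  have hbd : ∀ (k : ℕ) (η : ℝ × ℝ), ‖(((lam * τ) ^ k / k.factorial : ℝ) : ℂ) *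
      (ek σx σy ρ τ β1 β2 z η * jumpSymbol2 f η ^ k)‖ ≤
      eg σx σy ρ τ η * ((lam * τ * M) ^ k / k.factorial) := by
    intro k η
    rw [norm_mul, Complex.norm_real, Real.norm_eq_abs, abs_of_nonneg (by positivity)]
    calc _ ≤ (lam * τ) ^ k / k.factorial * (eg σx σy ρ τ η * M ^ k) := by
          gcongr
          exact HH_integrand_norm σx σy ρ τ β1 β2 hτ f hf0 k _ _
      _ = _ := by rw [mul_pow (lam * τ)]; ring
  have hIntg : ∀ k : ℕ, Integrable fun η : ℝ × ℝ => (((lam * τ) ^ k / k.factorial : ℝ) : ℂ) *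
      (ek σx σy ρ τ β1 β2 z η * jumpSymbol2 f η ^ k) := by
    intro k
    refine (hgi.mul_const _).mono' ?_ (Filter.Eventually.of_forall fun η => hbd k η)
    exact (continuous_const.mul ((he.comp (by fun_prop : Continuous fun η : ℝ × ℝ => (z, η))).mul
      (hj.pow k))).aestronglyMeasurable
  have hs := hasSum_integral_of_summable_integral_norm hIntg (by
    refine Summable.of_nonneg_of_le (fun k => integral_nonneg fun η => norm_nonneg _)
      (fun k => integral_mono (hIntg k).norm (hgi.mul_const _) (fun η => hbd k η)) ?_
    simp_rw [integral_mul_const]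
    exact (Real.summable_pow_div_factorial _).mul_left _)
  have hs2 := hs.mul_left (Complex.ofReal (1 / (2 * Real.pi) ^ 2) *
    ((Real.exp (-(r + lam) * τ) : ℝ) : ℂ))
  convert hs2 using 1
  · rfl
  · funext k
    unfold HH
    rw [integral_const_mul]
    push_cast
    ring
  · unfold greenFn2
    rw [mul_assoc, ← integral_const_mul ((Real.exp (-(r + lam) * τ) : ℝ) : ℂ)]
    refine congrArg (fun x : ℂ => Complex.ofReal (1 / (2 * Real.pi) ^ 2) * x) ?_
    refine integral_congr_ae (Filter.Eventually.of_forall fun η => ?_)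
    simp only
    have ht : ∑' k : ℕ, (((lam * τ) ^ k / k.factorial : ℝ) : ℂ) *
      (ek σx σy ρ τ β1 β2 z η * jumpSymbol2 f η ^ k) =
      ek σx σy ρ τ β1 β2 z η * Complex.exp (lam * τ * jumpSymbol2 f η) := by
      have := NormedSpace.expSeries_div_hasSum_exp (𝔸 := ℂ) ((lam * τ : ℂ) * jumpSymbol2 f η)
      rw [← Complex.exp_eq_exp_ℂ] at this
      rw [← (this.mul_left (ek σx σy ρ τ β1 β2 z η)).tsum_eq]
      congr 1
      funext k
      push_cast
      rw [mul_pow]; ring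
    rw [ht]
    unfold ek
    rw [Complex.ofReal_exp, ← Complex.exp_add, ← Complex.exp_add]
    congr 1
    unfold symbolPsi2
    rw [hβ1, hβ2]
    push_cast
    ring

lemma sqrt_const (v : ℝ) (hv : 0 < v) :
    ((Real.pi : ℂ) / -(-(v : ℂ) / 2)) ^ (1 / 2 : ℂ) =
      ((2 * Real.pi * (1 / Real.sqrt (2 * Real.pi * v)) : ℝ) : ℂ) := by
  have hp := Real.pi_pos
  have e : (Real.pi : ℂ) / -(-(v : ℂ) / 2) = ((Real.pi / (v / 2) : ℝ) : ℂ) := by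
    push_cast; ring
  rw [e, show (1 / 2 : ℂ) = ((1 / 2 : ℝ) : ℂ) by push_cast; rfl,
    ← Complex.ofReal_cpow (by positivity), ← Real.sqrt_eq_rpow]
  congr 1
  have h1 : Real.pi / (v / 2) = (2 * Real.pi) ^ 2 / (2 * Real.pi * v) := by field_simp; 
  rw [h1, Real.sqrt_div (by positivity), Real.sqrt_sq (by positivity)]
  ring

lemma HH_zero (σx σy ρ τ β1 β2 : ℝ) (hσx : 0 < σx) (hσy : 0 < σy) (h1 : -1 < ρ) (h2 : ρ < 1)
    (hτ : 0 < τ) (f : ℝ × ℝ → ℝ) (z : ℝ × ℝ) : HH σx σy ρ τ β1 β2 f 0 z =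
      ((gk (σx ^ 2 * τ) (z.1 + β1 * τ) * gk (σy ^ 2 * (1 - ρ ^ 2) * τ)
        (z.2 + β2 * τ - ρ * σy / σx * (z.1 + β1 * τ)) : ℝ) : ℂ) := by
  have hρ : 0 < 1 - ρ ^ 2 := by nlinarith
  unfold HH
  simp only [pow_zero, mul_one]
  set Z1 := z.1 + β1 * τ with hZ1
  set Z2 := z.2 + β2 * τ with hZ2
  set b := ρ * σy / σx with hb
  have hIntg : Integrable (fun η => ek σx σy ρ τ β1 β2 z η) := by
    refine (eg_int σx σy ρ τ hσx hσy h1 h2 hτ).mono' ?_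
      (Filter.Eventually.of_forall fun η => ek_norm_le σx σy ρ τ β1 β2 hτ z η)
    exact ((ek_cont σx σy ρ τ β1 β2).comp
      (by fun_prop : Continuous fun η : ℝ × ℝ => (z, η))).aestronglyMeasurable
  have e1 : ∫ η : ℝ × ℝ, ek σx σy ρ τ β1 β2 z η = ∫ y : ℝ, ∫ x : ℝ, ek σx σy ρ τ β1 β2 z (x, y) :=
    integral_prod_symm _ hIntg
  rw [e1]
  set v1 := σx ^ 2 * τ with hv1
  set v2 := σy ^ 2 * (1 - ρ ^ 2) * τ with hv2
  have hv1' : 0 < v1 := by positivity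
  have hv2' : 0 < v2 := by positivity
  have cσx : (σx : ℂ) ≠ 0 := by exact_mod_cast hσx.ne'
  have cσy : (σy : ℂ) ≠ 0 := by exact_mod_cast hσy.ne'
  have cτ : (τ : ℂ) ≠ 0 := by exact_mod_cast hτ.ne'
  have cρ : (1 - (ρ : ℂ) ^ 2) ≠ 0 := by exact_mod_cast hρ.ne'
  have cv1 : (v1 : ℂ) ≠ 0 := by exact_mod_cast hv1'.ne'
  have cv2 : (v2 : ℂ) ≠ 0 := by exact_mod_cast hv2'.ne'
  have inner : ∀ y : ℝ, ∫ x : ℝ, ek σx σy ρ τ β1 β2 z (x, y) =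
      ((2 * Real.pi * (1 / Real.sqrt (2 * Real.pi * v1)) : ℝ) : ℂ) *
      Complex.exp ((-(v2 : ℂ) / 2) * (y : ℂ) ^ 2 + (Complex.I * ((Z2 - b * Z1 : ℝ) : ℂ)) * y
        + ((-Z1 ^ 2 / (2 * v1) : ℝ) : ℂ)) := by
    intro y
    have := integral_cexp_quadratic (b := -(v1 : ℂ) / 2)
      (by rw [← Complex.ofReal_neg, ← Complex.ofReal_ofNat, ← Complex.ofReal_div, Complex.ofReal_re]; linarith)
      (Complex.I * (Z1 : ℂ) - ((τ * ρ * σx * σy * y : ℝ) : ℂ))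
      (Complex.I * ((y * Z2 : ℝ) : ℂ) - ((τ * σy ^ 2 * y ^ 2 / 2 : ℝ) : ℂ))
    rw [sqrt_const v1 hv1'] at this
    calc _ = ∫ x : ℝ, Complex.exp (-(v1 : ℂ) / 2 * (x : ℂ) ^ 2 +
          (Complex.I * (Z1 : ℂ) - ((τ * ρ * σx * σy * y : ℝ) : ℂ)) * x +
          (Complex.I * ((y * Z2 : ℝ) : ℂ) - ((τ * σy ^ 2 * y ^ 2 / 2 : ℝ) : ℂ))) := by
          congr 1
          funext x
          unfold ek
          congr 1
          simp only [← hZ1, ← hZ2]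
          rw [hv1]
          push_cast
          ring
      _ = _ := by
          rw [this]
          congr 2
          rw [hv2, hb]
          push_cast
          have hI : Complex.I ^ 2 = -1 := Complex.I_sq
          rw [hv1]
          push_cast
          field_simp
          ring_nf
          rw [hI]
          ring
  simp_rw [inner]
  rw [integral_const_mul]
  rw [integral_cexp_quadratic (b := -(v2 : ℂ) / 2)
      (by rw [← Complex.ofReal_neg, ← Complex.ofReal_ofNat, ← Complex.ofReal_div, Complex.ofReal_re]; linarith),
      sqrt_const v2 hv2']
  have e3 : ((-Z1 ^ 2 / (2 * v1) : ℝ) : ℂ) - (Complex.I * ((Z2 - b * Z1 : ℝ) : ℂ)) ^ 2 /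
      (4 * (-(v2 : ℂ) / 2)) = ((-Z1 ^ 2 / (2 * v1) + -(Z2 - b * Z1) ^ 2 / (2 * v2) : ℝ) : ℂ) := by
    rw [mul_pow, Complex.I_sq]
    push_cast
    field_simp
    ring
  rw [e3, ← Complex.ofReal_exp, ← Complex.ofReal_mul, ← Complex.ofReal_mul, ← Complex.ofReal_mul]
  congr 1
  unfold gk
  rw [Real.exp_add]
  have hp := Real.pi_pos
  field_simp

/-- discretised k-jump convolution -/
def QQ (σx σy ρ τ β1 β2 : ℝ) (f : ℝ × ℝ → ℝ) (s1 s2 : Finset ℤ) (c : ℤ → ℤ → ℝ)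
    (zz : ℤ → ℤ → ℝ × ℝ) (k : ℕ) (w : ℝ × ℝ) : ℂ :=
  ∑ l ∈ s1, ∑ d ∈ s2, (c l d : ℂ) * HH σx σy ρ τ β1 β2 f k (w - zz l d)

lemma QQ_succ (σx σy ρ τ β1 β2 : ℝ) (hσx : 0 < σx) (hσy : 0 < σy) (h1 : -1 < ρ) (h2 : ρ < 1)
    (hτ : 0 < τ) (f : ℝ × ℝ → ℝ) (hf : Continuous f) (hf0 : ∀ s, 0 ≤ f s) (hfi : Integrable f)
    (s1 s2 : Finset ℤ) (c : ℤ → ℤ → ℝ) (zz : ℤ → ℤ → ℝ × ℝ) (k : ℕ) (w : ℝ × ℝ) :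
    QQ σx σy ρ τ β1 β2 f s1 s2 c zz (k + 1) w =
      ∫ s : ℝ × ℝ, QQ σx σy ρ τ β1 β2 f s1 s2 c zz k (w + s) * (f s : ℂ) := by
  obtain ⟨B, hB⟩ := HH_bdd σx σy ρ τ β1 β2 hσx hσy h1 h2 hτ f hf0 k
  have hc := HH_cont σx σy ρ τ β1 β2 hσx hσy h1 h2 hτ f hf hf0 hfi k
  have hi : ∀ l d : ℤ, Integrable fun s : ℝ × ℝ =>
      (c l d : ℂ) * HH σx σy ρ τ β1 β2 f k (w + s - zz l d) * (f s : ℂ) := by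
    intro l d
    refine (hfi.const_mul (|c l d| * B)).mono' ?_ (Filter.Eventually.of_forall fun s => ?_)
    · have := hc.comp (by fun_prop : Continuous fun s : ℝ × ℝ => w + s - zz l d)
      exact ((continuous_const.mul this).mul
        (Complex.continuous_ofReal.comp hf)).aestronglyMeasurable
    · rw [norm_mul, norm_mul, Complex.norm_real, Complex.norm_real, Real.norm_eq_abs,
        Real.norm_eq_abs, abs_of_nonneg (hf0 s)]
      have := hf0 s
      gcongr
      exact hB _
  unfold QQ
  simp_rw [Finset.sum_mul]
  rw [integral_finset_sum _ fun l _ => integrable_finset_sum _ fun d _ => hi l d]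
  refine Finset.sum_congr rfl fun l _ => ?_
  rw [integral_finset_sum _ fun d _ => hi l d]
  refine Finset.sum_congr rfl fun d _ => ?_
  rw [HH_succ σx σy ρ τ β1 β2 hσx hσy h1 h2 hτ f hf hf0 hfi, ← integral_const_mul]
  refine integral_congr_ae (Filter.Eventually.of_forall fun s => ?_)
  simp only
  rw [← mul_assoc, sub_add_eq_add_sub]

lemma QQ_bound (σx σy ρ τ β1 β2 : ℝ) (hσx : 0 < σx) (hσy : 0 < σy) (h1 : -1 < ρ) (h2 : ρ < 1)
    (hτ : 0 < τ) (f : ℝ × ℝ → ℝ) (hf : Continuous f) (hf0 : ∀ s, 0 ≤ f s) (hfi : Integrable f)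
    (s1 s2 : Finset ℤ) (c : ℤ → ℤ → ℝ) (zz : ℤ → ℤ → ℝ × ℝ) (C : ℝ)
    (h0 : ∀ w, ‖QQ σx σy ρ τ β1 β2 f s1 s2 c zz 0 w‖ ≤ C) (k : ℕ) :
    ∀ w, ‖QQ σx σy ρ τ β1 β2 f s1 s2 c zz k w‖ ≤ C * (∫ s, f s) ^ k := by
  induction k with
  | zero => simpa using h0
  | succ k ih =>
    intro w
    rw [QQ_succ σx σy ρ τ β1 β2 hσx hσy h1 h2 hτ f hf hf0 hfi]
    refine (norm_integral_le_of_norm_le (hfi.const_mul (C * (∫ s, f s) ^ k))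
      (Filter.Eventually.of_forall fun s => ?_)).trans (le_of_eq ?_)
    · rw [norm_mul, Complex.norm_real, Real.norm_eq_abs, abs_of_nonneg (hf0 s)]
      exact mul_le_mul_of_nonneg_right (ih _) (hf0 s)
    · rw [integral_const_mul, pow_succ]; ring

lemma QQ_main (r lam σx σy ρ κx κy τ : ℝ) (hr : 0 < r) (hlam : 0 ≤ lam) (hσx : 0 < σx)
    (hσy : 0 < σy) (h1 : -1 < ρ) (h2 : ρ < 1)
    (hτ : 0 < τ) (f : ℝ × ℝ → ℝ) (hf : Continuous f) (hf0 : ∀ s, 0 ≤ f s) (hfi : Integrable f)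
    (s1 s2 : Finset ℤ) (c : ℤ → ℤ → ℝ) (zz : ℤ → ℤ → ℝ × ℝ) (C : ℝ)
    (h0 : ∀ w, ‖QQ σx σy ρ τ (r - lam * κx - σx ^ 2 / 2) (r - lam * κy - σy ^ 2 / 2)
      f s1 s2 c zz 0 w‖ ≤ C) (w : ℝ × ℝ) :
    ‖∑ l ∈ s1, ∑ d ∈ s2, (c l d : ℂ) * greenFn2 r lam σx σy ρ κx κy f τ (w - zz l d) -
      ((Real.exp (-(r + lam) * τ) : ℝ) : ℂ) *
        (QQ σx σy ρ τ (r - lam * κx - σx ^ 2 / 2) (r - lam * κy - σy ^ 2 / 2) f s1 s2 c zz 0 w +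
        ((lam * τ : ℝ) : ℂ) *
        QQ σx σy ρ τ (r - lam * κx - σx ^ 2 / 2) (r - lam * κy - σy ^ 2 / 2) f s1 s2 c zz 1 w)‖
      ≤ C * ((lam * τ * ∫ s, f s) ^ 2 * Real.exp (lam * τ * ∫ s, f s)) := by
  set β1 := r - lam * κx - σx ^ 2 / 2 with hβ1
  set β2 := r - lam * κy - σy ^ 2 / 2 with hβ2
  have hM : 0 ≤ ∫ s, f s := integral_nonneg hf0
  have hQ := QQ_bound σx σy ρ τ β1 β2 hσx hσy h1 h2 hτ f hf hf0 hfi s1 s2 c zz C h0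
  set M := ∫ s, f s
  have hC : 0 ≤ C := (norm_nonneg _).trans (h0 0)
  have hsum : HasSum (fun k : ℕ => ((Real.exp (-(r + lam) * τ) * ((lam * τ) ^ k / k.factorial) : ℝ) : ℂ)
      * QQ σx σy ρ τ β1 β2 f s1 s2 c zz k w)
      (∑ l ∈ s1, ∑ d ∈ s2, (c l d : ℂ) * greenFn2 r lam σx σy ρ κx κy f τ (w - zz l d)) := by
    have := hasSum_sum (s := s1) fun l _ => hasSum_sum (s := s2) fun d _ =>
      (green_hasSum r lam σx σy ρ κx κy τ hlam hσx hσy h1 h2 hτ f hf hf0 hfi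
        (w - zz l d)).mul_left (c l d : ℂ)
    refine this.congr_fun ?_
    intro k
    unfold QQ
    rw [Finset.mul_sum]
    refine Finset.sum_congr rfl fun l _ => ?_
    rw [Finset.mul_sum]
    refine Finset.sum_congr rfl fun d _ => ?_
    ring
  have hexp : HasSum (fun k : ℕ => (lam * τ * M) ^ k / k.factorial) (Real.exp (lam * τ * M)) := by
    have := NormedSpace.expSeries_div_hasSum_exp (𝔸 := ℝ) (lam * τ * M)
    rwa [← Real.exp_eq_exp_ℝ] at this
  have t1 := (hasSum_nat_add_iff' 2).2 hsum
  have t2 := ((hasSum_nat_add_iff' 2).2 hexp).mul_left C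
  have hle1 : Real.exp (-(r + lam) * τ) ≤ 1 := by
    apply Real.exp_le_one_iff.2
    nlinarith [mul_pos hr hτ, mul_nonneg hlam hτ.le]
  have hb := t1.norm_le_of_bounded t2 (fun k => by
    rw [norm_mul, Complex.norm_real, Real.norm_eq_abs, abs_of_nonneg (by positivity)]
    calc _ ≤ 1 * ((lam * τ) ^ (k + 2) / (k + 2).factorial) * (C * M ^ (k + 2)) := by
          gcongr
          exact hQ _ _
      _ = _ := by rw [mul_pow (lam * τ)]; ring)
  have hr2 := (abs_le.1 (real_exp_sub_sum_le (lam * τ * M) 2)).2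
  rw [abs_of_nonneg (by positivity : 0 ≤ lam * τ * M)] at hr2
  refine le_trans (le_of_eq ?_) (hb.trans (mul_le_mul_of_nonneg_left hr2 hC))
  congr 1
  simp [Finset.sum_range_succ]
  ring

lemma QQ_zero (σx σy ρ β1 β2 C1 C2 C3 h X0 Y0 : ℝ) (hσx : 0 < σx) (hσy : 0 < σy)
    (h1 : -1 < ρ) (h2 : ρ < 1) (hC3 : 0 < C3) (hh : 0 < h) (f φ : ℝ × ℝ → ℝ) (s1 s2 : Finset ℤ)
    (W1 W2 : ℤ → ℝ) (w : ℝ × ℝ) :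
    QQ σx σy ρ (C3 * h) β1 β2 f s1 s2
      (fun l d => C1 * h * (C2 * h) * (W1 l * W2 d * φ (X0 + l * (C1 * h), Y0 + d * (C2 * h))))
      (fun l d => (X0 + l * (C1 * h), Y0 + d * (C2 * h))) 0 w =
    ((dsum (σx ^ 2 * C3) (σy ^ 2 * (1 - ρ ^ 2) * C3) C1 C2 (ρ * σy / σx) h X0 Y0
      (w.1 + C3 * h * β1, w.2 + C3 * h * β2) φ s1 s2 W1 W2 : ℝ) : ℂ) := by
  unfold QQ dsum
  push_cast
  refine Finset.sum_congr rfl fun l _ => ?_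
  rw [Finset.sum_mul, Finset.mul_sum]
  refine Finset.sum_congr rfl fun d _ => ?_
  rw [HH_zero σx σy ρ (C3 * h) β1 β2 hσx hσy h1 h2 (by positivity)]
  unfold kd ud
  simp only [Prod.fst_sub, Prod.snd_sub]
  set b := ρ * σy / σx
  have e1 : gk (σx ^ 2 * (C3 * h)) (w.1 - (X0 + l * (C1 * h)) + β1 * (C3 * h)) =
      gk (σx ^ 2 * C3 * h) (X0 - (w.1 + C3 * h * β1) + l * (C1 * h)) := by
    rw [← gk_neg, ← mul_assoc]; congr 1; ring
  have e2 : gk (σy ^ 2 * (1 - ρ ^ 2) * (C3 * h)) (w.2 - (Y0 + d * (C2 * h)) + β2 * (C3 * h) -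
        b * (w.1 - (X0 + l * (C1 * h)) + β1 * (C3 * h))) =
      gk (σy ^ 2 * (1 - ρ ^ 2) * C3 * h) (Y0 - (w.2 + C3 * h * β2) -
        b * (X0 - (w.1 + C3 * h * β1) + l * (C1 * h)) + d * (C2 * h)) := by
    rw [← gk_neg, ← mul_assoc]; congr 1; ring
  rw [e1, e2]
  push_cast
  ring

set_option maxHeartbeats 1000000 in
theorem quadrature_local_consistency_aux
    (r lam σx σy ρ κx κy μx μy σtx σty ρh C₁ C₂ C₃ C₁' C₂' : ℝ)
    (hr : 0 < r) (hlam : 0 ≤ lam) (hσx : 0 < σx) (hσy : 0 < σy)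
    (hρ₁ : -1 < ρ) (hρ₂ : ρ < 1)
    (hσtx : 0 < σtx) (hσty : 0 < σty) (hρh₁ : -1 < ρh) (hρh₂ : ρh < 1)
    (hC₁ : 0 < C₁) (hC₂ : 0 < C₂) (hC₃ : 0 < C₃) (hC₁' : 0 < C₁') (hC₂' : 0 < C₂')
    (φ : ℝ × ℝ → ℝ) (hφ : Nice φ) :
    ∃ C > (0 : ℝ), ∀ h : ℝ, 0 < h → h ≤ 1 →
      ∀ X0 Y0 : ℝ, ∀ N J : ℕ,
        C₁' / h ≤ 2 * N * (C₁ * h) → C₂' / h ≤ 2 * J * (C₂ * h) →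
        ∀ n j : ℤ, 2 * |n| ≤ (N : ℤ) - 2 → 2 * |j| ≤ (J : ℤ) - 2 →
          ‖∑ l ∈ Finset.Icc (-(N : ℤ)) (N : ℤ), ∑ d ∈ Finset.Icc (-(J : ℤ)) (J : ℤ),
            ((C₁ * h * (C₂ * h) * (tw N l * tw J d *
              φ (X0 + (l : ℝ) * (C₁ * h), Y0 + (d : ℝ) * (C₂ * h))) : ℝ) : ℂ) *
              greenFn2 r lam σx σy ρ κx κy (mertonDensity2 μx μy σtx σty ρh) (C₃ * h)
                ((X0 + (n : ℝ) * (C₁ * h), Y0 + (j : ℝ) * (C₂ * h)) -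
                (X0 + (l : ℝ) * (C₁ * h), Y0 + (d : ℝ) * (C₂ * h))) -
              Complex.ofReal
                (φ (X0 + (n : ℝ) * (C₁ * h), Y0 + (j : ℝ) * (C₂ * h)) +
                  C₃ * h *
                    (Lop r lam σx σy ρ κx κy φ
                        (X0 + (n : ℝ) * (C₁ * h), Y0 + (j : ℝ) * (C₂ * h)) +
                      Jop lam (mertonDensity2 μx μy σtx σty ρh) φ
                        (X0 + (n : ℝ) * (C₁ * h), Y0 + (j : ℝ) * (C₂ * h))))‖ ≤
            C * h ^ 2 := by
  have hf := md_cont μx μy σtx σty ρh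
  have hf0 := md_nonneg μx μy σtx σty ρh hσtx hσty
  have hfi := md_int μx μy σtx σty ρh hσtx hσty hρh₁ hρh₂
  have hfm := md_moment μx μy σtx σty ρh hσtx hσty hρh₁ hρh₂
  set f := mertonDensity2 μx μy σtx σty ρh
  set β1 := r - lam * κx - σx ^ 2 / 2 with hβ1
  set β2 := r - lam * κy - σy ^ 2 / 2 with hβ2
  have hρ : 0 < 1 - ρ ^ 2 := by nlinarith
  have hM : 0 ≤ ∫ s, f s := integral_nonneg hf0
  set M := ∫ s, f s with hMd
  have hM2 : 0 ≤ ∫ s : ℝ × ℝ, (1 + s.1 ^ 2 + s.2 ^ 2) * f s :=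
    integral_nonneg fun s => mul_nonneg (by positivity) (hf0 s)
  set M2 := ∫ s : ℝ × ℝ, (1 + s.1 ^ 2 + s.2 ^ 2) * f s with hM2d
  obtain ⟨B, hB, hb⟩ := hφ.bdd
  obtain ⟨BL, hBL, hbL⟩ := L0_bdd σx σy ρ β1 β2 φ hφ
  obtain ⟨Cb, hCb, Hb⟩ := dsum_bdd (σx ^ 2 * C₃) (σy ^ 2 * (1 - ρ ^ 2) * C₃) C₁ C₂ (ρ * σy / σx)
    (by positivity) (by positivity) hC₁ hC₂ φ hφ
  obtain ⟨Cq, hCq, Hq⟩ := discQ σx σy ρ β1 β2 C₁ C₂ C₃ C₁' C₂' hσx hσy hρ₁ hρ₂ hC₁ hC₂ hC₃ hC₁' hC₂'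
    φ hφ
  set a := r + lam with ha
  have ha0 : 0 < a := by positivity
  set E := Real.exp (a * C₃) with hE
  have hE0 : 0 < E := Real.exp_pos _
  refine ⟨Cb * ((lam * C₃ * M) ^ 2 * Real.exp (lam * C₃ * M)) + (a * C₃) ^ 2 * E * B
    + C₃ * (a * C₃ * E) * BL + Cq + lam * C₃ * (a * C₃ * E) * (B * M)
    + lam * C₃ * (Cq * M2 + C₃ * BL * M), by positivity, ?_⟩
  intro h hh h1 X0 Y0 N J hN hJ n j hn hj
  have hh2 : h ^ 2 ≤ h := by nlinarith
  set z : ℝ × ℝ := (X0 + (n : ℝ) * (C₁ * h), Y0 + (j : ℝ) * (C₂ * h)) with hz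
  have hτ : 0 < C₃ * h := by positivity
  set ds : ℝ × ℝ → ℝ := fun w => dsum (σx ^ 2 * C₃) (σy ^ 2 * (1 - ρ ^ 2) * C₃) C₁ C₂
      (ρ * σy / σx) h X0 Y0 (w.1 + C₃ * h * β1, w.2 + C₃ * h * β2) φ (Finset.Icc (-(N : ℤ)) (N : ℤ))
      (Finset.Icc (-(J : ℤ)) (J : ℤ)) (tw N) (tw J) with hds
  have hQ0 := fun w => QQ_zero σx σy ρ β1 β2 C₁ C₂ C₃ h X0 Y0 hσx hσy hρ₁ hρ₂ hC₃ hh f φ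
    (Finset.Icc (-(N : ℤ)) (N : ℤ)) (Finset.Icc (-(J : ℤ)) (J : ℤ)) (tw N) (tw J) w
  have hdsb : ∀ w, |ds w| ≤ Cb := fun w => Hb h X0 Y0 _ _ _ _ _ hh h1 (tw_nonneg N) (tw_le_one N)
    (tw_nonneg J) (tw_le_one J)
  have hdsq : ∀ s, |ds (z + s) - (φ (z + s) + C₃ * h * L0 σx σy ρ β1 β2 φ (z + s))| ≤
      Cq * h ^ 2 * (1 + s.1 ^ 2 + s.2 ^ 2) := fun s => Hq h X0 Y0 N J n j s hh h1 hN hJ hn hj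
  have hmain := QQ_main r lam σx σy ρ κx κy (C₃ * h) hr hlam hσx hσy hρ₁ hρ₂ hτ f hf hf0 hfi
    (Finset.Icc (-(N : ℤ)) (N : ℤ)) (Finset.Icc (-(J : ℤ)) (J : ℤ)) _ _ Cb (fun w => by
      rw [hQ0 w, Complex.norm_real]; exact hdsb w) z
  have hQ1 := QQ_succ σx σy ρ (C₃ * h) β1 β2 hσx hσy hρ₁ hρ₂ hτ f hf hf0 hfi
    (Finset.Icc (-(N : ℤ)) (N : ℤ)) (Finset.Icc (-(J : ℤ)) (J : ℤ)) 
    (fun l d => C₁ * h * (C₂ * h) * (tw N l * tw J d * φ (X0 + l * (C₁ * h), Y0 + d * (C₂ * h))))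
    (fun l d => (X0 + l * (C₁ * h), Y0 + d * (C₂ * h))) 0 z
  simp_rw [hQ0, ← Complex.ofReal_mul] at hQ1
  rw [integral_complex_ofReal] at hQ1
  rw [hQ0] at hmain
  rw [hQ1] at hmain
  change ‖_ - _ * ((ds z : ℂ) + _ * ((∫ s, ds (z + s) * f s : ℝ) : ℂ))‖ ≤ _ at hmain
  have hdsc : Continuous ds := by
    rw [hds]; unfold dsum kd ud gk; fun_prop
  have hφc : Continuous φ := (hφ.1 0).continuous
  set q0 := ds z with hq0
  set q1 := ∫ s, ds (z + s) * f s with hq1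
  set Jf := ∫ s : ℝ × ℝ, φ (z + s) * f s with hJf
  have i1 : Integrable fun s => ds (z + s) * f s := by
    refine (hfi.const_mul Cb).mono' ?_ (Filter.Eventually.of_forall fun s => ?_)
    · exact ((hdsc.comp (by fun_prop : Continuous fun s : ℝ × ℝ => z + s)).mul
        hf).aestronglyMeasurable
    · rw [norm_mul, Real.norm_eq_abs, Real.norm_eq_abs, abs_of_nonneg (hf0 s)]
      exact mul_le_mul_of_nonneg_right (hdsb _) (hf0 s)
  have i2 : Integrable fun s => φ (z + s) * f s := by
    refine (hfi.const_mul B).mono' ?_ (Filter.Eventually.of_forall fun s => ?_)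
    · exact ((hφc.comp (by fun_prop : Continuous fun s : ℝ × ℝ => z + s)).mul
        hf).aestronglyMeasurable
    · rw [norm_mul, Real.norm_eq_abs, Real.norm_eq_abs, abs_of_nonneg (hf0 s)]
      exact mul_le_mul_of_nonneg_right (hb _) (hf0 s)
  have hJb : |Jf| ≤ B * M := by
    rw [← Real.norm_eq_abs, hMd, ← integral_const_mul]
    refine norm_integral_le_of_norm_le (hfi.const_mul B) (Filter.Eventually.of_forall fun s => ?_)
    rw [norm_mul, Real.norm_eq_abs, Real.norm_eq_abs, abs_of_nonneg (hf0 s)]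
    exact mul_le_mul_of_nonneg_right (hb _) (hf0 s)
  have hq1b : |q1 - Jf| ≤ (Cq * M2 + C₃ * BL * M) * h := by
    have e : (Cq * M2 + C₃ * BL * M) * h =
        ∫ s : ℝ × ℝ, (Cq * h) * ((1 + s.1 ^ 2 + s.2 ^ 2) * f s) + (C₃ * BL * h) * f s := by
      rw [integral_add (hfm.const_mul _) (hfi.const_mul _), integral_const_mul, integral_const_mul]
      ring
    rw [hq1, hJf, ← integral_sub i1 i2, e, ← Real.norm_eq_abs]
    refine norm_integral_le_of_norm_le ((hfm.const_mul _).add (hfi.const_mul _))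
      (Filter.Eventually.of_forall fun s => ?_)
    rw [← sub_mul, norm_mul, Real.norm_eq_abs, Real.norm_eq_abs, abs_of_nonneg (hf0 s)]
    have k1 := hdsq s
    have k2 : |C₃ * h * L0 σx σy ρ β1 β2 φ (z + s)| ≤ C₃ * h * BL := by
      rw [abs_mul, abs_of_pos hτ]
      exact mul_le_mul_of_nonneg_left (hbL _) hτ.le
    have k3 : Cq * h ^ 2 * (1 + s.1 ^ 2 + s.2 ^ 2) ≤ Cq * h * (1 + s.1 ^ 2 + s.2 ^ 2) := by gcongr
    have k4 : |ds (z + s) - φ (z + s)| ≤ Cq * h * (1 + s.1 ^ 2 + s.2 ^ 2) + C₃ * h * BL := by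
      rw [abs_le] at *
      constructor <;> linarith [k1.1, k1.2, k2.1, k2.2]
    refine (mul_le_mul_of_nonneg_right k4 (hf0 s)).trans (le_of_eq ?_)
    ring
  have hq0b : |q0 - (φ z + C₃ * h * L0 σx σy ρ β1 β2 φ z)| ≤ Cq * h ^ 2 := by
    simpa using hdsq 0
  set Lz := L0 σx σy ρ β1 β2 φ z with hLz
  have hLop : Lop r lam σx σy ρ κx κy φ z = Lz - a * φ z := rfl
  have hJop : Jop lam f φ z = lam * Jf := rfl
  rw [hLop, hJop]
  have he1 : Real.exp (-a * (C₃ * h)) ≤ 1 := by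
    apply Real.exp_le_one_iff.2
    have : 0 < a * (C₃ * h) := by positivity
    linarith
  have hep : 0 < Real.exp (-a * (C₃ * h)) := Real.exp_pos _
  have hx : |-a * (C₃ * h)| = a * C₃ * h := by
    rw [abs_mul, abs_neg, abs_of_pos ha0, abs_of_pos hτ]; ring
  have hEh : Real.exp (a * C₃ * h) ≤ E := by
    rw [hE]; apply Real.exp_le_exp.2
    have : 0 < a * C₃ := by positivity
    nlinarith
  have hx1 := real_exp_sub_sum_le (-a * (C₃ * h)) 1
  have hx2 := real_exp_sub_sum_le (-a * (C₃ * h)) 2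
  rw [hx] at hx1 hx2
  simp only [Finset.sum_range_succ, Finset.sum_range_zero, Nat.factorial, pow_zero, pow_one,
    zero_add, Nat.cast_one, div_one, mul_one] at hx1 hx2
  set ex := Real.exp (-a * (C₃ * h)) with hexd
  have hx1' : |ex - 1| ≤ a * C₃ * E * h := by
    refine hx1.trans ?_
    calc _ ≤ a * C₃ * h * E := by gcongr
      _ = _ := by ring
  have hx2' : |ex - 1 + a * (C₃ * h)| ≤ (a * C₃) ^ 2 * E * h ^ 2 := by
    have e : ex - 1 + a * (C₃ * h) = ex - (1 + -a * (C₃ * h)) := by ring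
    rw [e]
    refine hx2.trans ?_
    calc _ ≤ (a * C₃ * h) ^ 2 * E := by gcongr
      _ = _ := by ring
  have mulb : ∀ x y X Y : ℝ, |x| ≤ X → |y| ≤ Y → |x * y| ≤ X * Y := by
    intro x y X Y hX hY
    rw [abs_mul]
    exact mul_le_mul hX hY (abs_nonneg _) ((abs_nonneg _).trans hX)
  have hexa : |ex| ≤ 1 := by rw [abs_of_pos hep]; exact he1
  have hta : |C₃ * h| ≤ C₃ * h := by rw [abs_of_pos hτ]
  have hla : |lam| ≤ lam := by rw [abs_of_nonneg hlam]
  have T1 := mulb _ _ _ _ hx2' (hb z)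
  have T2 := mulb _ _ _ _ hta (mulb _ _ _ _ hx1' (hbL z))
  have T3 := mulb _ _ _ _ hexa hq0b
  have T4 := mulb _ _ _ _ (mulb _ _ _ _ hla hta) (mulb _ _ _ _ hx1' hJb)
  have T5 := mulb _ _ _ _ (mulb _ _ _ _ hla hta) (mulb _ _ _ _ hexa hq1b)
  rw [← hLz] at T2
  have hreal : |ex * (q0 + lam * (C₃ * h) * q1) - (φ z + C₃ * h * (Lz - a * φ z + lam * Jf))| ≤
      ((a * C₃) ^ 2 * E * B
    + C₃ * (a * C₃ * E) * BL + Cq + lam * C₃ * (a * C₃ * E) * (B * M)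
    + lam * C₃ * (Cq * M2 + C₃ * BL * M)) * h ^ 2 := by
    have e : ex * (q0 + lam * (C₃ * h) * q1) - (φ z + C₃ * h * (Lz - a * φ z + lam * Jf)) =
      (ex - 1 + a * (C₃ * h)) * φ z + C₃ * h * ((ex - 1) * Lz) +
      ex * (q0 - (φ z + C₃ * h * Lz)) + lam * (C₃ * h) * ((ex - 1) * Jf)
      + lam * (C₃ * h) * (ex * (q1 - Jf)) := by ring
    rw [e]
    refine (abs_add_le _ _).trans ((add_le_add (abs_add_le _ _) le_rfl).trans ?_)
    refine (add_le_add (add_le_add (abs_add_le _ _) le_rfl) le_rfl).trans ?_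
    refine (add_le_add (add_le_add (add_le_add (abs_add_le _ _) le_rfl) le_rfl) le_rfl).trans ?_
    refine (add_le_add (add_le_add (add_le_add (add_le_add T1 T2) T3) T4) T5).trans (le_of_eq ?_)
    ring
  have hrem : Cb * ((lam * (C₃ * h) * M) ^ 2 * Real.exp (lam * (C₃ * h) * M)) ≤
      Cb * ((lam * C₃ * M) ^ 2 * Real.exp (lam * C₃ * M)) * h ^ 2 := by
    have k : Real.exp (lam * (C₃ * h) * M) ≤ Real.exp (lam * C₃ * M) := by
      apply Real.exp_le_exp.2
      have : 0 ≤ lam * C₃ * M := by positivity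
      nlinarith
    calc _ ≤ Cb * ((lam * (C₃ * h) * M) ^ 2 * Real.exp (lam * C₃ * M)) := by gcongr
      _ = _ := by ring
  rw [← Complex.ofReal_mul, ← Complex.ofReal_add, ← Complex.ofReal_mul] at hmain
  have hreal' : ‖((ex * (q0 + lam * (C₃ * h) * q1) : ℝ) : ℂ) -
      ((φ z + C₃ * h * (Lz - a * φ z + lam * Jf) : ℝ) : ℂ)‖ ≤
      ((a * C₃) ^ 2 * E * B + C₃ * (a * C₃ * E) * BL + Cq + lam * C₃ * (a * C₃ * E) * (B * M)
        + lam * C₃ * (Cq * M2 + C₃ * BL * M)) * h ^ 2 := by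
    rw [← Complex.ofReal_sub, Complex.norm_real]
    exact hreal
  refine (norm_sub_le_norm_sub_add_norm_sub _ _ _).trans
    ((add_le_add (hmain.trans hrem) hreal').trans (le_of_eq ?_))
  ring

/-- local consistency of the quadrature: for a bounded smooth test
function `φ` with bounded derivatives of all orders, the composite trapezoidal
quadrature of the Green's function against `φ` equals
`φ(x_n,y_j) + Δτ[(Lφ) + (Jφ)](x_n,y_j)` up to `O(h²)`. -/
theorem quadrature_local_consistency
    (r lam σx σy ρ κx κy μx μy σtx σty ρh C₁ C₂ C₃ C₁' C₂' : ℝ)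
    (hr : 0 < r) (hlam : 0 ≤ lam) (hσx : 0 < σx) (hσy : 0 < σy)
    (hρ₁ : -1 < ρ) (hρ₂ : ρ < 1)
    (hσtx : 0 < σtx) (hσty : 0 < σty) (hρh₁ : -1 < ρh) (hρh₂ : ρh < 1)
    (hC₁ : 0 < C₁) (hC₂ : 0 < C₂) (hC₃ : 0 < C₃) (hC₁' : 0 < C₁') (hC₂' : 0 < C₂')
    (φ : ℝ × ℝ → ℝ) (hφ_smooth : ∀ n : ℕ, ContDiff ℝ n φ)
    (hφ_bd : ∀ k : ℕ, ∃ B : ℝ, ∀ z : ℝ × ℝ, ‖iteratedFDeriv ℝ k φ z‖ ≤ B) :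
    ∃ C > (0 : ℝ), ∃ h₀ > (0 : ℝ), ∀ h : ℝ, 0 < h → h < h₀ →
      ∀ xhat0 yhat0 : ℝ, ∀ N J : ℕ, 2 ≤ N → 2 ≤ J →
        C₁' / h ≤ 2 * N * (C₁ * h) → C₂' / h ≤ 2 * J * (C₂ * h) →
        ∀ n j : ℤ, 2 * |n| ≤ (N : ℤ) - 2 → 2 * |j| ≤ (J : ℤ) - 2 →
          ‖(Complex.ofReal (C₁ * h * (C₂ * h)) *
                ∑ l ∈ Finset.Icc (-(N : ℤ)) (N : ℤ), ∑ d ∈ Finset.Icc (-(J : ℤ)) (J : ℤ),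
                  Complex.ofReal
                      (trapWeight N l * trapWeight J d *
                        φ (xhat0 + (l : ℝ) * (C₁ * h), yhat0 + (d : ℝ) * (C₂ * h))) *
                    greenFn2 r lam σx σy ρ κx κy (mertonDensity2 μx μy σtx σty ρh) (C₃ * h)
                      (((n - l : ℤ) : ℝ) * (C₁ * h), ((j - d : ℤ) : ℝ) * (C₂ * h))) -
              Complex.ofReal
                (φ (xhat0 + (n : ℝ) * (C₁ * h), yhat0 + (j : ℝ) * (C₂ * h)) +
                  C₃ * h *
                    (Lop r lam σx σy ρ κx κy φ
                        (xhat0 + (n : ℝ) * (C₁ * h), yhat0 + (j : ℝ) * (C₂ * h)) +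
                      Jop lam (mertonDensity2 μx μy σtx σty ρh) φ
                        (xhat0 + (n : ℝ) * (C₁ * h), yhat0 + (j : ℝ) * (C₂ * h))))‖ ≤
            C * h ^ 2 := by
  obtain ⟨C, hC, H⟩ := quadrature_local_consistency_aux r lam σx σy ρ κx κy μx μy σtx σty ρh
    C₁ C₂ C₃ C₁' C₂' hr hlam hσx hσy hρ₁ hρ₂ hσtx hσty hρh₁ hρh₂ hC₁ hC₂ hC₃ hC₁' hC₂' φ
    ⟨hφ_smooth, hφ_bd⟩
  refine ⟨C, hC, 1, one_pos, ?_⟩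
  intro h hh h1 X0 Y0 N J _ _ hN hJ n j hn hj
  refine le_trans (le_of_eq ?_) (H h hh h1.le X0 Y0 N J hN hJ n j hn hj)
  congr 2
  rw [Finset.mul_sum]
  refine Finset.sum_congr rfl fun l hl => ?_
  rw [Finset.mul_sum]
  refine Finset.sum_congr rfl fun d hd => ?_
  have e1 : tw N l = trapWeight N l := by unfold tw; rw [if_pos hl]
  have e2 : tw J d = trapWeight J d := by unfold tw; rw [if_pos hd]
  rw [e1, e2, ← mul_assoc, ← Complex.ofReal_mul]
  congr 2
  ext
  · simp; ring
  · simp; ring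
end
end

section
/- Let r > 0, λ ≥ 0, σx, σy > 0, ρ ∈ (−1,1), κx, κy ∈ ℝ, and let f be a probability density on ℝ². Then for every real-valued Schwartz function χ on ℝ² there exist constants C > 0 and Δτ₀ > 0 such that for all Δτ ∈ (0, Δτ₀) and all z ∈ ℝ²: | ∫_{ℝ²} g(z − z', Δτ) χ(z') dz' − χ(z) − Δτ [(Lχ)(z) + (Jχ)(z)] | ≤ C Δτ². That is, convolution with the Green's function over one timestep reproduces χ + Δτ(L + J)χ up to a uniform second-order error in Δτ. -/
open MeasureTheory
noncomputable section

open scoped SchwartzMap FourierTransform LineDeriv in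
/-- Schwartz lift of a real Schwartz function to the Euclidean plane. -/
def liftE (φ : SchwartzMap (ℝ × ℝ) ℝ) : SchwartzMap (WithLp 2 (ℝ × ℝ)) ℂ :=
  SchwartzMap.compCLMOfContinuousLinearEquiv ℝ (WithLp.prodContinuousLinearEquiv 2 ℝ ℝ ℝ)
    (SchwartzMap.postcompCLM Complex.ofRealCLM φ)

/-- scaling equivalence -/
def scaleE : (ℝ × ℝ) ≃L[ℝ] WithLp 2 (ℝ × ℝ) :=
  (ContinuousLinearEquiv.smulLeft (R₁ := ℝ) (Units.mk0 ((2 * Real.pi)⁻¹ : ℝ) (by positivity))).trans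
    (WithLp.prodContinuousLinearEquiv 2 ℝ ℝ ℝ).symm

open scoped FourierTransform in
/-- Fourier transform. -/
def FS (φ : SchwartzMap (ℝ × ℝ) ℝ) : SchwartzMap (ℝ × ℝ) ℂ :=
  SchwartzMap.compCLMOfContinuousLinearEquiv ℝ scaleE (𝓕 (liftE φ))

lemma liftE_apply (φ : SchwartzMap (ℝ × ℝ) ℝ) (x) : liftE φ x = (φ (x.fst, x.snd) : ℂ) := rfl

lemma scaleE_apply (η : ℝ × ℝ) : scaleE η = WithLp.toLp 2 ((2 * Real.pi)⁻¹ * η.1, (2 * Real.pi)⁻¹ * η.2) := rfl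

open scoped FourierTransform in
lemma FS_apply' (φ : SchwartzMap (ℝ × ℝ) ℝ) (η : ℝ × ℝ) : FS φ η = 𝓕 (liftE φ) (scaleE η) := rfl

lemma integral_withLp (h : WithLp 2 (ℝ × ℝ) → ℂ) :
    ∫ x, h x = ∫ z : ℝ × ℝ, h (WithLp.toLp 2 z) := by
  rw [← (WithLp.volume_preserving_symm_measurableEquiv_toLp_prod ℝ ℝ).integral_comp'
    (g := fun z => h (WithLp.toLp 2 z))]
  rfl

lemma FS_apply (φ : SchwartzMap (ℝ × ℝ) ℝ) (η : ℝ × ℝ) :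
    FS φ η = ∫ z : ℝ × ℝ, Complex.exp (-(Complex.I * Complex.ofReal (η.1 * z.1 + η.2 * z.2))) * φ z := by
  rw [FS_apply', SchwartzMap.fourier_coe, Real.fourier_eq', integral_withLp]
  congr 1
  ext z
  rw [smul_eq_mul, liftE_apply, scaleE_apply, WithLp.prod_inner_apply]
  congr 2
  simp
  field_simp

open scoped FourierTransform in
lemma FS_inv (φ : SchwartzMap (ℝ × ℝ) ℝ) (z : ℝ × ℝ) :
    (φ z : ℂ) = Complex.ofReal (1 / (2 * Real.pi) ^ 2) *
      ∫ η : ℝ × ℝ, Complex.exp (Complex.I * Complex.ofReal (η.1 * z.1 + η.2 * z.2)) * FS φ η := by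
  have h : 𝓕⁻ (𝓕 (liftE φ)) (WithLp.toLp 2 z) = liftE φ (WithLp.toLp 2 z) := by
    rw [FourierTransform.fourierInv_fourier_eq]
  rw [liftE_apply] at h
  change _ = ((φ z : ℝ) : ℂ) at h
  rw [← h, SchwartzMap.fourierInv_coe, Real.fourierInv_eq', integral_withLp]
  have := Measure.integral_comp_smul (volume : Measure (ℝ × ℝ)) (fun w : ℝ × ℝ => Complex.exp (Complex.I * Complex.ofReal (2 * Real.pi * (w.1 * z.1 + w.2 * z.2))) * 𝓕 (liftE φ) (WithLp.toLp 2 w)) (2 * Real.pi)⁻¹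
  simp only [Module.finrank_prod, Module.finrank_self] at this
  have e1 : ∀ η : ℝ × ℝ, 2 * Real.pi * ((((2 * Real.pi)⁻¹ • η).1 * z.1 + ((2 * Real.pi)⁻¹ • η).2 * z.2)) = η.1 * z.1 + η.2 * z.2 := by
    intro η
    simp; field_simp
  simp_rw [e1] at this
  have e2 : ∀ η, FS φ η = 𝓕 (liftE φ) (WithLp.toLp 2 ((2 * Real.pi)⁻¹ • η)) := fun η => rfl
  simp_rw [e2]
  rw [this, Complex.real_smul, ← mul_assoc, ← Complex.ofReal_mul]
  have : 1 / (2 * Real.pi) ^ 2 * |(((2 * Real.pi)⁻¹) ^ (1+1))⁻¹| = 1 := by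
    rw [abs_of_nonneg (by positivity)]
    norm_num
    field_simp
  rw [this, Complex.ofReal_one, one_mul]
  congr 1
  ext w
  rw [smul_eq_mul, WithLp.prod_inner_apply]
  congr 2
  simp
  ring

open scoped LineDeriv

lemma liftE_lineDeriv (φ : SchwartzMap (ℝ × ℝ) ℝ) (m : ℝ × ℝ) :
    liftE (∂_{m} φ) = ∂_{WithLp.toLp 2 m} (liftE φ) := by
  unfold liftE
  rw [SchwartzMap.lineDerivOp_compCLMOfContinuousLinearEquiv]
  congr 1
  ext x
  rw [SchwartzMap.postcompCLM_apply, SchwartzMap.lineDerivOp_apply_eq_fderiv, SchwartzMap.lineDerivOp_apply_eq_fderiv]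
  have : (⇑(SchwartzMap.postcompCLM Complex.ofRealCLM φ) : ℝ × ℝ → ℂ) = Complex.ofRealCLM ∘ φ := by
    ext x; rfl
  rw [this, (Complex.ofRealCLM.hasFDerivAt.comp x φ.differentiableAt.hasFDerivAt).fderiv]
  rfl

lemma FS_lineDeriv (φ : SchwartzMap (ℝ × ℝ) ℝ) (m : ℝ × ℝ) (η : ℝ × ℝ) :
    FS (∂_{m} φ) η = Complex.I * Complex.ofReal (η.1 * m.1 + η.2 * m.2) * FS φ η := by
  rw [FS_apply', FS_apply', liftE_lineDeriv, SchwartzMap.fourier_lineDerivOp_eq]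
  have : (fun x => inner ℝ x (WithLp.toLp 2 m) : WithLp 2 (ℝ × ℝ) → ℝ).HasTemperateGrowth :=
    ((innerSL ℝ).flip (WithLp.toLp 2 m)).hasTemperateGrowth
  rw [smul_apply, SchwartzMap.smulLeftCLM_apply_apply this, scaleE_apply, WithLp.prod_inner_apply]
  simp
  field_simp

lemma norm_expI (x : ℝ) : ‖Complex.exp (Complex.I * Complex.ofReal x)‖ = 1 := by
  rw [mul_comm, Complex.norm_exp_ofReal_mul_I]

lemma norm_expI_neg (x : ℝ) : ‖Complex.exp (-(Complex.I * Complex.ofReal x))‖ = 1 := by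
  have := norm_expI (-x)
  simpa using this

lemma f_int (f : ℝ × ℝ → ℝ) (hf_prob : ∫ s : ℝ × ℝ, f s = 1) : Integrable f := by
  by_contra h
  rw [integral_undef h] at hf_prob
  norm_num at hf_prob

lemma jump_norm (f : ℝ × ℝ → ℝ) (hf_nonneg : ∀ s, 0 ≤ f s)
    (hf_prob : ∫ s : ℝ × ℝ, f s = 1) (η : ℝ × ℝ) : ‖jumpSymbol2 f η‖ ≤ 1 := by
  unfold jumpSymbol2
  refine (norm_integral_le_integral_norm _).trans ?_
  rw [← hf_prob]
  apply le_of_eq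
  congr 1
  ext s
  rw [norm_mul, norm_expI, mul_one, Complex.norm_real, Real.norm_of_nonneg (hf_nonneg s)]

lemma jump_cont (f : ℝ × ℝ → ℝ) (hf_meas : Measurable f)
    (hf_prob : ∫ s : ℝ × ℝ, f s = 1) : Continuous (jumpSymbol2 f) := by
  unfold jumpSymbol2
  apply continuous_of_dominated (bound := fun s => ‖f s‖)
  · intro η
    apply Measurable.aestronglyMeasurable
    fun_prop
  · intro η
    refine Filter.Eventually.of_forall fun s => ?_
    rw [norm_mul, norm_expI, mul_one, Complex.norm_real]
  · exact (f_int f hf_prob).norm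
  · refine Filter.Eventually.of_forall fun s => ?_
    fun_prop

lemma psi_cont (f : ℝ × ℝ → ℝ) (hf_meas : Measurable f)
    (hf_prob : ∫ s : ℝ × ℝ, f s = 1) (r lam σx σy ρ κx κy : ℝ) :
    Continuous (symbolPsi2 r lam σx σy ρ κx κy f) := by
  have := jump_cont f hf_meas hf_prob
  unfold symbolPsi2
  fun_prop

lemma psi_re (f : ℝ × ℝ → ℝ) (hf_nonneg : ∀ s, 0 ≤ f s)
    (hf_prob : ∫ s : ℝ × ℝ, f s = 1) (r lam σx σy ρ κx κy : ℝ) (hr : 0 < r) (hlam : 0 ≤ lam)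
    (η : ℝ × ℝ) :
    (symbolPsi2 r lam σx σy ρ κx κy f η).re ≤
      -((1 - |ρ|) / 2 * σx ^ 2) * η.1 ^ 2 + -((1 - |ρ|) / 2 * σy ^ 2) * η.2 ^ 2 := by
  have h1 : (jumpSymbol2 f η).re ≤ 1 :=
    (Complex.re_le_norm _).trans (jump_norm f hf_nonneg hf_prob η)
  have h2 : (symbolPsi2 r lam σx σy ρ κx κy f η).re =
      (-(1 / 2) * (σx ^ 2 * η.1 ^ 2 + 2 * ρ * σx * σy * η.1 * η.2 + σy ^ 2 * η.2 ^ 2))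
      - (r + lam) + lam * (jumpSymbol2 f η).re := by
    unfold symbolPsi2
    simp only [Complex.add_re, Complex.sub_re, Complex.ofReal_re, Complex.re_ofReal_mul,
      Complex.I_mul_re, Complex.ofReal_im]
    ring
  rw [h2]
  have h3 := mul_le_mul_of_nonneg_left h1 hlam
  have h4 : -ρ * (2 * (σx * η.1) * (σy * η.2)) ≤ |ρ| * ((σx * η.1)^2 + (σy * η.2)^2) := by
    rcases abs_cases ρ with ⟨h, h'⟩ | ⟨h, h'⟩ <;> rw [h]
    · nlinarith [mul_nonneg h' (sq_nonneg (σx * η.1 + σy * η.2))]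
    · nlinarith [mul_nonneg (neg_nonneg.2 h'.le) (sq_nonneg (σx * η.1 - σy * η.2))]
  nlinarith

lemma psi_norm (f : ℝ × ℝ → ℝ) (hf_nonneg : ∀ s, 0 ≤ f s)
    (hf_prob : ∫ s : ℝ × ℝ, f s = 1) (r lam σx σy ρ κx κy : ℝ) : ∃ K : ℝ, 0 ≤ K ∧ ∀ η : ℝ × ℝ,
    ‖symbolPsi2 r lam σx σy ρ κx κy f η‖ ≤ K * (1 + ‖η‖ ^ 2) := by
  obtain ⟨b1, hb1⟩ : ∃ b, b = r - lam * κx - σx ^ 2 / 2 := ⟨_, rfl⟩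
  obtain ⟨b2, hb2⟩ : ∃ b, b = r - lam * κy - σy ^ 2 / 2 := ⟨_, rfl⟩
  refine ⟨σx ^ 2 + 2 * |ρ * σx * σy| + σy ^ 2 + |b1| + |b2| + |r + lam| + |lam|,
    by positivity, fun η => ?_⟩
  have h1 : |η.1| ≤ ‖η‖ := norm_fst_le η
  have h2 : |η.2| ≤ ‖η‖ := norm_snd_le η
  set t := ‖η‖
  have ht : 0 ≤ t := norm_nonneg η
  have a1 : |-(1 / 2) * (σx ^ 2 * η.1 ^ 2 + 2 * ρ * σx * σy * η.1 * η.2 + σy ^ 2 * η.2 ^ 2)| ≤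
      (σx ^ 2 + 2 * |ρ * σx * σy| + σy ^ 2) * t ^ 2 := by
    rw [abs_mul]
    have e : |σx ^ 2 * η.1 ^ 2 + 2 * ρ * σx * σy * η.1 * η.2 + σy ^ 2 * η.2 ^ 2| ≤
        σx ^ 2 * |η.1| ^ 2 + 2 * |ρ * σx * σy| * (|η.1| * |η.2|) + σy ^ 2 * |η.2| ^ 2 := by
      refine (abs_add_three _ _ _).trans (le_of_eq ?_)
      simp only [abs_mul, abs_pow, sq_abs, abs_two]
      ring
    have e1 : |η.1| ^ 2 ≤ t ^ 2 := by gcongr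
    have e2 : |η.2| ^ 2 ≤ t ^ 2 := by gcongr
    have e3 : |η.1| * |η.2| ≤ t ^ 2 := by rw [sq]; gcongr
    have : σx ^ 2 * |η.1| ^ 2 + 2 * |ρ * σx * σy| * (|η.1| * |η.2|) + σy ^ 2 * |η.2| ^ 2 ≤
        σx ^ 2 * t ^ 2 + 2 * |ρ * σx * σy| * t ^ 2 + σy ^ 2 * t ^ 2 := by gcongr
    have hh : |(-(1/2) : ℝ)| ≤ 1 := by norm_num [abs_of_nonneg]
    calc _ ≤ 1 * |σx ^ 2 * η.1 ^ 2 + 2 * ρ * σx * σy * η.1 * η.2 + σy ^ 2 * η.2 ^ 2| := by gcongr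
      _ ≤ _ := by linarith
  have a2 : |b1 * η.1 + b2 * η.2| ≤ (|b1| + |b2|) * (1 + t ^ 2) := by
    have e : t ≤ 1 + t ^ 2 := by nlinarith [sq_nonneg (t - 1)]
    refine (abs_add_le _ _).trans ?_
    rw [abs_mul, abs_mul, add_mul]
    have := h1.trans e
    have := h2.trans e
    gcongr
  have a3 := jump_norm f hf_nonneg hf_prob η
  have : ‖symbolPsi2 r lam σx σy ρ κx κy f η‖ ≤
      |-(1 / 2) * (σx ^ 2 * η.1 ^ 2 + 2 * ρ * σx * σy * η.1 * η.2 + σy ^ 2 * η.2 ^ 2)| +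
      |b1 * η.1 + b2 * η.2| + |r + lam| + |lam| * ‖jumpSymbol2 f η‖ := by
    unfold symbolPsi2
    rw [← hb1, ← hb2]
    refine (norm_add_le _ _).trans ?_
    rw [norm_mul (lam : ℂ), Complex.norm_real lam, Real.norm_eq_abs lam]
    gcongr
    refine (norm_sub_le _ _).trans ?_
    rw [Complex.norm_real (r + lam), Real.norm_eq_abs (r + lam)]
    gcongr
    refine (norm_add_le _ _).trans ?_
    rw [norm_mul, Complex.norm_real, Complex.norm_real, Complex.norm_I, one_mul,
      Real.norm_eq_abs, Real.norm_eq_abs]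
  have a4 : |lam| * ‖jumpSymbol2 f η‖ ≤ |lam| * 1 := by gcongr
  have p1 : 0 ≤ (σx ^ 2 + 2 * |ρ * σx * σy| + σy ^ 2) := by positivity
  have p2 : 0 ≤ |r + lam| * t ^ 2 := by positivity
  have p3 : 0 ≤ |lam| * t ^ 2 := by positivity
  nlinarith

/-- Fourier representation of the jump operator. -/
lemma J_repr (f : ℝ × ℝ → ℝ) (hf_meas : Measurable f)
    (hf_prob : ∫ s : ℝ × ℝ, f s = 1) (lam : ℝ) (χ : SchwartzMap (ℝ × ℝ) ℝ) (z : ℝ × ℝ) :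
    (Jop lam f χ z : ℂ) = Complex.ofReal (1 / (2 * Real.pi) ^ 2) *
      ∫ η : ℝ × ℝ, Complex.exp (Complex.I * Complex.ofReal (η.1 * z.1 + η.2 * z.2)) *
        (lam * jumpSymbol2 f η * FS χ η) := by
  unfold Jop
  rw [Complex.ofReal_mul, ← integral_complex_ofReal]
  have h1 : ∀ s : ℝ × ℝ, ((χ (z.1 + s.1, z.2 + s.2) * f s : ℝ) : ℂ) =
      Complex.ofReal (1 / (2 * Real.pi) ^ 2) * ∫ η : ℝ × ℝ,
        Complex.exp (Complex.I * Complex.ofReal (η.1 * (z.1 + s.1) + η.2 * (z.2 + s.2)))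
          * FS χ η * f s := by
    intro s
    rw [Complex.ofReal_mul, FS_inv, integral_mul_const, mul_assoc]
  simp_rw [h1]
  rw [integral_const_mul, integral_integral_swap]
  · rw [mul_left_comm, ← integral_const_mul]
    congr 2
    ext η
    unfold jumpSymbol2
    rw [mul_assoc (lam : ℂ), ← integral_mul_const, mul_left_comm,
      ← integral_const_mul (Complex.exp _)]
    congr 2
    ext s
    have : Complex.exp (Complex.I * Complex.ofReal (η.1 * (z.1 + s.1) + η.2 * (z.2 + s.2))) =
      Complex.exp (Complex.I * Complex.ofReal (η.1 * z.1 + η.2 * z.2)) *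
      Complex.exp (Complex.I * Complex.ofReal (η.1 * s.1 + η.2 * s.2)) := by
      rw [← Complex.exp_add]; congr 1; push_cast; ring
    rw [this]
    ring
  · have hi : Integrable (fun p : (ℝ × ℝ) × (ℝ × ℝ) => (f p.1 : ℂ) * FS χ p.2)
        (volume.prod volume) :=
      Integrable.mul_prod (f_int f hf_prob).ofReal ((FS χ).integrable)
    refine hi.mono ?_ ?_
    · have := (FS χ).continuous
      apply Measurable.aestronglyMeasurable
      have := this.measurable
      unfold Function.uncurry
      fun_prop
    · refine Filter.Eventually.of_forall fun p => ?_
      simp only [Function.uncurry, norm_mul, norm_expI]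
      apply le_of_eq; ring

lemma exp_taylor (w : ℂ) (hw : w.re ≤ 0) : ‖Complex.exp w - 1 - w‖ ≤ 3 * ‖w‖ ^ 2 := by
  rcases le_total ‖w‖ 1 with h | h
  · have := Complex.norm_exp_sub_one_sub_id_le h
    nlinarith [sq_nonneg ‖w‖]
  · have h1 : ‖Complex.exp w‖ ≤ 1 := by
      rw [Complex.norm_exp]; exact Real.exp_le_one_iff.2 hw
    have h2 := norm_sub_le (Complex.exp w - 1) w
    have h3 := norm_sub_le (Complex.exp w) 1
    rw [norm_one] at h3
    nlinarith

/-- If `h` is dominated by a quartic times the transform, it is integrable. -/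
lemma int_dom (F : SchwartzMap (ℝ × ℝ) ℂ) (h : ℝ × ℝ → ℂ) (hc : Continuous h) (K : ℝ)
    (hK : ∀ η, ‖h η‖ ≤ K * (1 + ‖η‖ ^ 2) ^ 2) : Integrable (fun η => h η * F η) := by
  have hi : Integrable (fun η : ℝ × ℝ => K * (‖F η‖ + 2 * (‖η‖ ^ 2 * ‖F η‖) + ‖η‖ ^ 4 * ‖F η‖)) :=
    ((F.integrable.norm.add ((F.integrable_pow_mul volume 2).const_mul 2)).add
      (F.integrable_pow_mul volume 4)).const_mul K
  refine hi.mono' (hc.mul F.continuous).aestronglyMeasurable ?_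
  refine Filter.Eventually.of_forall fun η => ?_
  rw [norm_mul]
  calc _ ≤ K * (1 + ‖η‖ ^ 2) ^ 2 * ‖F η‖ := by gcongr; exact hK η
    _ = _ := by ring

lemma int_dom_e (F : SchwartzMap (ℝ × ℝ) ℂ) (h : ℝ × ℝ → ℂ) (hc : Continuous h) (K : ℝ)
    (hK : ∀ η, ‖h η‖ ≤ K * (1 + ‖η‖ ^ 2) ^ 2) (z : ℝ × ℝ) :
    Integrable (fun η : ℝ × ℝ =>
      Complex.exp (Complex.I * Complex.ofReal (η.1 * z.1 + η.2 * z.2)) * (h η * F η)) := by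
  have := int_dom F (fun η : ℝ × ℝ =>
      Complex.exp (Complex.I * Complex.ofReal (η.1 * z.1 + η.2 * z.2)) * h η) (by fun_prop) K
      (fun η => by rw [norm_mul, norm_expI, one_mul]; exact hK η)
  simpa only [mul_assoc] using this

/-- Fourier representation of the full generator. -/
lemma LJ_repr (f : ℝ × ℝ → ℝ) (hf_meas : Measurable f) (hf_nonneg : ∀ s, 0 ≤ f s)
    (hf_prob : ∫ s : ℝ × ℝ, f s = 1) (r lam σx σy ρ κx κy : ℝ)
    (χ : SchwartzMap (ℝ × ℝ) ℝ) (z : ℝ × ℝ) :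
    ((Lop r lam σx σy ρ κx κy χ z + Jop lam f χ z : ℝ) : ℂ) =
    Complex.ofReal (1 / (2 * Real.pi) ^ 2) *
      ∫ η : ℝ × ℝ, Complex.exp (Complex.I * Complex.ofReal (η.1 * z.1 + η.2 * z.2)) *
        (symbolPsi2 r lam σx σy ρ κx κy f η * FS χ η) := by
  have d : ∀ (φ : SchwartzMap (ℝ × ℝ) ℝ) (m w : ℝ × ℝ), fderiv ℝ φ w m = (∂_{m} φ) w := by
    intro φ m w
    rw [SchwartzMap.lineDerivOp_apply_eq_fderiv]
  have hI : ∀ φ : SchwartzMap (ℝ × ℝ) ℝ, Integrable (fun η : ℝ × ℝ =>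
      Complex.exp (Complex.I * Complex.ofReal (η.1 * z.1 + η.2 * z.2)) * FS φ η) := by
    intro φ
    have := int_dom_e (FS φ) (fun _ => 1) continuous_const 1 (fun η => by
      rw [norm_one, one_mul]; nlinarith [sq_nonneg ‖η‖]) z
    simpa using this
  have hJ : Integrable (fun η : ℝ × ℝ =>
      Complex.exp (Complex.I * Complex.ofReal (η.1 * z.1 + η.2 * z.2)) *
        (lam * jumpSymbol2 f η * FS χ η)) := by
    have hc := jump_cont f hf_meas hf_prob
    refine int_dom_e (FS χ) (fun η => lam * jumpSymbol2 f η) (by fun_prop) |lam| (fun η => ?_) z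
    rw [norm_mul, Complex.norm_real, Real.norm_eq_abs]
    gcongr
    exact (jump_norm f hf_nonneg hf_prob η).trans (by nlinarith [sq_nonneg ‖η‖])
  have hL : ((Lop r lam σx σy ρ κx κy χ z : ℝ) : ℂ) =
      (σx:ℂ) ^ 2 / 2 * ((∂_{((1:ℝ), (0:ℝ))} (∂_{((1:ℝ), (0:ℝ))} χ)) z : ℝ)
      + ((r:ℂ) - lam * κx - (σx:ℂ) ^ 2 / 2) * ((∂_{((1:ℝ), (0:ℝ))} χ) z : ℝ)
      + (σy:ℂ) ^ 2 / 2 * ((∂_{((0:ℝ), (1:ℝ))} (∂_{((0:ℝ), (1:ℝ))} χ)) z : ℝ)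
      + ((r:ℂ) - lam * κy - (σy:ℂ) ^ 2 / 2) * ((∂_{((0:ℝ), (1:ℝ))} χ) z : ℝ)
      + (ρ:ℂ) * σx * σy * ((∂_{((1:ℝ), (0:ℝ))} (∂_{((0:ℝ), (1:ℝ))} χ)) z : ℝ)
      - ((r:ℂ) + lam) * (χ z : ℝ) := by
    unfold Lop
    simp only [d]
    push_cast
    rfl
  rw [Complex.ofReal_add, J_repr f hf_meas hf_prob, hL]
  rw [FS_inv χ z, FS_inv (∂_{((1:ℝ), (0:ℝ))} χ) z, FS_inv (∂_{((0:ℝ), (1:ℝ))} χ) z,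
    FS_inv (∂_{((1:ℝ), (0:ℝ))} (∂_{((1:ℝ), (0:ℝ))} χ)) z,
    FS_inv (∂_{((0:ℝ), (1:ℝ))} (∂_{((0:ℝ), (1:ℝ))} χ)) z,
    FS_inv (∂_{((1:ℝ), (0:ℝ))} (∂_{((0:ℝ), (1:ℝ))} χ)) z]
  set c := Complex.ofReal (1 / (2 * Real.pi) ^ 2)
  have i1 := (hI (∂_{((1:ℝ), (0:ℝ))} (∂_{((1:ℝ), (0:ℝ))} χ))).const_mul ((σx:ℂ) ^ 2 / 2)
  have i2 := (hI (∂_{((1:ℝ), (0:ℝ))} χ)).const_mul ((r:ℂ) - lam * κx - (σx:ℂ) ^ 2 / 2)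
  have i3 := (hI (∂_{((0:ℝ), (1:ℝ))} (∂_{((0:ℝ), (1:ℝ))} χ))).const_mul ((σy:ℂ) ^ 2 / 2)
  have i4 := (hI (∂_{((0:ℝ), (1:ℝ))} χ)).const_mul ((r:ℂ) - lam * κy - (σy:ℂ) ^ 2 / 2)
  have i5 := (hI (∂_{((1:ℝ), (0:ℝ))} (∂_{((0:ℝ), (1:ℝ))} χ))).const_mul ((ρ:ℂ) * σx * σy)
  have i6 := (hI χ).const_mul ((r:ℂ) + lam)
  have key := integral_add (((((i1.add i2).add i3).add i4).add i5).sub i6) hJ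
  have k2 := integral_sub ((((i1.add i2).add i3).add i4).add i5) i6
  have k3 := integral_add (((i1.add i2).add i3).add i4) i5
  have k4 := integral_add ((i1.add i2).add i3) i4
  have k5 := integral_add (i1.add i2) i3
  have k6 := integral_add i1 i2
  simp only [Pi.add_apply, Pi.sub_apply] at key k2 k3 k4 k5 k6
  rw [k2, k3, k4, k5, k6] at key
  simp only [integral_const_mul] at key
  have e : (∫ η : ℝ × ℝ, Complex.exp (Complex.I * Complex.ofReal (η.1 * z.1 + η.2 * z.2)) *
        (symbolPsi2 r lam σx σy ρ κx κy f η * FS χ η)) = _ :=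
    (integral_congr_ae (Filter.Eventually.of_forall fun η => by
      simp only [FS_lineDeriv]
      unfold symbolPsi2
      generalize Complex.exp (Complex.I * Complex.ofReal (η.1 * z.1 + η.2 * z.2)) = E
      push_cast
      linear_combination (-(E * FS χ η * ((σx:ℂ) ^ 2 * (η.1:ℂ) ^ 2 / 2 +
        (σy:ℂ) ^ 2 * (η.2:ℂ) ^ 2 / 2 + ρ * σx * σy * η.1 * η.2))) * Complex.I_sq)).trans key
  rw [e]
  ring

lemma gauss_int (a b : ℝ) (ha : 0 < a) (hb : 0 < b) :
    Integrable (fun η : ℝ × ℝ => Real.exp (-a * η.1 ^ 2) * Real.exp (-b * η.2 ^ 2)) :=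
  Integrable.mul_prod (integrable_exp_neg_mul_sq ha) (integrable_exp_neg_mul_sq hb)

/-- Fourier representation of the Green's function convolution. -/
lemma conv_repr (f : ℝ × ℝ → ℝ) (hf_meas : Measurable f) (hf_nonneg : ∀ s, 0 ≤ f s)
    (hf_prob : ∫ s : ℝ × ℝ, f s = 1) (r lam σx σy ρ κx κy : ℝ)
    (hr : 0 < r) (hlam : 0 ≤ lam) (hσx : 0 < σx) (hσy : 0 < σy)
    (hρ₁ : -1 < ρ) (hρ₂ : ρ < 1) (τ : ℝ) (hτ : 0 < τ)
    (χ : SchwartzMap (ℝ × ℝ) ℝ) (z : ℝ × ℝ) :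
    (∫ z' : ℝ × ℝ, greenFn2 r lam σx σy ρ κx κy f τ (z - z') * Complex.ofReal (χ z')) =
    Complex.ofReal (1 / (2 * Real.pi) ^ 2) *
      ∫ η : ℝ × ℝ, Complex.exp (Complex.I * Complex.ofReal (η.1 * z.1 + η.2 * z.2)) *
        (Complex.exp (symbolPsi2 r lam σx σy ρ κx κy f η * τ) * FS χ η) := by
  have hpc := psi_cont f hf_meas hf_prob r lam σx σy ρ κx κy
  unfold greenFn2
  simp_rw [mul_assoc (Complex.ofReal (1 / (2 * Real.pi) ^ 2)), ← integral_mul_const]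
  rw [integral_const_mul, integral_integral_swap]
  · congr 2
    ext η
    rw [FS_apply, ← integral_const_mul, ← integral_const_mul]
    congr 1
    ext z'
    rw [← mul_assoc, ← mul_assoc, ← Complex.exp_add, ← Complex.exp_add]
    congr 2
    simp only [Prod.fst_sub, Prod.snd_sub]
    push_cast
    ring
  · have hρ : 0 < 1 - |ρ| := by
      have := abs_lt.2 ⟨hρ₁, hρ₂⟩
      linarith
    have hg := gauss_int ((1 - |ρ|) / 2 * σx ^ 2 * τ) ((1 - |ρ|) / 2 * σy ^ 2 * τ)
      (by positivity) (by positivity)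
    have hi : Integrable (fun p : (ℝ × ℝ) × (ℝ × ℝ) => ‖χ p.1‖ *
        (Real.exp (-((1 - |ρ|) / 2 * σx ^ 2 * τ) * p.2.1 ^ 2) *
          Real.exp (-((1 - |ρ|) / 2 * σy ^ 2 * τ) * p.2.2 ^ 2))) (volume.prod volume) :=
      Integrable.mul_prod χ.integrable.norm hg
    refine hi.mono' ?_ ?_
    · have := χ.continuous
      apply Continuous.aestronglyMeasurable
      unfold Function.uncurry
      fun_prop
    · refine Filter.Eventually.of_forall fun p => ?_
      simp only [Function.uncurry]
      rw [norm_mul, Complex.exp_add, norm_mul, norm_expI, one_mul, Complex.norm_real, mul_comm,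
        Complex.norm_exp, ← Real.exp_add]
      gcongr
      rw [Complex.re_mul_ofReal]
      have := mul_le_mul_of_nonneg_right
        (psi_re f hf_nonneg hf_prob r lam σx σy ρ κx κy hr hlam p.2) hτ.le
      linarith

/-- for every real-valued Schwartz function `χ`, convolution with
the Green's function over one timestep reproduces `χ + Δτ(L + J)χ` up to a uniform
`O(Δτ²)` error. -/
theorem green_convolution_short_time_expansion
    (r lam σx σy ρ κx κy : ℝ)
    (hr : 0 < r) (hlam : 0 ≤ lam) (hσx : 0 < σx) (hσy : 0 < σy)
    (hρ₁ : -1 < ρ) (hρ₂ : ρ < 1)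
    (f : ℝ × ℝ → ℝ) (hf_meas : Measurable f) (hf_nonneg : ∀ s, 0 ≤ f s)
    (hf_prob : ∫ s : ℝ × ℝ, f s = 1)
    (χ : SchwartzMap (ℝ × ℝ) ℝ) :
    ∃ C > (0 : ℝ), ∃ Δτ₀ > (0 : ℝ), ∀ Δτ : ℝ, 0 < Δτ → Δτ < Δτ₀ → ∀ z : ℝ × ℝ,
      ‖(∫ z' : ℝ × ℝ, greenFn2 r lam σx σy ρ κx κy f Δτ (z - z') * Complex.ofReal (χ z')) -
          Complex.ofReal (χ z + Δτ * (Lop r lam σx σy ρ κx κy (⇑χ) z + Jop lam f (⇑χ) z))‖ ≤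
        C * Δτ ^ 2 := by
  obtain ⟨K, hK0, hK⟩ := psi_norm f hf_nonneg hf_prob r lam σx σy ρ κx κy
  have hpc := psi_cont f hf_meas hf_prob r lam σx σy ρ κx κy
  have hre : ∀ η, (symbolPsi2 r lam σx σy ρ κx κy f η).re ≤ 0 := by
    intro η
    refine (psi_re f hf_nonneg hf_prob r lam σx σy ρ κx κy hr hlam η).trans ?_
    have hρ : 0 < 1 - |ρ| := by
      have := abs_lt.2 ⟨hρ₁, hρ₂⟩
      linarith
    have h1 : 0 ≤ (1 - |ρ|) / 2 * σx ^ 2 * η.1 ^ 2 := by positivity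
    have h2 : 0 ≤ (1 - |ρ|) / 2 * σy ^ 2 * η.2 ^ 2 := by positivity
    linarith
  have hB : Integrable (fun η : ℝ × ℝ => 3 * K ^ 2 * ((1 + ‖η‖ ^ 2) ^ 2 * ‖FS χ η‖)) := by
    have := (int_dom (FS χ) (fun η : ℝ × ℝ => (((1 + ‖η‖ ^ 2) ^ 2 : ℝ) : ℂ)) (by fun_prop) 1
      (fun η => by
        rw [Complex.norm_real, Real.norm_of_nonneg (by positivity), one_mul])).norm
    refine Integrable.const_mul (this.congr (Filter.Eventually.of_forall fun η => ?_)) _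
    simp only
    rw [norm_mul, Complex.norm_real, Real.norm_of_nonneg (by positivity)]
  set B := ∫ η : ℝ × ℝ, 3 * K ^ 2 * ((1 + ‖η‖ ^ 2) ^ 2 * ‖FS χ η‖) with hBdef
  have hB0 : 0 ≤ B := integral_nonneg fun η => by positivity
  refine ⟨1 / (2 * Real.pi) ^ 2 * B + 1, by positivity, 1, one_pos, fun τ hτ _ z => ?_⟩
  rw [conv_repr f hf_meas hf_nonneg hf_prob r lam σx σy ρ κx κy hr hlam hσx hσy hρ₁ hρ₂ τ hτ χ z,
    Complex.ofReal_add, Complex.ofReal_mul, LJ_repr f hf_meas hf_nonneg hf_prob, FS_inv χ z]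
  have hone : ∀ η : ℝ × ℝ, 1 ≤ (1 + ‖η‖ ^ 2) ^ 2 := fun η => by nlinarith [sq_nonneg ‖η‖]
  have i1 := int_dom_e (FS χ) (fun η => Complex.exp (symbolPsi2 r lam σx σy ρ κx κy f η * τ))
    (by fun_prop) 1 (fun η => by
      rw [Complex.norm_exp, one_mul, Complex.re_mul_ofReal]
      exact (Real.exp_le_one_iff.2 (mul_nonpos_of_nonpos_of_nonneg (hre η) hτ.le)).trans (hone η)) z
  have i2 := int_dom_e (FS χ) (fun _ => 1) continuous_const 1 (fun η => by
      rw [norm_one, one_mul]; exact hone η) z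
  simp only [one_mul] at i2
  have i3 := int_dom_e (FS χ) (symbolPsi2 r lam σx σy ρ κx κy f) hpc K (fun η => by
      refine (hK η).trans ?_
      gcongr
      nlinarith [sq_nonneg ‖η‖]) z
  have k : ∀ c A D E : ℂ, c * A - (c * D + τ * (c * E)) = c * (A - D - τ * E) := by
    intros; ring
  rw [k, ← integral_const_mul (τ : ℂ), ← integral_sub i1 i2]
  have k1 := integral_sub (i1.sub i2) (i3.const_mul (τ : ℂ))
  simp only [Pi.sub_apply] at k1
  rw [← k1, norm_mul, Complex.norm_real, Real.norm_of_nonneg (by positivity)]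
  have hmain : ‖∫ η : ℝ × ℝ, (Complex.exp (Complex.I * Complex.ofReal (η.1 * z.1 + η.2 * z.2)) *
        (Complex.exp (symbolPsi2 r lam σx σy ρ κx κy f η * τ) * FS χ η) -
        Complex.exp (Complex.I * Complex.ofReal (η.1 * z.1 + η.2 * z.2)) * FS χ η -
        τ * (Complex.exp (Complex.I * Complex.ofReal (η.1 * z.1 + η.2 * z.2)) *
          (symbolPsi2 r lam σx σy ρ κx κy f η * FS χ η)))‖ ≤ B * τ ^ 2 := by
    rw [hBdef, ← integral_mul_const]
    refine norm_integral_le_of_norm_le (hB.mul_const _) (Filter.Eventually.of_forall fun η => ?_)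
    have e : ∀ E P F X : ℂ, E * (X * F) - E * F - τ * (E * (P * F)) = E * ((X - 1 - P * τ) * F) := by
      intros; ring
    rw [e, norm_mul, norm_expI, one_mul, norm_mul]
    have h1 := exp_taylor (symbolPsi2 r lam σx σy ρ κx κy f η * τ) (by
      rw [Complex.re_mul_ofReal]
      exact mul_nonpos_of_nonpos_of_nonneg (hre η) hτ.le)
    have h2 : ‖symbolPsi2 r lam σx σy ρ κx κy f η * τ‖ ≤ K * (1 + ‖η‖ ^ 2) * τ := by
      rw [norm_mul, Complex.norm_real, Real.norm_of_nonneg hτ.le]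
      gcongr
      exact hK η
    calc _ ≤ 3 * (K * (1 + ‖η‖ ^ 2) * τ) ^ 2 * ‖FS χ η‖ := by
          gcongr
          refine h1.trans ?_
          gcongr
      _ = _ := by ring
  have hp : 0 ≤ 1 / (2 * Real.pi) ^ 2 := by positivity
  have := mul_le_mul_of_nonneg_left hmain hp
  nlinarith [sq_nonneg τ]
end
end
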